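/- (Yoccoz's theorem.) Let θ ∈ (0,1) be irrational and suppose the polynomial P_θ has a Siegel point at the origin, i.e. there exist ρ > 0 and an injective holomorphic map φ : B(0,ρ) → ℂ with φ(0) = 0 such that P_θ(φ(z)) = φ(e^{2πiθ}z) for all z ∈ B(0,ρ). Then Φ(θ) < ∞. -/

import Mathlib

open Complex Real

/-- The quadratic polynomial `P_θ(z) = z² + e^{2πiθ} z`. -/
noncomputable def Ptheta (θ : ℝ) : ℂ → ℂ :=
  fun z => z ^ 2 + Complex.exp (2 * Real.pi * Complex.I * θ) * z

/-- The sequence `θ₁ = θ`, `θ_{n+1} = {1/θ_n}` (indexed from `0`). -/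
noncomputable def brjunoSeq (θ : ℝ) : ℕ → ℝ
  | 0 => θ
  | n + 1 => Int.fract (1 / brjunoSeq θ n)

/-- The terms of the Brjuno series: `θ₁θ₂⋯θ_{n-1} log(1/θ_n)`. -/
noncomputable def brjunoTerm (θ : ℝ) (n : ℕ) : ℝ :=
  (∏ k ∈ Finset.range n, brjunoSeq θ k) * Real.log (1 / brjunoSeq θ n)

namespace YoccozBrjuno

open Topology Filter Polynomial

/-- Germs at `0` that are divisible by `z ^ n`. -/
def vanishing (n : ℕ) : Submodule ℂ (ℂ → ℂ) where
  carrier := {u | ∃ w : ℂ → ℂ, AnalyticAt ℂ w 0 ∧ u =ᶠ[𝓝 0] fun z => z ^ n * w z}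
  add_mem' := by
    rintro a b ⟨w, hw, h⟩ ⟨w', hw', h'⟩
    refine ⟨fun z => w z + w' z, hw.add hw', ?_⟩
    filter_upwards [h, h'] with z h1 h2
    simp only [Pi.add_apply, h1, h2]; ring
  zero_mem' := ⟨fun _ => 0, analyticAt_const, by
    filter_upwards with z; simp⟩
  smul_mem' := by
    rintro c a ⟨w, hw, h⟩
    refine ⟨fun z => c * w z, analyticAt_const.mul hw, ?_⟩
    filter_upwards [h] with z h1
    simp only [Pi.smul_apply, h1, smul_eq_mul]; ring

theorem mem_vanishing {n : ℕ} {u : ℂ → ℂ} : u ∈ vanishing n ↔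
    ∃ w : ℂ → ℂ, AnalyticAt ℂ w 0 ∧ u =ᶠ[𝓝 0] fun z => z ^ n * w z := Iff.rfl

theorem vanishing_zero {u : ℂ → ℂ} : u ∈ vanishing 0 ↔ AnalyticAt ℂ u 0 := by
  constructor
  · rintro ⟨w, hw, h⟩
    exact hw.congr (by filter_upwards [h] with z hz; simp [hz])
  · intro h
    exact ⟨u, h, by filter_upwards with z; simp⟩

theorem vanishing_congr {n : ℕ} {u v : ℂ → ℂ} (hu : u ∈ vanishing n) (h : v =ᶠ[𝓝 0] u) :
    v ∈ vanishing n := by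
  obtain ⟨w, hw, h'⟩ := hu
  exact ⟨w, hw, h.trans h'⟩

theorem vanishing_analyticAt {n : ℕ} {u : ℂ → ℂ} (hu : u ∈ vanishing n) : AnalyticAt ℂ u 0 := by
  obtain ⟨w, hw, h'⟩ := hu
  have : AnalyticAt ℂ (fun z => z ^ n * w z) 0 := by fun_prop
  exact this.congr h'.symm

theorem vanishing_of_eventually_zero {u : ℂ → ℂ} (n : ℕ) (h : u =ᶠ[𝓝 0] 0) : u ∈ vanishing n :=
  vanishing_congr (vanishing n).zero_mem h

theorem vanishing_mul {m n : ℕ} {u v : ℂ → ℂ} (hu : u ∈ vanishing m) (hv : v ∈ vanishing n) :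
    (fun z => u z * v z) ∈ vanishing (m + n) := by
  obtain ⟨w, hw, h⟩ := hu
  obtain ⟨w', hw', h'⟩ := hv
  refine ⟨fun z => w z * w' z, hw.mul hw', ?_⟩
  filter_upwards [h, h'] with z h1 h2
  rw [h1, h2]; ring

theorem vanishing_pow_self (n : ℕ) : (fun z : ℂ => z ^ n) ∈ vanishing n :=
  ⟨fun _ => 1, analyticAt_const, by filter_upwards with z; simp⟩

theorem vanishing_mono {m n : ℕ} (h : m ≤ n) : vanishing n ≤ vanishing m := by
  rintro u ⟨w, hw, hu⟩
  refine ⟨fun z => z ^ (n - m) * w z, by fun_prop, ?_⟩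
  filter_upwards [hu] with z hz
  rw [hz, ← mul_assoc, ← pow_add, Nat.add_sub_cancel' h]

theorem analyticAt_dslope {u : ℂ → ℂ} {a b : ℂ} (hu : AnalyticAt ℂ u b) :
    AnalyticAt ℂ (dslope u a) b := by
  rw [analyticAt_iff_eventually_differentiableAt] at hu ⊢
  rcases eq_or_ne b a with rfl | hb
  · obtain ⟨s, hs, hd⟩ := eventually_iff_exists_mem.mp hu
    have h2 : DifferentiableOn ℂ (dslope u b) s :=
      (Complex.differentiableOn_dslope hs).2 fun z hz => (hd z hz).differentiableWithinAt
    have := eventually_mem_nhds_iff.mpr hs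
    filter_upwards [this] with z hz
    exact h2.differentiableAt hz
  · filter_upwards [hu, isOpen_ne.mem_nhds hb] with z hz hne
    exact (differentiableAt_dslope_of_ne hne).2 hz

theorem eq_mul_dslope {u : ℂ → ℂ} (h0 : u 0 = 0) (z : ℂ) : u z = z * dslope u 0 z := by
  have := sub_smul_dslope u 0 z
  simp only [sub_zero, smul_eq_mul, h0] at this
  exact this.symm

theorem vanishing_one {u : ℂ → ℂ} : u ∈ vanishing 1 ↔ AnalyticAt ℂ u 0 ∧ u 0 = 0 := by
  constructor
  · intro h
    refine ⟨vanishing_analyticAt h, ?_⟩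
    obtain ⟨w, hw, h⟩ := h
    simpa using h.self_of_nhds
  · rintro ⟨h, h0⟩
    refine ⟨dslope u 0, analyticAt_dslope h, ?_⟩
    filter_upwards with z
    rw [pow_one]; exact eq_mul_dslope h0 z

theorem mul_vanishing_succ {n : ℕ} {w : ℂ → ℂ} (hw : AnalyticAt ℂ w 0) (h0 : w 0 = 0) :
    (fun z => z ^ n * w z) ∈ vanishing (n + 1) :=
  vanishing_mul (vanishing_pow_self n) (vanishing_one.2 ⟨hw, h0⟩)

theorem vanishing_two {u : ℂ → ℂ} (h : AnalyticAt ℂ u 0) (h0 : u 0 = 0) (h1 : deriv u 0 = 0) :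
    u ∈ vanishing 2 := by
  have := mul_vanishing_succ (n := 1) (w := dslope u 0) (analyticAt_dslope h) (by simpa using h1)
  refine vanishing_congr this ?_
  filter_upwards with z
  rw [pow_one]; exact eq_mul_dslope h0 z

/-- The coefficient of `z ^ n` in the Taylor expansion at `0`. -/
noncomputable def coef (n : ℕ) (u : ℂ → ℂ) : ℂ := iteratedDeriv n u 0 / (n.factorial : ℂ)

theorem coef_congr {n : ℕ} {u v : ℂ → ℂ} (h : u =ᶠ[𝓝 0] v) : coef n u = coef n v := by
  rw [coef, coef, h.iteratedDeriv_eq]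

theorem coef_add {n : ℕ} {u v : ℂ → ℂ} (hu : AnalyticAt ℂ u 0) (hv : AnalyticAt ℂ v 0) :
    coef n (u + v) = coef n u + coef n v := by
  rw [coef, coef, coef, iteratedDeriv_add (hu.contDiffAt) (hv.contDiffAt), add_div]

theorem coef_smul {n : ℕ} {u : ℂ → ℂ} (c : ℂ) (hu : AnalyticAt ℂ u 0) :
    coef n (c • u) = c * coef n u := by
  rw [coef, coef, iteratedDeriv_const_smul hu.contDiffAt c]
  simp [mul_div_assoc]

theorem coef_sub {n : ℕ} {u v : ℂ → ℂ} (hu : AnalyticAt ℂ u 0) (hv : AnalyticAt ℂ v 0) :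
    coef n (u - v) = coef n u - coef n v := by
  rw [coef, coef, coef, iteratedDeriv_sub (hu.contDiffAt) (hv.contDiffAt), sub_div]

theorem coef_pow_mul {n : ℕ} {w : ℂ → ℂ} (hw : AnalyticAt ℂ w 0) :
    coef n (fun z => z ^ n * w z) = w 0 := by
  have h1 : iteratedDeriv n (fun z => z ^ n * w z) 0 = n.factorial * w 0 := by
    have := iteratedDeriv_mul (n := n) (x := (0 : ℂ)) (f := fun z : ℂ => z ^ n) (g := w)
      (by fun_prop) hw.contDiffAt
    have h2 : iteratedDeriv n (fun z => z ^ n * w z) 0 =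
      iteratedDeriv n ((fun z : ℂ => z ^ n) * w) 0 := rfl
    rw [h2, this, Finset.sum_eq_single n]
    · simp [iteratedDeriv_eq_iterate, Nat.descFactorial_self]
    · intro i hi hne
      have : i < n := lt_of_le_of_ne (by simpa [Nat.lt_succ_iff] using hi) hne
      simp [iteratedDeriv_eq_iterate, Nat.sub_ne_zero_of_lt this]
    · simp
  rw [coef, h1]
  field_simp [Nat.factorial_ne_zero]

theorem coef_of_eventuallyEq {n : ℕ} {u w : ℂ → ℂ} (hw : AnalyticAt ℂ w 0)
    (h : u =ᶠ[𝓝 0] fun z => z ^ n * w z) : coef n u = w 0 := by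
  rw [coef_congr h, coef_pow_mul hw]

theorem coef_vanishing_succ {n : ℕ} {u : ℂ → ℂ} (hu : u ∈ vanishing (n + 1)) : coef n u = 0 := by
  obtain ⟨w, hw, h⟩ := hu
  rw [coef_of_eventuallyEq (w := fun z => z * w z) (by fun_prop)]
  · simp
  · filter_upwards [h] with z hz
    rw [hz]; ring

theorem coef_pow_self (n : ℕ) : coef n (fun z => z ^ n) = 1 := by
  have := coef_pow_mul (n := n) (w := fun _ => 1) analyticAt_const
  simpa using this

theorem sub_coef_mem {n : ℕ} {u : ℂ → ℂ} (hu : u ∈ vanishing n) :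
    (fun z => u z - coef n u * z ^ n) ∈ vanishing (n + 1) := by
  obtain ⟨w, hw, h⟩ := hu
  rw [coef_of_eventuallyEq hw h]
  have h1 : (fun z => z ^ n * (w z - w 0)) ∈ vanishing (n + 1) :=
    mul_vanishing_succ (w := fun z => w z - w 0) (by fun_prop) (by simp)
  refine vanishing_congr h1 ?_
  filter_upwards [h] with z hz
  rw [hz]; ring

theorem deriv_mem_vanishing {n : ℕ} {u : ℂ → ℂ} (hu : u ∈ vanishing (n + 1)) :
    deriv u ∈ vanishing n := by
  obtain ⟨w, hw, h⟩ := hu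
  refine ⟨fun z => (n + 1) * w z + z * deriv w z, ?_, ?_⟩
  · have := hw.deriv
    fun_prop
  · filter_upwards [h.deriv, hw.eventually_analyticAt] with z hz hwz
    rw [hz]
    have h1 : HasDerivAt (fun z => z ^ (n + 1) * w z)
        (((n + 1 : ℕ) * z ^ n) * w z + z ^ (n + 1) * deriv w z) z := (hasDerivAt_pow (n + 1) z).fun_mul hwz.differentiableAt.hasDerivAt
    rw [h1.deriv]; push_cast; ring

/-- Composition with a germ fixing `0`. -/
theorem comp_mem_vanishing {n : ℕ} {u f : ℂ → ℂ} (hu : u ∈ vanishing n) (hf : f ∈ vanishing 1) :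
    u ∘ f ∈ vanishing n := by
  obtain ⟨hfa, hf0⟩ := vanishing_one.1 hf
  obtain ⟨w, hw, h⟩ := hu
  refine ⟨fun z => (dslope f 0 z) ^ n * w (f z), ?_, ?_⟩
  · have h1 := analyticAt_dslope (a := 0) hfa
    have h2 : AnalyticAt ℂ (fun z => w (f z)) 0 := AnalyticAt.fun_comp (by rwa [hf0]) hfa
    exact (h1.fun_pow n).fun_mul h2
  · have ht : Tendsto f (𝓝 0) (𝓝 0) := by
      have := hfa.continuousAt.tendsto; rwa [hf0] at this
    filter_upwards [ht.eventually h] with z hz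
    rw [Function.comp_apply, hz]
    nth_rewrite 1 [eq_mul_dslope hf0 z]
    rw [mul_pow]; ring

theorem coef_comp {n : ℕ} {u f : ℂ → ℂ} (hu : u ∈ vanishing n) (hf : f ∈ vanishing 1) :
    coef n (u ∘ f) = (deriv f 0) ^ n * coef n u := by
  obtain ⟨hfa, hf0⟩ := vanishing_one.1 hf
  obtain ⟨w, hw, h⟩ := hu
  have h1 := analyticAt_dslope (a := 0) hfa
  have h2 : AnalyticAt ℂ (fun z => w (f z)) 0 := AnalyticAt.fun_comp (by rwa [hf0]) hfa
  rw [coef_of_eventuallyEq hw h,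
    coef_of_eventuallyEq (w := fun z => (dslope f 0 z) ^ n * w (f z)) ((h1.fun_pow n).fun_mul h2)]
  · simp [hf0]
  · have ht : Tendsto f (𝓝 0) (𝓝 0) := by
      have := hfa.continuousAt.tendsto; rwa [hf0] at this
    filter_upwards [ht.eventually h] with z hz
    rw [Function.comp_apply, hz]
    nth_rewrite 1 [eq_mul_dslope hf0 z]
    rw [mul_pow]; ring

end YoccozBrjuno

namespace YoccozBrjuno

open Topology Filter Polynomial

/-- The composition operator `v ↦ v ∘ f`. -/
noncomputable def compOp (f : ℂ → ℂ) : Module.End ℂ (ℂ → ℂ) := LinearMap.funLeft ℂ ℂ f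

theorem compOp_apply (f v : ℂ → ℂ) : compOp f v = v ∘ f := rfl

theorem compOp_pow_apply (f v : ℂ → ℂ) (k : ℕ) : (compOp f ^ k) v = v ∘ f^[k] := by
  induction k with
  | zero => rfl
  | succ k ih => rw [pow_succ', Module.End.mul_apply, ih, compOp_apply, Function.iterate_succ]; rfl

/-- The polynomial `c` in the composition operator of `f`, applied to `v`. -/
noncomputable def act (f : ℂ → ℂ) (c : ℂ[X]) (v : ℂ → ℂ) : ℂ → ℂ := aeval (compOp f) c v

theorem act_apply (f : ℂ → ℂ) (c : ℂ[X]) (v : ℂ → ℂ) (z : ℂ) :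
    act f c v z = c.sum fun k a => a * v (f^[k] z) := by
  rw [act, aeval_eq_sum_range, Polynomial.sum_over_range _ (by simp)]
  simp [LinearMap.sum_apply, compOp_pow_apply]

theorem act_mul (f : ℂ → ℂ) (c d : ℂ[X]) (v : ℂ → ℂ) : act f (c * d) v = act f c (act f d v) := by
  simp [act]

theorem act_add_left (f : ℂ → ℂ) (c d : ℂ[X]) (v : ℂ → ℂ) :
    act f (c + d) v = act f c v + act f d v := by
  simp [act]

theorem act_add (f : ℂ → ℂ) (c : ℂ[X]) (u v : ℂ → ℂ) :
    act f c (u + v) = act f c u + act f c v := by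
  simp [act]

theorem act_smul (f : ℂ → ℂ) (c : ℂ[X]) (a : ℂ) (v : ℂ → ℂ) :
    act f c (a • v) = a • act f c v := by
  simp [act]

theorem act_C (f : ℂ → ℂ) (a : ℂ) (v : ℂ → ℂ) : act f (C a) v = a • v := by
  simp [act, Module.algebraMap_end_apply]

theorem act_X (f : ℂ → ℂ) (v : ℂ → ℂ) : act f X v = v ∘ f := by
  simp [act, compOp_apply]

theorem act_X_sub_C (f : ℂ → ℂ) (a : ℂ) (v : ℂ → ℂ) : act f (X - C a) v = v ∘ f - a • v := by
  simp [act, compOp_apply, Module.algebraMap_end_apply]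

theorem act_comp (f : ℂ → ℂ) (c : ℂ[X]) (v : ℂ → ℂ) : act f c (v ∘ f) = act f c v ∘ f := by
  rw [← act_X, ← act_mul, mul_comm, act_mul, act_X]

theorem act_mem_vanishing {f : ℂ → ℂ} (hf : f ∈ vanishing 1) (c : ℂ[X]) {n : ℕ} {v : ℂ → ℂ}
    (hv : v ∈ vanishing n) : act f c v ∈ vanishing n := by
  induction c using Polynomial.induction_on' with
  | add p q hp hq => rw [act_add_left]; exact (vanishing n).add_mem hp hq
  | monomial k a =>
    rw [← C_mul_X_pow_eq_monomial, act_mul, act_C]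
    refine (vanishing n).smul_mem _ ?_
    induction k with
    | zero => simpa [act] using hv
    | succ k ih => rw [pow_succ', act_mul, act_X]; exact comp_mem_vanishing ih hf

theorem coef_act {f : ℂ → ℂ} (hf : f ∈ vanishing 1) (c : ℂ[X]) {n : ℕ} {v : ℂ → ℂ}
    (hv : v ∈ vanishing n) : coef n (act f c v) = c.eval (deriv f 0 ^ n) * coef n v := by
  induction c using Polynomial.induction_on' with
  | add p q hp hq =>
    rw [act_add_left, coef_add (vanishing_analyticAt (act_mem_vanishing hf p hv))
      (vanishing_analyticAt (act_mem_vanishing hf q hv)), hp, hq, eval_add, add_mul]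
  | monomial k a =>
    rw [← C_mul_X_pow_eq_monomial, act_mul, act_C,
      coef_smul _ (vanishing_analyticAt (act_mem_vanishing hf _ hv))]
    suffices coef n (act f (X ^ k) v) = (deriv f 0 ^ n) ^ k * coef n v by
      rw [this]; simp [mul_assoc]
    induction k with
    | zero => simp [act]
    | succ k ih =>
      rw [pow_succ', act_mul, act_X, coef_comp (act_mem_vanishing hf _ hv) hf, ih]; ring

theorem iterate_eventually_semiconj {f g ψ : ℂ → ℂ} (hf : f ∈ vanishing 1)
    (h : ψ ∘ f =ᶠ[𝓝 0] g ∘ ψ) (k : ℕ) : (ψ ∘ f^[k]) =ᶠ[𝓝 0] (g^[k] ∘ ψ) := by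
  obtain ⟨hfa, hf0⟩ := vanishing_one.1 hf
  have ht : Tendsto f (𝓝 0) (𝓝 0) := by
    have := hfa.continuousAt.tendsto; rwa [hf0] at this
  induction k with
  | zero => rfl
  | succ k ih =>
    filter_upwards [ht.eventually ih, h] with z h1 h2
    simp only [Function.comp_apply, Function.iterate_succ] at *
    rw [h1, h2]

theorem act_semiconj {f g ψ : ℂ → ℂ} (hf : f ∈ vanishing 1)
    (h : ψ ∘ f =ᶠ[𝓝 0] g ∘ ψ) (c : ℂ[X]) (v : ℂ → ℂ) :
    act f c (v ∘ ψ) =ᶠ[𝓝 0] act g c v ∘ ψ := by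
  have : ∀ᶠ z in 𝓝 0, ∀ k ∈ c.support, ψ (f^[k] z) = g^[k] (ψ z) := by
    rw [Filter.eventually_all_finset]
    intro k _
    exact iterate_eventually_semiconj hf h k
  filter_upwards [this] with z hz
  rw [Function.comp_apply, act_apply, act_apply, Polynomial.sum, Polynomial.sum]
  refine Finset.sum_congr rfl fun k hk => ?_
  rw [Function.comp_apply, hz k hk]

/-- The polynomial annihilating the eigenvalues `l ^ j`, `1 ≤ j < n`. -/
noncomputable def filt (l : ℂ) (n : ℕ) : ℂ[X] := ∏ j ∈ Finset.Ico 1 n, (X - C (l ^ j))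

/-- The value of `filt l n` at `l ^ n`. -/
noncomputable def nrm (l : ℂ) (n : ℕ) : ℂ := ∏ j ∈ Finset.Ico 1 n, (l ^ n - l ^ j)

theorem filt_eval (l : ℂ) (n : ℕ) : (filt l n).eval (l ^ n) = nrm l n := by
  simp [filt, nrm, eval_prod]

theorem filt_succ (l : ℂ) {n : ℕ} (hn : 1 ≤ n) : filt l (n + 1) = (X - C (l ^ n)) * filt l n := by
  rw [filt, Finset.prod_Ico_succ_top hn, mul_comm]; rfl

theorem filt_one (l : ℂ) : filt l 1 = 1 := by simp [filt]

theorem nrm_ne_zero {l : ℂ} {n : ℕ} (hl : ∀ j ∈ Finset.Ico 1 n, l ^ n ≠ l ^ j) : nrm l n ≠ 0 :=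
  Finset.prod_ne_zero_iff.2 fun j hj => sub_ne_zero.2 (hl j hj)

theorem act_filt_mem {f : ℂ → ℂ} (hf : f ∈ vanishing 1) {n : ℕ} (hn : 1 ≤ n) {v : ℂ → ℂ}
    (hv : v ∈ vanishing 1) : act f (filt (deriv f 0) n) v ∈ vanishing n := by
  induction n, hn using Nat.le_induction with
  | base => rw [filt_one]; simpa [act] using hv
  | succ n hn ih =>
    rw [filt_succ _ hn, act_mul, act_X_sub_C]
    set u := act f (filt (deriv f 0) n) v
    have h1 := sub_coef_mem (comp_mem_vanishing ih hf)
    have h2 := sub_coef_mem ih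
    rw [coef_comp ih hf] at h1
    have h3 := (vanishing (n + 1)).sub_mem h1 ((vanishing (n + 1)).smul_mem (deriv f 0 ^ n) h2)
    convert h3 using 1
    ext z
    simp only [Pi.sub_apply, Pi.smul_apply, smul_eq_mul]
    ring

/-- The `n`-th Taylor coefficient of `v` in the linearizing coordinate of `f`. -/
noncomputable def gam (l : ℂ) (n : ℕ) (f v : ℂ → ℂ) : ℂ := coef n (act f (filt l n) v) / nrm l n

section

variable {l : ℂ} {n : ℕ} {f : ℂ → ℂ}

theorem coef_act_mul_filt (hf : f ∈ vanishing 1) (hl : deriv f 0 = l) (hn : 1 ≤ n)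
    (hnl : nrm l n ≠ 0) (d : ℂ[X]) {v : ℂ → ℂ} (hv : v ∈ vanishing 1) :
    coef n (act f (d * filt l n) v) = (d * filt l n).eval (l ^ n) * gam l n f v := by
  subst hl
  rw [act_mul, coef_act hf _ (act_filt_mem hf hn hv), eval_mul, filt_eval, gam]
  field_simp

theorem act_mul_filt_mem (hf : f ∈ vanishing 1) (hl : deriv f 0 = l) (hn : 1 ≤ n)
    (d : ℂ[X]) {v : ℂ → ℂ} (hv : v ∈ vanishing 1) :
    act f (d * filt l n) v ∈ vanishing n := by
  subst hl
  rw [act_mul]; exact act_mem_vanishing hf _ (act_filt_mem hf hn hv)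

theorem gam_add (hf : f ∈ vanishing 1) {u v : ℂ → ℂ} (hu : u ∈ vanishing 1)
    (hv : v ∈ vanishing 1) : gam l n f (u + v) = gam l n f u + gam l n f v := by
  rw [gam, act_add, coef_add (vanishing_analyticAt (act_mem_vanishing hf _ hu))
    (vanishing_analyticAt (act_mem_vanishing hf _ hv)), add_div]; rfl

theorem gam_smul (hf : f ∈ vanishing 1) (a : ℂ) {v : ℂ → ℂ}
    (hv : v ∈ vanishing 1) : gam l n f (a • v) = a * gam l n f v := by
  rw [gam, act_smul, coef_smul _ (vanishing_analyticAt (act_mem_vanishing hf _ hv)),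
    mul_div_assoc]; rfl

theorem gam_vanishing_succ (hf : f ∈ vanishing 1) {v : ℂ → ℂ}
    (hv : v ∈ vanishing (n + 1)) : gam l n f v = 0 := by
  rw [gam, coef_vanishing_succ (act_mem_vanishing hf _ hv), zero_div]

theorem gam_congr (hf : f ∈ vanishing 1) {u v : ℂ → ℂ} (hu : u ∈ vanishing 1)
    (h : u - v ∈ vanishing (n + 1)) : gam l n f v = gam l n f u := by
  have h1 : v = u + (-1 : ℂ) • (u - v) := by
    ext z; simp
  have h2 : u - v ∈ vanishing 1 := vanishing_mono (by omega) h
  rw [h1, gam_add hf hu ((vanishing 1).smul_mem _ h2), gam_smul hf _ h2, gam_vanishing_succ hf h]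
  simp

theorem gam_eventually_congr (hf : f ∈ vanishing 1) {u v : ℂ → ℂ} (hu : u ∈ vanishing 1)
    (h : u =ᶠ[𝓝 0] v) : gam l n f v = gam l n f u :=
  gam_congr hf hu (vanishing_of_eventually_zero _ (by
    filter_upwards [h] with z hz; simp [hz]))

theorem gam_vanishing (hf : f ∈ vanishing 1) (hl : deriv f 0 = l) (hnl : nrm l n ≠ 0) {v : ℂ → ℂ}
    (hv : v ∈ vanishing n) : gam l n f v = coef n v := by
  subst hl
  rw [gam, coef_act hf _ hv, filt_eval, mul_div_cancel_left₀ _ hnl]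

theorem gam_comp (hf : f ∈ vanishing 1) (hl : deriv f 0 = l) (hn : 1 ≤ n) {v : ℂ → ℂ}
    (hv : v ∈ vanishing 1) : gam l n f (v ∘ f) = l ^ n * gam l n f v := by
  subst hl
  rw [gam, act_comp, coef_comp (act_filt_mem hf hn hv) hf, mul_div_assoc]; rfl

theorem gam_semiconj {g ψ : ℂ → ℂ} (hf : f ∈ vanishing 1) (hg : g ∈ vanishing 1)
    (hψ : ψ ∈ vanishing 1) (hl : deriv g 0 = l) (hn : 1 ≤ n) (h : ψ ∘ f =ᶠ[𝓝 0] g ∘ ψ)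
    {v : ℂ → ℂ} (hv : v ∈ vanishing 1) :
    gam l n f (v ∘ ψ) = deriv ψ 0 ^ n * gam l n g v := by
  subst hl
  rw [gam, coef_congr (act_semiconj hf h _ v), coef_comp (act_filt_mem hg hn hv) hψ,
    mul_div_assoc]; rfl

end

end YoccozBrjuno

namespace YoccozBrjuno

open Topology Filter Polynomial

/-- Directional derivative of a function of two complex variables. -/
noncomputable def dirD (a : ℂ × ℂ) (u : ℂ × ℂ → ℂ) : ℂ × ℂ → ℂ := fun x => fderiv ℂ u x a

theorem analyticAt_dirD (a : ℂ × ℂ) {u : ℂ × ℂ → ℂ} {x : ℂ × ℂ} (hu : AnalyticAt ℂ u x) :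
    AnalyticAt ℂ (dirD a u) x := by
  have h1 := hu.fderiv
  exact ((ContinuousLinearMap.apply ℂ ℂ a).analyticAt _).comp h1

theorem analyticAt_dirD_iterate (a : ℂ × ℂ) {u : ℂ × ℂ → ℂ} {x : ℂ × ℂ} (hu : AnalyticAt ℂ u x)
    (n : ℕ) : AnalyticAt ℂ ((dirD a)^[n] u) x := by
  induction n with
  | zero => exact hu
  | succ n ih => rw [Function.iterate_succ_apply']; exact analyticAt_dirD a ih

theorem dirD_congr (a : ℂ × ℂ) {u v : ℂ × ℂ → ℂ} {x : ℂ × ℂ} (h : u =ᶠ[𝓝 x] v) :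
    dirD a u =ᶠ[𝓝 x] dirD a v := by
  filter_upwards [h.fderiv (𝕜 := ℂ)] with y hy
  simp [dirD, hy]

theorem dirD_comm_apply (a b : ℂ × ℂ) {u : ℂ × ℂ → ℂ} {x : ℂ × ℂ} (hu : AnalyticAt ℂ u x) :
    dirD a (dirD b u) x = dirD b (dirD a u) x := by
  have hs := (hu.contDiffAt (n := ⊤)).isSymmSndFDerivAt_of_omega
  have key : ∀ c d : ℂ × ℂ, dirD c (dirD d u) x = fderiv ℂ (fderiv ℂ u) x c d := by
    intro c d
    have h1 : HasFDerivAt (fderiv ℂ u) (fderiv ℂ (fderiv ℂ u) x) x :=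
      hu.fderiv.differentiableAt.hasFDerivAt
    have h2 := ((ContinuousLinearMap.apply ℂ ℂ d).hasFDerivAt (x := fderiv ℂ u x)).comp x h1
    have h3 : HasFDerivAt (dirD d u) ((ContinuousLinearMap.apply ℂ ℂ d).comp
      (fderiv ℂ (fderiv ℂ u) x)) x := h2
    rw [dirD, h3.fderiv]; rfl
  rw [key, key]
  exact hs a b

theorem dirD_iterate_comm (a b : ℂ × ℂ) {u : ℂ × ℂ → ℂ} (n : ℕ) {x : ℂ × ℂ}
    (hu : AnalyticAt ℂ u x) :
    dirD a ((dirD b)^[n] u) x = (dirD b)^[n] (dirD a u) x := by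
  induction n generalizing x with
  | zero => rfl
  | succ n ih =>
    rw [Function.iterate_succ_apply', Function.iterate_succ_apply',
      dirD_comm_apply _ _ (analyticAt_dirD_iterate b hu n)]
    refine (dirD_congr b ?_).self_of_nhds
    filter_upwards [hu.eventually_analyticAt] with y hy
    exact ih hy

theorem hasDerivAt_snd {u : ℂ × ℂ → ℂ} {x : ℂ × ℂ} (hu : AnalyticAt ℂ u x) :
    HasDerivAt (fun z => u (x.1, z)) (dirD (0, 1) u x) x.2 := by
  have h1 : HasFDerivAt u (fderiv ℂ u x) (x.1, x.2) := hu.differentiableAt.hasFDerivAt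
  have h2 : HasDerivAt (fun z : ℂ => (x.1, z)) ((0 : ℂ), (1 : ℂ)) x.2 :=
    (hasDerivAt_const x.2 x.1).prodMk (hasDerivAt_id x.2)
  exact h1.comp_hasDerivAt x.2 h2

theorem hasDerivAt_fst {u : ℂ × ℂ → ℂ} {x : ℂ × ℂ} (hu : AnalyticAt ℂ u x) :
    HasDerivAt (fun t => u (t, x.2)) (dirD (1, 0) u x) x.1 := by
  have h1 : HasFDerivAt u (fderiv ℂ u x) (x.1, x.2) := hu.differentiableAt.hasFDerivAt
  have h2 : HasDerivAt (fun t : ℂ => (t, x.2)) ((1 : ℂ), (0 : ℂ)) x.1 :=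
    (hasDerivAt_id x.1).prodMk (hasDerivAt_const x.1 x.2)
  exact h1.comp_hasDerivAt x.1 h2

theorem iteratedDeriv_snd {u : ℂ × ℂ → ℂ} (n : ℕ) {x : ℂ × ℂ} (hu : AnalyticAt ℂ u x) :
    iteratedDeriv n (fun z => u (x.1, z)) x.2 = (dirD (0, 1))^[n] u x := by
  induction n generalizing x with
  | zero => simp
  | succ n ih =>
    rw [iteratedDeriv_succ, Function.iterate_succ_apply']
    rw [← (hasDerivAt_snd (analyticAt_dirD_iterate (0, 1) hu n)).deriv]
    refine Filter.EventuallyEq.deriv_eq ?_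
    have ht : Tendsto (fun z : ℂ => (x.1, z)) (𝓝 x.2) (𝓝 x) := by
      have : Continuous (fun z : ℂ => (x.1, z)) := by fun_prop
      exact this.tendsto' _ _ rfl
    filter_upwards [ht.eventually hu.eventually_analyticAt] with z hz
    exact ih (x := (x.1, z)) hz

theorem coef_param_eventually {u : ℂ × ℂ → ℂ} (n : ℕ) {t₀ : ℂ} (hu : AnalyticAt ℂ u (t₀, 0)) :
    (fun t => coef n (fun z => u (t, z))) =ᶠ[𝓝 t₀]
      fun t => (dirD (0, 1))^[n] u (t, 0) / (n.factorial : ℂ) := by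
  have ht : Tendsto (fun t : ℂ => (t, (0 : ℂ))) (𝓝 t₀) (𝓝 (t₀, 0)) := by
    have : Continuous (fun t : ℂ => (t, (0 : ℂ))) := by fun_prop
    exact this.tendsto' _ _ rfl
  filter_upwards [ht.eventually hu.eventually_analyticAt] with t hz
  rw [coef, iteratedDeriv_snd (x := (t, 0)) n hz]

theorem hasDerivAt_coef_param {u : ℂ × ℂ → ℂ} (n : ℕ) {t₀ : ℂ} (hu : AnalyticAt ℂ u (t₀, 0)) :
    HasDerivAt (fun t => coef n (fun z => u (t, z))) (coef n (fun z => dirD (1, 0) u (t₀, z)))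
      t₀ := by
  have h1 := (hasDerivAt_fst (analyticAt_dirD_iterate (0, 1) hu n)).div_const (n.factorial : ℂ)
  have h2 := h1.congr_of_eventuallyEq (coef_param_eventually n hu)
  have h3 : coef n (fun z => dirD (1, 0) u (t₀, z)) =
      dirD (1, 0) ((dirD (0, 1))^[n] u) (t₀, 0) / (n.factorial : ℂ) := by
    rw [coef, iteratedDeriv_snd (x := (t₀, 0)) n (analyticAt_dirD _ hu), dirD_iterate_comm _ _ _ hu]
  rw [h3]
  exact h2

end YoccozBrjuno

namespace YoccozBrjuno

open Topology Filter Polynomial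

theorem analyticAt_act_filt {F : ℂ × ℂ → ℂ} {L v : ℂ → ℂ} {t₀ : ℂ} (hF : AnalyticAt ℂ F (t₀, 0))
    (hF0 : F (t₀, 0) = 0) (hL : AnalyticAt ℂ L t₀) (hv : AnalyticAt ℂ v 0) {n : ℕ} (hn : 1 ≤ n) :
    AnalyticAt ℂ (fun x : ℂ × ℂ => act (fun z => F (x.1, z)) (filt (L x.1) n) v x.2) (t₀, 0) := by
  induction n, hn using Nat.le_induction with
  | base =>
    simp only [filt_one, act, map_one, Module.End.one_apply]
    exact AnalyticAt.fun_comp (f := Prod.snd) (x := (t₀, (0 : ℂ))) hv analyticAt_snd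
  | succ n hn ih =>
    simp only [filt_succ _ hn, act_mul, act_X_sub_C]
    have h1 : AnalyticAt ℂ (fun x : ℂ × ℂ => (x.1, F x)) (t₀, 0) := analyticAt_fst.prod hF
    have h2 := AnalyticAt.fun_comp (f := fun x : ℂ × ℂ => (x.1, F x)) (x := (t₀, (0 : ℂ)))
      (g := (fun x : ℂ × ℂ => act (fun z => F (x.1, z)) (filt (L x.1) n) v x.2))
      (by rw [hF0]; exact ih) h1
    have h3 : AnalyticAt ℂ (fun x : ℂ × ℂ => L x.1) (t₀, 0) :=
      AnalyticAt.fun_comp (f := Prod.fst) (x := (t₀, (0 : ℂ))) hL analyticAt_fst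
    exact h2.sub ((h3.pow n).mul ih)

theorem analyticAt_nrm {L : ℂ → ℂ} {t₀ : ℂ} (hL : AnalyticAt ℂ L t₀) (n : ℕ) :
    AnalyticAt ℂ (fun t => nrm (L t) n) t₀ := by
  unfold nrm
  refine Finset.analyticAt_fun_prod _ fun j _ => ?_
  exact (hL.pow n).sub (hL.pow j)

/-- The coefficient functional is differentiable with respect to parameters. -/
theorem differentiableAt_gam {F : ℂ × ℂ → ℂ} {L v : ℂ → ℂ} {t₀ : ℂ}
    (hF : AnalyticAt ℂ F (t₀, 0))
    (hF0 : F (t₀, 0) = 0) (hL : AnalyticAt ℂ L t₀) (hv : AnalyticAt ℂ v 0) {n : ℕ} (hn : 1 ≤ n)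
    (hnl : nrm (L t₀) n ≠ 0) :
    DifferentiableAt ℂ (fun t => gam (L t) n (fun z => F (t, z)) v) t₀ := by
  have h1 := hasDerivAt_coef_param n (analyticAt_act_filt hF hF0 hL hv hn)
  exact h1.differentiableAt.div (analyticAt_nrm hL n).differentiableAt hnl

/-- The first variation of the filtered iterates of `f` in the direction `H`. -/
noncomputable def dvar (l : ℂ) (f H : ℂ → ℂ) : ℕ → ℂ → ℂ
  | 0 => 0
  | 1 => 0
  | n + 2 => (fun z => deriv (act f (filt l (n + 1)) id) (f z) * H z) +
      (dvar l f H (n + 1) ∘ f - l ^ (n + 1) • dvar l f H (n + 1))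

theorem dvar_succ (l : ℂ) (f H : ℂ → ℂ) {n : ℕ} (hn : 1 ≤ n) : dvar l f H (n + 1) =
    (fun z => deriv (act f (filt l n) id) (f z) * H z) +
      (dvar l f H n ∘ f - l ^ n • dvar l f H n) := by
  obtain ⟨m, rfl⟩ := Nat.exists_eq_add_of_le' hn
  rfl

theorem dvar_add (l : ℂ) (f H K : ℂ → ℂ) {n : ℕ} (hn : 1 ≤ n) :
    dvar l f (H + K) n = dvar l f H n + dvar l f K n := by
  induction n, hn using Nat.le_induction with
  | base => simp [dvar]
  | succ n hn ih =>
    rw [dvar_succ _ _ _ hn, dvar_succ _ _ _ hn, dvar_succ _ _ _ hn, ih]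
    ext z
    simp only [Pi.add_apply, Pi.sub_apply, Function.comp_apply, Pi.smul_apply, smul_eq_mul]
    ring

theorem dvar_smul (l : ℂ) (f : ℂ → ℂ) (a : ℂ) (H : ℂ → ℂ) {n : ℕ} (hn : 1 ≤ n) :
    dvar l f (a • H) n = a • dvar l f H n := by
  induction n, hn using Nat.le_induction with
  | base => simp [dvar]
  | succ n hn ih =>
    rw [dvar_succ _ _ _ hn, dvar_succ _ _ _ hn, ih]
    ext z
    simp only [Pi.add_apply, Pi.sub_apply, Function.comp_apply, Pi.smul_apply, smul_eq_mul]
    ring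

theorem id_mem_vanishing : (id : ℂ → ℂ) ∈ vanishing 1 := by
  rw [vanishing_one]; exact ⟨analyticAt_id, rfl⟩

section

variable {l : ℂ} {n : ℕ} {f : ℂ → ℂ}

theorem deriv_act_comp_mem (hf : f ∈ vanishing 1) :
    (fun z => deriv (act f (filt l n) id) (f z)) ∈ vanishing 0 :=
  comp_mem_vanishing (deriv_mem_vanishing (act_mem_vanishing hf _ id_mem_vanishing)) hf

theorem dvar_mem_vanishing (hf : f ∈ vanishing 1) {H : ℂ → ℂ} {k : ℕ} (hH : H ∈ vanishing k)
    (hn : 1 ≤ n) : dvar l f H n ∈ vanishing k := by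
  induction n, hn using Nat.le_induction with
  | base => exact (vanishing k).zero_mem
  | succ n hn ih =>
    rw [dvar_succ _ _ _ hn]
    refine (vanishing k).add_mem ?_ ((vanishing k).sub_mem (comp_mem_vanishing ih hf)
      ((vanishing k).smul_mem _ ih))
    simpa using vanishing_mul (deriv_act_comp_mem hf) hH

theorem dvar_coboundary (hf : f ∈ vanishing 1) {v H : ℂ → ℂ}
    (hH : H = fun z => v (f z) - deriv f z * v z) (hn : 1 ≤ n) :
    dvar l f H n =ᶠ[𝓝 0] fun z => act f (filt l n) v z - deriv (act f (filt l n) id) z * v z := by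
  obtain ⟨hfa, hf0⟩ := vanishing_one.1 hf
  have ht : Tendsto f (𝓝 0) (𝓝 0) := by
    have := hfa.continuousAt.tendsto; rwa [hf0] at this
  induction n, hn using Nat.le_induction with
  | base =>
    filter_upwards with z
    simp [dvar, filt_one, act]
  | succ n hn ih =>
    have hu := vanishing_analyticAt (act_mem_vanishing hf (filt l n) id_mem_vanishing)
    rw [dvar_succ _ _ _ hn, filt_succ _ hn, act_mul, act_mul, act_X_sub_C, act_X_sub_C]
    set u := act f (filt l n) id
    filter_upwards [ih, ht.eventually ih, hu.eventually_analyticAt,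
      ht.eventually hu.eventually_analyticAt, hfa.eventually_analyticAt] with z h1 h2 h3 h4 h5
    have h6 : deriv (u ∘ f - l ^ n • u) z = deriv u (f z) * deriv f z - l ^ n * deriv u z := by
      have := (h4.differentiableAt.hasDerivAt.comp z h5.differentiableAt.hasDerivAt).sub
        (h3.differentiableAt.hasDerivAt.const_smul (l ^ n))
      rw [this.deriv, smul_eq_mul]
    rw [h6]
    simp only [Pi.add_apply, Pi.sub_apply, Function.comp_apply, Pi.smul_apply, smul_eq_mul, h1, h2]
    simp only [hH]
    ring

/-- The derivative of the `n`-th linearization coefficient of `f` in the direction `H`. -/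
noncomputable def lam (l : ℂ) (n : ℕ) (f H : ℂ → ℂ) : ℂ := coef n (dvar l f H n) / nrm l n

theorem lam_add (hf : f ∈ vanishing 1) (hn : 1 ≤ n) {H K : ℂ → ℂ} (hH : AnalyticAt ℂ H 0)
    (hK : AnalyticAt ℂ K 0) : lam l n f (H + K) = lam l n f H + lam l n f K := by
  rw [← vanishing_zero] at hH hK
  rw [lam, dvar_add _ _ _ _ hn, coef_add (vanishing_analyticAt (dvar_mem_vanishing hf hH hn))
    (vanishing_analyticAt (dvar_mem_vanishing hf hK hn)), add_div]; rfl

theorem lam_smul (hf : f ∈ vanishing 1) (hn : 1 ≤ n) (a : ℂ) {H : ℂ → ℂ} (hH : AnalyticAt ℂ H 0) :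
    lam l n f (a • H) = a * lam l n f H := by
  rw [← vanishing_zero] at hH
  rw [lam, dvar_smul _ _ _ _ hn, coef_smul _ (vanishing_analyticAt (dvar_mem_vanishing hf hH hn)),
    mul_div_assoc]; rfl

theorem lam_vanishing_succ (hf : f ∈ vanishing 1) (hn : 1 ≤ n) {H : ℂ → ℂ}
    (hH : H ∈ vanishing (n + 1)) : lam l n f H = 0 := by
  rw [lam, coef_vanishing_succ (dvar_mem_vanishing hf hH hn), zero_div]

theorem lam_congr (hf : f ∈ vanishing 1) (hn : 1 ≤ n) {H K : ℂ → ℂ} (hH : AnalyticAt ℂ H 0)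
    (h : H - K ∈ vanishing (n + 1)) : lam l n f K = lam l n f H := by
  have h1 : K = H + (-1 : ℂ) • (H - K) := by
    ext z; simp
  have h2 : AnalyticAt ℂ (H - K) 0 := vanishing_analyticAt h
  have h3 : AnalyticAt ℂ ((-1 : ℂ) • (H - K)) 0 :=
    vanishing_analyticAt ((vanishing _).smul_mem _ h)
  rw [h1, lam_add hf hn hH h3, lam_smul hf hn _ h2, lam_vanishing_succ hf hn h]
  simp

theorem lam_coboundary (hf : f ∈ vanishing 1) (hl : deriv f 0 = l) (hn : 1 ≤ n)
    {v : ℂ → ℂ} (hv : v ∈ vanishing 2) :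
    lam l n f (fun z => v (f z) - deriv f z * v z) = gam l n f v := by
  subst hl
  have hva := vanishing_analyticAt hv
  obtain ⟨m, rfl⟩ := Nat.exists_eq_add_of_le' hn
  have h1 := deriv_mem_vanishing (act_filt_mem hf hn id_mem_vanishing)
  have h2 : (fun z => deriv (act f (filt (deriv f 0) (m + 1)) id) z * v z) ∈ vanishing (m + 2) :=
    vanishing_mul h1 hv
  have h3 := act_mem_vanishing hf (filt (deriv f 0) (m + 1)) (vanishing_zero.2 hva)
  rw [lam, gam, coef_congr (dvar_coboundary hf rfl hn)]
  have h4 := coef_sub (n := m + 1) (vanishing_zero.1 h3) (vanishing_analyticAt h2)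
  rw [coef_vanishing_succ h2, sub_zero] at h4
  rw [← h4]; rfl

theorem lam_pow (hf : f ∈ vanishing 1) (hl : deriv f 0 = l) (hn : 2 ≤ n) (hnl : nrm l n ≠ 0) :
    (l ^ n - l) * lam l n f (fun z => z ^ n) = 1 := by
  obtain ⟨hfa, hf0⟩ := vanishing_one.1 hf
  have hn1 : 1 ≤ n := by omega
  have h0 := vanishing_pow_self n
  have h1 := lam_coboundary hf hl hn1 (vanishing_mono hn h0)
  rw [gam_vanishing hf hl hnl h0, coef_pow_self] at h1
  rw [← h1, ← lam_smul hf hn1 _ (vanishing_analyticAt h0)]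
  refine lam_congr hf hn1 ?_ ?_
  · have := hfa.deriv
    fun_prop
  · have h2 := sub_coef_mem (comp_mem_vanishing h0 hf)
    rw [coef_comp h0 hf, coef_pow_self, hl] at h2
    have h3 : (fun z => z ^ n * (deriv f z - l)) ∈ vanishing (n + 1) := by
      refine mul_vanishing_succ (w := fun z => deriv f z - l) ?_ (by simp [hl])
      have := hfa.deriv
      fun_prop
    convert (vanishing (n + 1)).sub_mem h2 h3 using 1
    ext z
    simp only [Pi.sub_apply, Pi.smul_apply, smul_eq_mul, Function.comp_apply]
    ring

theorem hasDerivAt_act_filt (hf : f ∈ vanishing 1) {H : ℂ → ℂ} (hH : AnalyticAt ℂ H 0)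
    (hn : 1 ≤ n) : ∀ᶠ z in 𝓝 0,
      HasDerivAt (fun t : ℂ => act (fun z => f z + t * H z) (filt l n) id z) (dvar l f H n z) 0 := by
  obtain ⟨hfa, hf0⟩ := vanishing_one.1 hf
  have ht : Tendsto f (𝓝 0) (𝓝 0) := by
    have := hfa.continuousAt.tendsto; rwa [hf0] at this
  have hF : AnalyticAt ℂ (fun x : ℂ × ℂ => f x.2 + x.1 * H x.2) (0, 0) := by
    have h1 : AnalyticAt ℂ (fun x : ℂ × ℂ => f x.2) (0, 0) :=
      AnalyticAt.fun_comp (f := Prod.snd) (x := ((0 : ℂ), (0 : ℂ))) hfa analyticAt_snd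
    have h2 : AnalyticAt ℂ (fun x : ℂ × ℂ => H x.2) (0, 0) :=
      AnalyticAt.fun_comp (f := Prod.snd) (x := ((0 : ℂ), (0 : ℂ))) hH analyticAt_snd
    exact h1.add (analyticAt_fst.mul h2)
  have hF0 : (fun x : ℂ × ℂ => f x.2 + x.1 * H x.2) (0, 0) = 0 := by simp [hf0]
  induction n, hn using Nat.le_induction with
  | base =>
    filter_upwards with z
    simpa [dvar, filt_one, act] using hasDerivAt_const (0 : ℂ) z
  | succ n hn ih =>
    have hU := analyticAt_act_filt hF hF0 (analyticAt_const (v := l)) analyticAt_id hn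
    set U := fun x : ℂ × ℂ => act (fun z => f z + x.1 * H z) (filt l n) id x.2 with hUdef
    have hc : Tendsto (fun z : ℂ => ((0 : ℂ), z)) (𝓝 0) (𝓝 (0, 0)) := by
      have : Continuous (fun z : ℂ => ((0 : ℂ), z)) := by fun_prop
      exact this.tendsto' _ _ rfl
    filter_upwards [ih, ht.eventually ih,
      (hc.comp ht).eventually hU.eventually_analyticAt] with z h1 h2 h3
    simp only [filt_succ _ hn, act_mul, act_X_sub_C]
    rw [dvar_succ _ _ _ hn]
    have h3 : AnalyticAt ℂ U (0, f z) := h3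
    have h4 : HasFDerivAt U (fderiv ℂ U (0, f z)) ((0 : ℂ), f z + 0 * H z) := by
      rw [zero_mul, add_zero]
      exact h3.differentiableAt.hasFDerivAt
    have h5 : HasDerivAt (fun t : ℂ => (t, f z + t * H z)) ((1 : ℂ), H z) 0 := by
      refine (hasDerivAt_id (0 : ℂ)).prodMk ?_
      simpa using ((hasDerivAt_id (0 : ℂ)).mul_const (H z)).const_add (f z)
    have h6 := h4.comp_hasDerivAt (0 : ℂ) h5
    have h7 : fderiv ℂ U (0, f z) (1, H z) =
        dvar l f H n (f z) + deriv (act f (filt l n) id) (f z) * H z := by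
      have e1 : ((1 : ℂ), H z) = ((1 : ℂ), (0 : ℂ)) + H z • ((0 : ℂ), (1 : ℂ)) := by simp
      have e2 := (hasDerivAt_fst h3).unique h2
      have e3 := (hasDerivAt_snd h3).deriv
      have e4 : (fun y => U ((0 : ℂ), y)) = act f (filt l n) id := by
        ext y; simp [hUdef]
      simp only [e4] at e3
      rw [e1, map_add, map_smul, smul_eq_mul, e3, ← e2, dirD, dirD]
      ring
    rw [h7] at h6
    have h8 := h6.sub (h1.const_smul (l ^ n))
    refine h8.congr_deriv ?_
    change dvar l f H n (f z) + deriv (act f (filt l n) id) (f z) * H z - l ^ n * dvar l f H n z =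
      deriv (act f (filt l n) id) (f z) * H z + (dvar l f H n (f z) - l ^ n * dvar l f H n z)
    ring

theorem hasDerivAt_gam (hf : f ∈ vanishing 1) {H : ℂ → ℂ} (hH : AnalyticAt ℂ H 0)
    (hn : 1 ≤ n) :
    HasDerivAt (fun t : ℂ => gam l n (fun z => f z + t * H z) id) (lam l n f H) 0 := by
  obtain ⟨hfa, hf0⟩ := vanishing_one.1 hf
  have hF : AnalyticAt ℂ (fun x : ℂ × ℂ => f x.2 + x.1 * H x.2) (0, 0) := by
    have h1 : AnalyticAt ℂ (fun x : ℂ × ℂ => f x.2) (0, 0) :=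
      AnalyticAt.fun_comp (f := Prod.snd) (x := ((0 : ℂ), (0 : ℂ))) hfa analyticAt_snd
    have h2 : AnalyticAt ℂ (fun x : ℂ × ℂ => H x.2) (0, 0) :=
      AnalyticAt.fun_comp (f := Prod.snd) (x := ((0 : ℂ), (0 : ℂ))) hH analyticAt_snd
    exact h1.add (analyticAt_fst.mul h2)
  have hF0 : (fun x : ℂ × ℂ => f x.2 + x.1 * H x.2) (0, 0) = 0 := by simp [hf0]
  have hU := analyticAt_act_filt hF hF0 (analyticAt_const (v := l)) analyticAt_id hn
  have h1 := (hasDerivAt_coef_param n hU).div_const (nrm l n)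
  have hc : Tendsto (fun z : ℂ => ((0 : ℂ), z)) (𝓝 0) (𝓝 (0, 0)) := by
    have : Continuous (fun z : ℂ => ((0 : ℂ), z)) := by fun_prop
    exact this.tendsto' _ _ rfl
  have h2 : (fun z => dirD (1, 0) (fun x : ℂ × ℂ =>
      act (fun z => f z + x.1 * H z) (filt l n) id x.2) (0, z)) =ᶠ[𝓝 0] dvar l f H n := by
    filter_upwards [hasDerivAt_act_filt (l := l) hf hH hn,
      hc.eventually hU.eventually_analyticAt] with z h3 h4
    exact (hasDerivAt_fst h4).unique h3
  rw [coef_congr h2] at h1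
  exact h1

end

end YoccozBrjuno

namespace YoccozBrjuno

open Topology Filter Polynomial Metric

/-- Tangent perturbations of a linear germ, with small derivative on a disc. -/
structure SmallPert (R δ : ℝ) (h : ℂ → ℂ) : Prop where
  diff : DifferentiableOn ℂ h (ball 0 R)
  zero : h 0 = 0
  deriv_zero : deriv h 0 = 0
  bound : ∀ z ∈ ball (0 : ℂ) R, ‖deriv h z‖ ≤ δ

/-- The germ with multiplier `l` and nonlinear part `h`. -/
def germ (l : ℂ) (h : ℂ → ℂ) : ℂ → ℂ := fun z => l * z + h z

/-- A uniform bound on the `n`-th coefficient functional over `SmallPert R δ`. -/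
def GamBound (l : ℂ) (n : ℕ) (R δ A : ℝ) : Prop :=
  ∀ h, SmallPert R δ h → ∀ v : ℂ → ℂ, DifferentiableOn ℂ v (ball 0 R) → v 0 = 0 →
    (∀ z ∈ ball (0 : ℂ) R, ‖v z‖ ≤ 1) → ‖gam l n (germ l h) v‖ ≤ A

theorem norm_deriv_le_of_ball {u : ℂ → ℂ} {c : ℂ} {r M : ℝ} (hr : 0 < r)
    (hd : DifferentiableOn ℂ u (ball c r)) (hM : ∀ z ∈ ball c r, ‖u z‖ ≤ M) :
    ‖deriv u c‖ ≤ 2 * M / r := by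
  have h1 : closedBall c (r / 2) ⊆ ball c r := closedBall_subset_ball (by linarith)
  have := Complex.norm_deriv_le_of_forall_mem_sphere_norm_le (c := c) (R := r / 2) (C := M)
    (f := u) (by linarith) (hd.diffContOnCl_ball h1)
    (fun z hz => hM z (h1 (sphere_subset_closedBall hz)))
  convert this using 1
  field_simp

section

variable {l : ℂ} {R δ : ℝ} {h : ℂ → ℂ}

theorem SmallPert.mono (hh : SmallPert R δ h) {R' δ' : ℝ} (hR : R' ≤ R) (hδ : δ ≤ δ') :
    SmallPert R' δ' h :=
  ⟨hh.diff.mono (ball_subset_ball hR), hh.zero, hh.deriv_zero,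
    fun z hz => (hh.bound z (ball_subset_ball hR hz)).trans hδ⟩

theorem SmallPert.analyticAt (hh : SmallPert R δ h) {z : ℂ} (hz : z ∈ ball (0 : ℂ) R) :
    AnalyticAt ℂ h z := hh.diff.analyticAt (isOpen_ball.mem_nhds hz)

theorem SmallPert.germ_analyticAt (hh : SmallPert R δ h) {z : ℂ} (hz : z ∈ ball (0 : ℂ) R) :
    AnalyticAt ℂ (germ l h) z := by
  have := hh.analyticAt hz
  unfold germ; fun_prop

theorem SmallPert.germ_diff (hh : SmallPert R δ h) :
    DifferentiableOn ℂ (germ l h) (ball 0 R) := fun _ hz =>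
  (hh.germ_analyticAt hz).differentiableAt.differentiableWithinAt

theorem SmallPert.germ_mem (hh : SmallPert R δ h) (hR : 0 < R) : germ l h ∈ vanishing 1 := by
  rw [vanishing_one]
  exact ⟨hh.germ_analyticAt (mem_ball_self hR), by simp [germ, hh.zero]⟩

theorem SmallPert.deriv_germ (hh : SmallPert R δ h) {z : ℂ} (hz : z ∈ ball (0 : ℂ) R) :
    deriv (germ l h) z = l + deriv h z := by
  have h1 : HasDerivAt (germ l h) (l * 1 + deriv h z) z :=
    ((hasDerivAt_id z).const_mul l).add (hh.analyticAt hz).differentiableAt.hasDerivAt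
  rw [h1.deriv, mul_one]

theorem SmallPert.deriv_germ_zero (hh : SmallPert R δ h) (hR : 0 < R) :
    deriv (germ l h) 0 = l := by
  rw [hh.deriv_germ (mem_ball_self hR), hh.deriv_zero, add_zero]

theorem SmallPert.lip (hh : SmallPert R δ h) {x y : ℂ} (hx : x ∈ ball (0 : ℂ) R)
    (hy : y ∈ ball (0 : ℂ) R) : ‖h y - h x‖ ≤ δ * ‖y - x‖ :=
  (convex_ball (0 : ℂ) R).norm_image_sub_le_of_norm_deriv_le
    (fun _ hz => (hh.analyticAt hz).differentiableAt) hh.bound hx hy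

theorem SmallPert.norm_le (hh : SmallPert R δ h) {y : ℂ}
    (hy : y ∈ ball (0 : ℂ) R) : ‖h y‖ ≤ δ * ‖y‖ := by
  have hR : 0 < R := (norm_nonneg y).trans_lt (by simpa using hy)
  simpa [hh.zero] using hh.lip (mem_ball_self hR) hy

theorem SmallPert.add_mul {κ : ℝ} (hR : 0 < R) (hh : SmallPert R (δ - κ) h) {H : ℂ → ℂ} {B : ℝ}
    (hH : SmallPert R B H) {t : ℂ} (ht : ‖t‖ * B ≤ κ) :
    SmallPert R δ (fun z => h z + t * H z) := by
  have hd : ∀ z ∈ ball (0 : ℂ) R,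
      HasDerivAt (fun z => h z + t * H z) (deriv h z + t * deriv H z) z := fun z hz =>
    (hh.analyticAt hz).differentiableAt.hasDerivAt.add
      ((hH.analyticAt hz).differentiableAt.hasDerivAt.const_mul t)
  refine ⟨fun z hz => (hd z hz).differentiableAt.differentiableWithinAt, ?_, ?_, ?_⟩
  · simp [hh.zero, hH.zero]
  · rw [(hd 0 (mem_ball_self hR)).deriv]; simp [hh.deriv_zero, hH.deriv_zero]
  · intro z hz
    rw [(hd z hz).deriv]
    have h1 := hh.bound z hz
    have h2 := hH.bound z hz
    have h3 : ‖t * deriv H z‖ ≤ ‖t‖ * B := by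
      rw [norm_mul]; exact mul_le_mul_of_nonneg_left h2 (norm_nonneg t)
    linarith [norm_add_le (deriv h z) (t * deriv H z)]

theorem lam_bound_of_gam_id {n : ℕ} {A κ B : ℝ} (hn : 1 ≤ n) (hnl : nrm l n ≠ 0) (hR : 0 < R)
    (hA : ∀ h, SmallPert R δ h → ‖gam l n (germ l h) id‖ ≤ A) (hκ : 0 < κ) (hh : SmallPert R (δ - κ) h) {H : ℂ → ℂ}
    (hB : 0 < B) (hH : SmallPert R B H) : ‖lam l n (germ l h) H‖ ≤ A * B / κ := by
  have h0 : (0 : ℂ) ∈ ball (0 : ℂ) R := mem_ball_self hR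
  have hfm := hh.germ_mem (l := l) hR
  have hderiv := hasDerivAt_gam (l := l) hfm (hH.analyticAt h0) hn
  have heq : ∀ t : ℂ, (fun z => germ l h z + t * H z) = germ l (fun z => h z + t * H z) := by
    intro t; ext z; simp only [germ]; ring
  have hr : 0 < κ / B := by positivity
  have hdiff : ∀ t : ℂ, DifferentiableAt ℂ
      (fun t : ℂ => gam l n (fun z => germ l h z + t * H z) id) t := by
    intro t
    refine differentiableAt_gam (F := fun x : ℂ × ℂ => germ l h x.2 + x.1 * H x.2) (L := fun _ => l)
      ?_ ?_ analyticAt_const analyticAt_id hn hnl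
    · have h1 : AnalyticAt ℂ (fun x : ℂ × ℂ => germ l h x.2) (t, 0) :=
        AnalyticAt.fun_comp (f := Prod.snd) (x := (t, (0 : ℂ))) (hh.germ_analyticAt h0)
          analyticAt_snd
      have h2 : AnalyticAt ℂ (fun x : ℂ × ℂ => H x.2) (t, 0) :=
        AnalyticAt.fun_comp (f := Prod.snd) (x := (t, (0 : ℂ))) (hH.analyticAt h0) analyticAt_snd
      exact h1.add (analyticAt_fst.mul h2)
    · simp [germ, hh.zero, hH.zero]
  have hb := Complex.norm_deriv_le_of_forall_mem_sphere_norm_le (c := (0 : ℂ)) (R := κ / B)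
    (C := A)
    (f := fun t : ℂ => gam l n (fun z => germ l h z + t * H z) id) hr
    (Differentiable.diffContOnCl fun t => hdiff t) ?_
  · rw [hderiv.deriv] at hb
    calc _ ≤ _ := hb
      _ = _ := by field_simp
  · intro t ht
    have ht' : ‖t‖ = κ / B := by simpa using ht
    have hs : SmallPert R δ (fun z => h z + t * H z) :=
      hh.add_mul hR hH (by rw [ht']; field_simp; rfl)
    rw [heq]
    exact hA _ hs

theorem lam_bound_of_gamBound {n : ℕ} {A κ B : ℝ} (hn : 1 ≤ n) (hnl : nrm l n ≠ 0) (hR : 0 < R)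
    (hR2 : R ≤ 2)
    (hA : GamBound l n R δ A) (hκ : 0 < κ) (hh : SmallPert R (δ - κ) h) {H : ℂ → ℂ}
    (hB : 0 < B) (hH : SmallPert R B H) : ‖lam l n (germ l h) H‖ ≤ 2 * A * B / κ := by
  refine lam_bound_of_gam_id hn hnl hR (fun u hu => ?_) hκ hh hB hH
  have h1 := hA _ hu (fun z => (1 / 2 : ℂ) * z) (by fun_prop) (by simp) (by
    intro z hz
    have : ‖z‖ < R := by simpa using hz
    rw [norm_mul]; norm_num; linarith)
  have h2 : (fun z => (1 / 2 : ℂ) * z) = (1 / 2 : ℂ) • (id : ℂ → ℂ) := by ext z; simp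
  rw [h2, gam_smul (hu.germ_mem hR) _ id_mem_vanishing, norm_mul] at h1
  norm_num at h1
  linarith

theorem lam_bound_of_sup {n : ℕ} {A κ M η : ℝ} (hn : 1 ≤ n) (hnl : nrm l n ≠ 0) (hR : 0 < R)
    (hR2 : R ≤ 2)
    (hA : GamBound l n R δ A) (hκ : 0 < κ) (hh : SmallPert R (δ - κ) h) {H : ℂ → ℂ}
    (hM : 0 < M) (hη : 0 < η) (hHd : DifferentiableOn ℂ H (ball 0 (R + η)))
    (hHM : ∀ z ∈ ball (0 : ℂ) (R + η), ‖H z‖ ≤ M) (hH2 : H ∈ vanishing 2) :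
    ‖lam l n (germ l h) H‖ ≤ 4 * A * M / (η * κ) := by
  have hH : SmallPert R (2 * M / η) H := by
    refine ⟨hHd.mono (ball_subset_ball (by linarith)), ?_, ?_, ?_⟩
    · exact (vanishing_one.1 (vanishing_mono (by norm_num) hH2)).2
    · exact (vanishing_one.1 (deriv_mem_vanishing hH2)).2
    · intro z hz
      have hz' : ‖z‖ < R := by simpa using hz
      have hsub : ball z η ⊆ ball 0 (R + η) := ball_subset_ball' (by
        rw [dist_zero_right]; linarith)
      exact norm_deriv_le_of_ball hη (hHd.mono hsub) fun w hw => hHM w (hsub hw)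
  have := lam_bound_of_gamBound hn hnl hR hR2 hA hκ hh (by positivity) hH
  calc _ ≤ _ := this
    _ = _ := by field_simp; ring

theorem gam_bound_of_sup {n : ℕ} {A M : ℝ} (hR : 0 < R)
    (hA : GamBound l n R δ A) (hh : SmallPert R δ h) {v : ℂ → ℂ}
    (hM : 0 < M) (hvd : DifferentiableOn ℂ v (ball 0 R))
    (hvM : ∀ z ∈ ball (0 : ℂ) R, ‖v z‖ ≤ M) (hv0 : v 0 = 0) :
    ‖gam l n (germ l h) v‖ ≤ A * M := by
  have h0 : (0 : ℂ) ∈ ball (0 : ℂ) R := mem_ball_self hR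
  have hMc : (M : ℂ) ≠ 0 := by exact_mod_cast hM.ne'
  have h1 := hA h hh (fun z => (M : ℂ)⁻¹ * v z) (by fun_prop) (by simp [hv0]) (by
    intro z hz
    rw [norm_mul, norm_inv, Complex.norm_real, Real.norm_of_nonneg hM.le]
    have := hvM z hz
    rw [inv_mul_le_iff₀ hM]; linarith)
  have h2 : (fun z => (M : ℂ)⁻¹ * v z) = (M : ℂ)⁻¹ • v := rfl
  have hv1 : v ∈ vanishing 1 := vanishing_one.2 ⟨hvd.analyticAt (isOpen_ball.mem_nhds h0), hv0⟩
  rw [h2, gam_smul (hh.germ_mem hR) _ hv1, norm_mul, norm_inv, Complex.norm_real,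
    Real.norm_of_nonneg hM.le, inv_mul_le_iff₀ hM] at h1
  linarith

end

end YoccozBrjuno

namespace YoccozBrjuno

open Topology Filter Polynomial Metric

/-- The vector field `z ^ 2 / (w - z)`. -/
noncomputable def kern (w : ℂ) : ℂ → ℂ := fun z => z ^ 2 / (w - z)

theorem analyticAt_inv_sub {w z : ℂ} (hz : z ≠ w) : AnalyticAt ℂ (fun z => (w - z)⁻¹) z := by
  have h1 : AnalyticAt ℂ (fun z => w - z) z := by fun_prop
  exact h1.inv (sub_ne_zero.2 hz.symm)

theorem pow_div_sub_mem (m : ℕ) {w : ℂ} (hw : w ≠ 0) :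
    (fun z => z ^ m / (w - z)) ∈ vanishing m :=
  ⟨fun z => (w - z)⁻¹, analyticAt_inv_sub hw.symm, by filter_upwards with z; rw [div_eq_mul_inv]⟩

theorem kern_mem {w : ℂ} (hw : w ≠ 0) : kern w ∈ vanishing 2 := pow_div_sub_mem 2 hw

section

variable {l : ℂ} {n : ℕ} {f : ℂ → ℂ}

theorem mul_mem_vanishing_of_analytic {m : ℕ} {g u : ℂ → ℂ} (hg : AnalyticAt ℂ g 0)
    (hu : u ∈ vanishing m) : (fun z => g z * u z) ∈ vanishing m := by
  simpa using vanishing_mul (vanishing_zero.2 hg) hu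

theorem lam_kern_expand (hf : f ∈ vanishing 1) (hn : 1 ≤ n) {g : ℂ → ℂ} (hg : AnalyticAt ℂ g 0)
    {w : ℂ} (hw : w ≠ 0) (m : ℕ) :
    lam l n f (fun z => g z * kern w z) =
      ∑ i ∈ Finset.range m, (w⁻¹) ^ (i + 1) * lam l n f (fun z => g z * z ^ (i + 2)) +
      (w⁻¹) ^ m * lam l n f (fun z => g z * (z ^ (m + 2) / (w - z))) := by
  induction m with
  | zero => simp; rfl
  | succ m ih =>
    rw [ih, Finset.sum_range_succ, add_assoc]
    congr 1
    have h1 : AnalyticAt ℂ (fun z => g z * z ^ (m + 2)) 0 := by fun_prop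
    have h2 : AnalyticAt ℂ (fun z => g z * (z ^ (m + 1 + 2) / (w - z))) 0 :=
      vanishing_analyticAt (mul_mem_vanishing_of_analytic hg (pow_div_sub_mem (m + 1 + 2) hw))
    have h3 : lam l n f (fun z => g z * (z ^ (m + 2) / (w - z))) =
        lam l n f (w⁻¹ • (fun z => g z * z ^ (m + 2)) +
          w⁻¹ • (fun z => g z * (z ^ (m + 1 + 2) / (w - z)))) := by
      refine lam_congr hf hn ((h1.const_smul).add (h2.const_smul)) ?_
      refine vanishing_of_eventually_zero _ ?_
      filter_upwards [isOpen_ne.mem_nhds hw.symm] with z hz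
      have hz' : w - z ≠ 0 := sub_ne_zero.2 (Ne.symm hz)
      simp only [Pi.sub_apply, Pi.add_apply, Pi.smul_apply, smul_eq_mul, Pi.zero_apply]
      field_simp
      ring
    rw [h3, lam_add hf hn h1.const_smul h2.const_smul, lam_smul hf hn _ h1, lam_smul hf hn _ h2]
    ring

theorem gam_kern_expand (hf : f ∈ vanishing 1)
    {w : ℂ} (hw : w ≠ 0) (m : ℕ) :
    gam l n f (kern w) =
      ∑ i ∈ Finset.range m, (w⁻¹) ^ (i + 1) * gam l n f (fun z => z ^ (i + 2)) +
      (w⁻¹) ^ m * gam l n f (fun z => z ^ (m + 2) / (w - z)) := by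
  induction m with
  | zero => simp; rfl
  | succ m ih =>
    rw [ih, Finset.sum_range_succ, add_assoc]
    congr 1
    have h1 : (fun z : ℂ => z ^ (m + 2)) ∈ vanishing 1 :=
      vanishing_mono (by omega) (vanishing_pow_self (m + 2))
    have h2 : (fun z => z ^ (m + 1 + 2) / (w - z)) ∈ vanishing 1 :=
      vanishing_mono (by omega) (pow_div_sub_mem (m + 1 + 2) hw)
    have h1' := (vanishing 1).smul_mem w⁻¹ h1
    have h2' := (vanishing 1).smul_mem w⁻¹ h2
    have h3 : gam l n f (fun z => z ^ (m + 2) / (w - z)) =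
        gam l n f (w⁻¹ • (fun z => z ^ (m + 2)) +
          w⁻¹ • (fun z => z ^ (m + 1 + 2) / (w - z))) := by
      refine gam_congr hf ((vanishing 1).add_mem h1' h2') ?_
      refine vanishing_of_eventually_zero _ ?_
      filter_upwards [isOpen_ne.mem_nhds hw.symm] with z hz
      have hz' : w - z ≠ 0 := sub_ne_zero.2 (Ne.symm hz)
      simp only [Pi.sub_apply, Pi.add_apply, Pi.smul_apply, smul_eq_mul, Pi.zero_apply]
      field_simp
      ring
    rw [h3, gam_add hf h1' h2', gam_smul hf _ h1, gam_smul hf _ h2]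
    ring

theorem pow_mul_sum_inv {p : ℕ} {w : ℂ} (hw : w ≠ 0) (c : ℕ → ℂ) :
    w ^ p * ∑ i ∈ Finset.range p, (w⁻¹) ^ (i + 1) * c i =
      ∑ i ∈ Finset.range p, w ^ (p - 1 - i) * c i := by
  rw [Finset.mul_sum]
  refine Finset.sum_congr rfl fun i hi => ?_
  have hi' : i < p := by simpa using hi
  have : w ^ p = w ^ (p - 1 - i) * w ^ (i + 1) := by
    rw [← pow_add]; congr 1; omega
  rw [this, inv_pow]
  field_simp

/-- Numerator of the generating function of the variation functional. -/
noncomputable def numB (l : ℂ) (p : ℕ) (f : ℂ → ℂ) (y : ℂ) : ℂ :=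
  (l ^ (p + 1) - l) * ∑ i ∈ Finset.range p,
    y ^ (p - 1 - i) * lam l (p + 1) f (fun z => deriv f z * z ^ (i + 2))

/-- Numerator of the generating function of the coefficient functional. -/
noncomputable def numD (l : ℂ) (p : ℕ) (f : ℂ → ℂ) (y : ℂ) : ℂ :=
  (l ^ (p + 1) - l) * ∑ i ∈ Finset.range p, y ^ (p - 1 - i) * gam l (p + 1) f (fun z => z ^ (i + 2))

theorem differentiable_numB (p : ℕ) : Differentiable ℂ (numB l p f) := by
  unfold numB; fun_prop

theorem differentiable_numD (p : ℕ) : Differentiable ℂ (numD l p f) := by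
  unfold numD; fun_prop

theorem numB_eq (hf : f ∈ vanishing 1) (p : ℕ) {w : ℂ} (hw : w ≠ 0) :
    numB l p f w = w ^ p * ((l ^ (p + 1) - l) * lam l (p + 1) f (fun z => deriv f z * kern w z)) := by
  have hd := (vanishing_analyticAt hf).deriv
  rw [lam_kern_expand hf (by omega) hd hw p, lam_vanishing_succ hf (by omega)
    (mul_mem_vanishing_of_analytic hd (pow_div_sub_mem (p + 2) hw)), mul_zero, add_zero,
    mul_left_comm, pow_mul_sum_inv hw]
  rfl

theorem numD_eq (hf : f ∈ vanishing 1) (p : ℕ) {w : ℂ} (hw : w ≠ 0) :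
    numD l p f w = w ^ p * ((l ^ (p + 1) - l) * gam l (p + 1) f (kern w)) := by
  rw [gam_kern_expand hf hw p, gam_vanishing_succ hf (pow_div_sub_mem (p + 2) hw), mul_zero,
    add_zero, mul_left_comm, pow_mul_sum_inv hw]
  rfl

theorem numB_zero (hf : f ∈ vanishing 1) (hl : deriv f 0 = l) {p : ℕ} (hp : 1 ≤ p)
    (hnl : nrm l (p + 1) ≠ 0) : numB l p f 0 = l := by
  have hd := (vanishing_analyticAt hf).deriv
  obtain ⟨m, rfl⟩ := Nat.exists_eq_add_of_le' hp
  rw [numB, Finset.sum_range_succ, Finset.sum_eq_zero]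
  · have h1 : lam l (m + 1 + 1) f (fun z => deriv f z * z ^ (m + 2)) =
        lam l (m + 1 + 1) f (l • fun z => z ^ (m + 2)) := by
      have ha : AnalyticAt ℂ (fun z : ℂ => z ^ (m + 2)) 0 := by fun_prop
      refine lam_congr hf (by omega) ha.const_smul ?_
      have h2 : (fun z => z ^ (m + 2) * (l - deriv f z)) ∈ vanishing (m + 2 + 1) :=
        mul_vanishing_succ (w := fun z => l - deriv f z) (by fun_prop) (by simp [hl])
      convert h2 using 1
      ext z
      simp only [Pi.sub_apply, Pi.smul_apply, smul_eq_mul]; ring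
    have h3 := lam_pow hf hl (n := m + 1 + 1) (by omega) hnl
    rw [h1, lam_smul hf (by omega) _ (by fun_prop)]
    have h4 : m + 1 - 1 - m = 0 := by omega
    rw [h4, pow_zero, zero_add, one_mul, mul_left_comm]
    have h5 : (l ^ (m + 1 + 1) - l) * lam l (m + 1 + 1) f (fun z => z ^ (m + 2)) = 1 := h3
    rw [h5, mul_one]
  · intro i hi
    have hi' : i < m := by simpa using hi
    rw [zero_pow (by omega), zero_mul]

end

end YoccozBrjuno

namespace YoccozBrjuno

open Topology Filter Polynomial Metric

/-- The size of the generating functions of the coefficient functionals. -/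
noncomputable def pot (l : ℂ) (p : ℕ) (f : ℂ → ℂ) (y : ℂ) : ℝ :=
  max ‖numB l p f y‖ ‖numD l p f y‖ / ‖y‖ ^ p

theorem pot_eq {l : ℂ} {f : ℂ → ℂ} (hf : f ∈ vanishing 1) (p : ℕ) {w : ℂ} (hw : w ≠ 0) :
    pot l p f w = ‖l ^ (p + 1) - l‖ *
      max ‖lam l (p + 1) f (fun z => deriv f z * kern w z)‖ ‖gam l (p + 1) f (kern w)‖ := by
  have h : 0 < ‖w‖ ^ p := by positivity
  rw [pot, numB_eq hf p hw, numD_eq hf p hw]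
  simp only [norm_mul, norm_pow]
  rw [← mul_max_of_nonneg _ _ h.le, ← mul_max_of_nonneg _ _ (norm_nonneg _)]
  field_simp

theorem exists_remainder {R ρ ε : ℝ} (hε : 0 < ε) {g : ℂ → ℂ} {y : ℂ} (hy : y ≠ 0) (hyR : ‖y‖ < R)
    (hρ : R + ε ≤ ρ)
    (hg : DifferentiableOn ℂ g (ball 0 ρ)) (hgy : g y = 0)
    (hg4 : ∀ z ∈ ball (0 : ℂ) ρ, ‖g z‖ ≤ 4) :
    ∃ r : ℂ → ℂ, DifferentiableOn ℂ r (ball 0 ρ) ∧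
      (∀ z ∈ ball (0 : ℂ) ρ, ‖r z‖ ≤ ‖z‖ ^ 2 * (4 / ε)) ∧ r ∈ vanishing 2 ∧
      ∀ z, z ≠ y → kern y z * g z = r z := by
  have hyρ : y ∈ ball (0 : ℂ) ρ := by simp; linarith
  have hd : DifferentiableOn ℂ (dslope g y) (ball 0 ρ) :=
    (Complex.differentiableOn_dslope (isOpen_ball.mem_nhds hyρ)).2 hg
  have hρ0 : (0 : ℂ) ∈ ball (0 : ℂ) ρ := mem_ball_self (by linarith [norm_nonneg y])
  refine ⟨fun z => z ^ 2 * (-dslope g y z), by fun_prop, ?_, ?_, ?_⟩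
  · intro z hz
    rw [norm_mul, norm_pow, norm_neg]
    refine mul_le_mul_of_nonneg_left ?_ (by positivity)
    by_cases hzy : z ∈ ball y ε
    · have hsub : ball y ε ⊆ ball 0 ρ := ball_subset_ball' (by rw [dist_zero_right]; linarith)
      refine Complex.norm_dslope_le_div_of_mapsTo_ball (hg.mono hsub) ?_ hzy
      intro x hx
      rw [hgy, mem_closedBall_zero_iff]
      exact hg4 x (hsub hx)
    · have h1 : ε ≤ ‖z - y‖ := by
        rw [mem_ball, not_lt, dist_eq_norm] at hzy; exact hzy
      have hne : z ≠ y := by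
        rintro rfl; simp at h1; linarith
      rw [dslope_of_ne _ hne, slope_def_field, hgy, sub_zero, norm_div]
      exact div_le_div₀ (by norm_num) (hg4 z hz) hε h1
  · have := vanishing_mul (vanishing_pow_self 2) (vanishing_zero.2
      (hd.analyticAt (isOpen_ball.mem_nhds hρ0)).neg)
    exact this
  · intro z hz
    have hne : y - z ≠ 0 := sub_ne_zero.2 hz.symm
    have hne' : z - y ≠ 0 := sub_ne_zero.2 hz
    simp only [dslope_of_ne _ hz, slope_def_field, hgy, kern]
    rw [← neg_sub y z]
    field_simp
    ring

section

variable {l : ℂ} {R δ : ℝ} {h : ℂ → ℂ}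

theorem SmallPert.norm_slope_germ (hl : ‖l‖ = 1) (hh : SmallPert R (1 / 8) h) {x y : ℂ}
    (hx : x ∈ ball (0 : ℂ) R) (hy : y ∈ ball (0 : ℂ) R) :
    7 / 8 ≤ ‖dslope (germ l h) x y‖ ∧ ‖dslope (germ l h) x y‖ ≤ 9 / 8 := by
  rcases eq_or_ne y x with rfl | hne
  · rw [dslope_same, hh.deriv_germ hx]
    have := hh.bound y hx
    constructor
    · have := norm_sub_le (l + deriv h y) (deriv h y)
      rw [add_sub_cancel_right] at this; linarith
    · linarith [norm_add_le l (deriv h y)]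
  · rw [dslope_of_ne _ hne, slope_def_field]
    have hp : 0 < ‖y - x‖ := norm_pos_iff.2 (sub_ne_zero.2 hne)
    have h1 := hh.lip hx hy
    have h2 : germ l h y - germ l h x = l * (y - x) + (h y - h x) := by simp only [germ]; ring
    have h3 : ‖l * (y - x)‖ = ‖y - x‖ := by rw [norm_mul, hl, one_mul]
    rw [norm_div, le_div_iff₀ hp, div_le_iff₀ hp, h2]
    constructor
    · have := norm_sub_le (l * (y - x) + (h y - h x)) (h y - h x)
      rw [add_sub_cancel_right] at this; linarith
    · linarith [norm_add_le (l * (y - x)) (h y - h x)]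

theorem SmallPert.norm_germ (hl : ‖l‖ = 1) (hh : SmallPert R (1 / 8) h) {y : ℂ}
    (hy : y ∈ ball (0 : ℂ) R) :
    7 / 8 * ‖y‖ ≤ ‖germ l h y‖ ∧ ‖germ l h y‖ ≤ 9 / 8 * ‖y‖ := by
  have h1 := hh.norm_le hy
  have h3 : ‖l * y‖ = ‖y‖ := by rw [norm_mul, hl, one_mul]
  simp only [germ]
  constructor
  · have := norm_sub_le (l * y + h y) (h y)
    rw [add_sub_cancel_right] at this; linarith
  · linarith [norm_add_le (l * y) (h y)]

theorem kern_bound {ρ η : ℝ} (hη : 0 < η) {w z : ℂ} (hz : ‖z‖ < ρ) (hw : ρ + η ≤ ‖w‖) :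
    ‖kern w z‖ ≤ ρ ^ 2 / η := by
  rw [kern, norm_div, norm_pow]
  have h1 : η ≤ ‖w - z‖ := by linarith [norm_sub_norm_le w z]
  have h2 : ‖z‖ ^ 2 ≤ ρ ^ 2 := by gcongr
  exact div_le_div₀ (by positivity) h2 hη h1

theorem kern_diff {ρ : ℝ} {w : ℂ} (hw : ρ ≤ ‖w‖) : DifferentiableOn ℂ (kern w) (ball 0 ρ) := by
  intro z hz
  have hne : w - z ≠ 0 := by
    rw [sub_ne_zero]; rintro rfl; simp at hz; linarith
  have : DifferentiableAt ℂ (fun z => z ^ 2 / (w - z)) z := by fun_prop (disch := exact hne)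
  exact this.differentiableWithinAt

variable {p : ℕ} {ε κ A : ℝ}

theorem pot_far (hl : ‖l‖ = 1) (hnl : nrm l (p + 1) ≠ 0) (hR : 0 < R) (hε : 0 < ε)
    (hR2 : R + 2 * ε ≤ 2) (hκ : 0 < κ) (hκ1 : κ ≤ 1) (hδ : δ ≤ 1 / 8) (hA0 : 0 ≤ A)
    (hA : GamBound l (p + 1) R δ A) (hh : SmallPert (R + 2 * ε) (δ - κ) h) {w : ℂ}
    (hw : R + ε ≤ ‖w‖) :
    pot l p (germ l h) w ≤ 128 * ‖l ^ (p + 1) - l‖ * A / (ε ^ 2 * κ) := by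
  have hw0 : w ≠ 0 := by rw [← norm_pos_iff]; linarith
  have hf : germ l h ∈ vanishing 1 := hh.germ_mem (by linarith)
  have hfb : SmallPert (R + 2 * ε) (1 / 8) h := hh.mono le_rfl (by linarith)
  have hh' : SmallPert R (δ - κ) h := hh.mono (by linarith) le_rfl
  have hε1 : ε ≤ 1 := by linarith
  have h1 : ‖lam l (p + 1) (germ l h) (fun z => deriv (germ l h) z * kern w z)‖ ≤
      128 * A / (ε ^ 2 * κ) := by
    have hbd : ∀ z ∈ ball (0 : ℂ) (R + ε / 2), ‖deriv (germ l h) z * kern w z‖ ≤ 9 / ε := by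
      intro z hz
      have hz' : ‖z‖ < R + ε / 2 := by simpa using hz
      have hz2 : z ∈ ball (0 : ℂ) (R + 2 * ε) := by simp; linarith
      have h2 := (hfb.norm_slope_germ hl hz2 hz2).2
      rw [dslope_same] at h2
      have h3 := kern_bound (w := w) (η := ε / 2) (by linarith) hz' (by linarith)
      have h4 : (R + ε / 2) ^ 2 / (ε / 2) ≤ 8 / ε := by
        rw [div_div_eq_mul_div]
        gcongr
        nlinarith
      rw [norm_mul]
      calc _ ≤ 9 / 8 * (8 / ε) := by gcongr; exact h3.trans h4
        _ = _ := by field_simp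
    have hdd : DifferentiableOn ℂ (fun z => deriv (germ l h) z * kern w z) (ball 0 (R + ε / 2)) := by
      have := (hh.germ_diff (l := l)).deriv isOpen_ball
      exact (this.mono (ball_subset_ball (by linarith))).mul (kern_diff (by linarith))
    have := lam_bound_of_sup (l := l) (n := p + 1) (by omega) hnl hR (by linarith) hA hκ hh'
      (M := 9 / ε) (by positivity) (η := ε / 2) (by positivity) hdd hbd
      (mul_mem_vanishing_of_analytic (vanishing_analyticAt hf).deriv (kern_mem hw0))
    refine this.trans ?_
    have e : 4 * A * (9 / ε) / (ε / 2 * κ) = 72 * A / (ε ^ 2 * κ) := by field_simp; ring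
    rw [e]
    gcongr
    norm_num
  have h2 : ‖gam l (p + 1) (germ l h) (kern w)‖ ≤ 128 * A / (ε ^ 2 * κ) := by
    have := gam_bound_of_sup (l := l) (n := p + 1) (v := kern w) (M := 4 / ε) hR hA
      (hh'.mono le_rfl (by linarith)) (by positivity) (kern_diff (by linarith)) (by
        intro z hz
        have h3 := kern_bound (w := w) (η := ε) hε (by simpa using hz : ‖z‖ < R) (by linarith)
        refine h3.trans ?_
        gcongr
        nlinarith) (by simp [kern])
    refine this.trans ?_
    rw [mul_div_assoc', div_le_div_iff₀ hε (by positivity)]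
    have : ε ^ 2 * κ ≤ ε := by nlinarith [mul_le_mul hε1 hκ1 hκ.le zero_le_one]
    nlinarith [mul_nonneg hA0 hε.le]
  rw [pot_eq hf p hw0]
  calc _ ≤ ‖l ^ (p + 1) - l‖ * (128 * A / (ε ^ 2 * κ)) := by gcongr; exact max_le h1 h2
    _ = _ := by ring

theorem pot_near_aux {a b c e₁ e₂ By Dy Bw Dw : ℂ} {N : ℝ} (ha : 3 / 5 ≤ ‖a‖) (hb : 1 / 2 ≤ ‖b‖)
    (hc : ‖c‖ = 1) (h₁ : ‖e₁‖ ≤ N) (h₂ : ‖e₂‖ ≤ N) (E₁ : Bw + Dw = a * By + e₁)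
    (E₂ : c * Dw = b * Dy + e₂) : max ‖By‖ ‖Dy‖ ≤ 4 * max ‖Bw‖ ‖Dw‖ + 8 * N := by
  have hBw : ‖Bw‖ ≤ max ‖Bw‖ ‖Dw‖ := le_max_left _ _
  have hDw : ‖Dw‖ ≤ max ‖Bw‖ ‖Dw‖ := le_max_right _ _
  have hN : 0 ≤ N := (norm_nonneg _).trans h₁
  refine max_le ?_ ?_
  · have t1 : ‖a * By‖ ≤ ‖Bw‖ + ‖Dw‖ + N := by
      have : a * By = Bw + Dw - e₁ := by rw [E₁]; ring
      rw [this]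
      linarith [norm_sub_le (Bw + Dw) e₁, norm_add_le Bw Dw]
    rw [norm_mul] at t1
    nlinarith [norm_nonneg By]
  · have t1 : ‖b * Dy‖ ≤ ‖Dw‖ + N := by
      have : b * Dy = c * Dw - e₂ := by rw [E₂]; ring
      rw [this]
      have t2 := norm_sub_le (c * Dw) e₂
      rw [norm_mul, hc, one_mul] at t2
      linarith
    rw [norm_mul] at t1
    nlinarith [norm_nonneg Dy]

set_option maxHeartbeats 1000000 in
theorem pot_near (hl : ‖l‖ = 1) (hnl : nrm l (p + 1) ≠ 0) (hR : 0 < R) (hε : 0 < ε)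
    (hR2 : R + 2 * ε ≤ 2) (hκ : 0 < κ) (hκ1 : κ ≤ 1) (hδ : δ ≤ 1 / 8) (hA0 : 0 ≤ A)
    (hA : GamBound l (p + 1) R δ A) (hh : SmallPert (R + 2 * ε) (δ - κ) h) {y : ℂ} (hy0 : y ≠ 0)
    (hy : ‖y‖ < R + ε) :
    pot l p (germ l h) y ≤ 4 * pot l p (germ l h) (germ l h y) +
      4 * (128 * ‖l ^ (p + 1) - l‖ * A / (ε ^ 2 * κ)) := by
  have hf : germ l h ∈ vanishing 1 := hh.germ_mem (by linarith)
  have hfb : SmallPert (R + 2 * ε) (1 / 8) h := hh.mono le_rfl (by linarith)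
  have hh' : SmallPert R (δ - κ) h := hh.mono (by linarith) le_rfl
  have hfl : deriv (germ l h) 0 = l := hh.deriv_germ_zero (by linarith)
  have hε1 : ε ≤ 1 := by linarith
  have hfd := hh.germ_diff (l := l)
  have hyb : y ∈ ball (0 : ℂ) (R + 2 * ε) := by simp; linarith
  have h0b : (0 : ℂ) ∈ ball (0 : ℂ) (R + 2 * ε) := by simp; linarith
  have hyp : 0 < ‖y‖ := norm_pos_iff.2 hy0
  set f := germ l h with hfdef
  have hfy : f y ≠ 0 := by
    have := (hfb.norm_germ hl hyb).1
    rw [← norm_pos_iff]; rw [← hfdef] at this; linarith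
  have hf0 : f 0 = 0 := (vanishing_one.1 hf).2
  -- the slopes
  set s := dslope f y with hs
  set q := dslope f 0 with hq
  have hsb : ∀ z ∈ ball (0 : ℂ) (R + 2 * ε), 7 / 8 ≤ ‖s z‖ ∧ ‖s z‖ ≤ 9 / 8 := fun z hz =>
    hfb.norm_slope_germ hl hyb hz
  have hqb : ∀ z ∈ ball (0 : ℂ) (R + 2 * ε), 7 / 8 ≤ ‖q z‖ ∧ ‖q z‖ ≤ 9 / 8 := fun z hz =>
    hfb.norm_slope_germ hl h0b hz
  have hdb : ∀ z ∈ ball (0 : ℂ) (R + 2 * ε), 7 / 8 ≤ ‖deriv f z‖ ∧ ‖deriv f z‖ ≤ 9 / 8 := by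
    intro z hz
    have := hfb.norm_slope_germ hl hz hz
    rwa [dslope_same] at this
  have hsne : ∀ z ∈ ball (0 : ℂ) (R + 2 * ε), s z ≠ 0 := fun z hz => by
    rw [← norm_pos_iff]; linarith [(hsb z hz).1]
  have hsd : DifferentiableOn ℂ s (ball 0 (R + 2 * ε)) :=
    (Complex.differentiableOn_dslope (isOpen_ball.mem_nhds hyb)).2 hfd
  have hqd : DifferentiableOn ℂ q (ball 0 (R + 2 * ε)) :=
    (Complex.differentiableOn_dslope (isOpen_ball.mem_nhds h0b)).2 hfd
  have hf'd : DifferentiableOn ℂ (deriv f) (ball 0 (R + 2 * ε)) := hfd.deriv isOpen_ball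
  have hqz : ∀ z, f z = z * q z := by
    intro z
    have := sub_smul_dslope f 0 z
    simp only [sub_zero, hf0, smul_eq_mul] at this
    rw [hq, this]
  have hsz : ∀ z, f z - f y = (z - y) * s z := by
    intro z
    have := sub_smul_dslope f y z
    simp only [smul_eq_mul] at this
    rw [hs, this]
  have hsy : s y = deriv f y := dslope_same _ _
  have hdy := hdb y hyb
  have hdyne : deriv f y ≠ 0 := by rw [← norm_pos_iff]; linarith
  have hqy := hqb y hyb
  have hqyne : q y ≠ 0 := by rw [← norm_pos_iff]; linarith
  set G : ℂ → ℂ := fun z => q z ^ 2 / s z with hG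
  have hGd : DifferentiableOn ℂ G (ball 0 (R + 2 * ε)) := (hqd.pow 2).div hsd hsne
  have hGb : ∀ z ∈ ball (0 : ℂ) (R + 2 * ε), ‖G z‖ ≤ 3 / 2 := by
    intro z hz
    rw [hG]; simp only [norm_div, norm_pow]
    rw [div_le_iff₀ (by linarith [(hsb z hz).1])]
    nlinarith [(hsb z hz).1, (hqb z hz).2, norm_nonneg (q z)]
  set b : ℂ := G y with hb
  set a : ℂ := b / deriv f y with ha
  have hbn : 1 / 2 ≤ ‖b‖ := by
    rw [hb, hG]; simp only [norm_div, norm_pow, hsy]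
    rw [le_div_iff₀ (by linarith)]
    nlinarith [hdy.2, hqy.1]
  have hbval : ‖b‖ * ‖deriv f y‖ = ‖q y‖ ^ 2 := by
    rw [hb, hG]; simp only [norm_div, norm_pow, hsy]
    field_simp
  have haval : ‖a‖ * ‖deriv f y‖ = ‖b‖ := by
    rw [ha, norm_div]; field_simp
  have han : 1 / 2 ≤ ‖a‖ := by
    rw [ha, norm_div, le_div_iff₀ (by linarith)]
    nlinarith [hdy.2, hqy.1]
  have han2 : ‖a‖ ≤ 2 := by
    rw [ha, norm_div, div_le_iff₀ (by linarith)]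
    have := hGb y hyb
    nlinarith [hdy.1]
  have hker : ∀ z ∈ ball (0 : ℂ) (R + 2 * ε), z ≠ y → kern (f y) (f z) = kern y z * G z := by
    intro z hz hzy
    have h1 : f y - f z = (y - z) * s z := by
      have := hsz z; linear_combination -this
    have h2 : y - z ≠ 0 := sub_ne_zero.2 hzy.symm
    have h3 := hsne z hz
    simp only [kern, hG]
    rw [h1, hqz z]
    field_simp
  -- first remainder
  obtain ⟨r₁, hr₁d, hr₁b, hr₁v, hr₁e⟩ := exists_remainder (g := fun z => G z - a * deriv f z)
    (R := R + ε) (ρ := R + 2 * ε) hε hy0 hy (by linarith)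
    (hGd.sub (hf'd.const_mul a)) (by simp only [← hb, ha]; field_simp; ring) (by
      intro z hz
      have h1 := hGb z hz
      have h2 : ‖a * deriv f z‖ ≤ 2 * (9 / 8) := by
        rw [norm_mul]; exact mul_le_mul han2 (hdb z hz).2 (norm_nonneg _) (by norm_num)
      linarith [norm_sub_le (G z) (a * deriv f z)])
  obtain ⟨r₂, hr₂d, hr₂b, hr₂v, hr₂e⟩ := exists_remainder (g := fun z => G z - b)
    (R := R + ε) (ρ := R + 2 * ε) hε hy0 hy (by linarith)
    (hGd.sub (differentiableOn_const b)) (by simp [← hb]) (by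
      intro z hz
      have h1 := hGb z hz
      have h2 := hGb y hyb
      linarith [norm_sub_le (G z) b])
  have hrb : ∀ z ∈ ball (0 : ℂ) (R + 2 * ε), ‖z‖ ^ 2 * (4 / ε) ≤ 16 / ε := by
    intro z hz
    have : ‖z‖ < 2 := by simp at hz; linarith
    have h4 : ‖z‖ ^ 2 ≤ 4 := by nlinarith [norm_nonneg z]
    calc _ ≤ 4 * (4 / ε) := by gcongr
      _ = _ := by ring
  have hnear : ∀ᶠ z in 𝓝 (0 : ℂ), z ∈ ball (0 : ℂ) (R + 2 * ε) ∧ z ≠ y :=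
    (isOpen_ball.eventually_mem h0b).and (isOpen_ne.eventually_mem hy0.symm)
  set N₁ : ℝ := 64 * A / (ε ^ 2 * κ) with hN₁
  have he₁ : ‖lam l (p + 1) f r₁‖ ≤ N₁ := by
    have := lam_bound_of_sup (l := l) (n := p + 1) (by omega) hnl hR (by linarith) hA hκ hh'
      (H := r₁) (M := 16 / ε) (by positivity) (η := ε) hε (hr₁d.mono (ball_subset_ball (by linarith)))
      (fun z hz => (hr₁b z (ball_subset_ball (by linarith) hz)).trans
        (hrb z (ball_subset_ball (by linarith) hz))) hr₁v
    refine this.trans (le_of_eq ?_)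
    rw [hN₁]; field_simp; ring
  have he₂ : ‖gam l (p + 1) f r₂‖ ≤ N₁ := by
    have := gam_bound_of_sup (l := l) (n := p + 1) (v := r₂) (M := 16 / ε) hR hA
      (hh'.mono le_rfl (by linarith)) (by positivity) (hr₂d.mono (ball_subset_ball (by linarith)))
      (fun z hz => (hr₂b z (ball_subset_ball (by linarith) hz)).trans
        (hrb z (ball_subset_ball (by linarith) hz)))
        (vanishing_one.1 (vanishing_mono (by norm_num) hr₂v)).2
    refine this.trans ?_
    rw [hN₁, mul_div_assoc', div_le_div_iff₀ hε (by positivity)]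
    have : ε ^ 2 * κ ≤ ε := by nlinarith [mul_le_mul hε1 hκ1 hκ.le zero_le_one]
    nlinarith [mul_nonneg hA0 hε.le]
  -- functional equations
  have hkv : kern (f y) ∘ f ∈ vanishing 2 := comp_mem_vanishing (kern_mem hfy) hf
  have hdfa : AnalyticAt ℂ (deriv f) 0 := (vanishing_analyticAt hf).deriv
  have hkyv : (fun z => deriv f z * kern y z) ∈ vanishing 2 :=
    mul_mem_vanishing_of_analytic hdfa (kern_mem hy0)
  have hkwv : (fun z => deriv f z * kern (f y) z) ∈ vanishing 2 :=
    mul_mem_vanishing_of_analytic hdfa (kern_mem hfy)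
  have E₁ : lam l (p + 1) f (fun z => deriv f z * kern (f y) z) + gam l (p + 1) f (kern (f y)) =
      a * lam l (p + 1) f (fun z => deriv f z * kern y z) + lam l (p + 1) f r₁ := by
    have c1 := lam_coboundary hf hfl (n := p + 1) (by omega) (kern_mem hfy)
    have c2 : lam l (p + 1) f (kern (f y) ∘ f) =
        lam l (p + 1) f ((kern (f y) ∘ f - fun z => deriv f z * kern (f y) z) +
          fun z => deriv f z * kern (f y) z) := by
      rw [sub_add_cancel]
    rw [lam_add hf (by omega) (vanishing_analyticAt ((vanishing 2).sub_mem hkv hkwv))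
      (vanishing_analyticAt hkwv)] at c2
    have c1' : lam l (p + 1) f (kern (f y) ∘ f - fun z => deriv f z * kern (f y) z) =
        gam l (p + 1) f (kern (f y)) := c1
    rw [c1'] at c2
    have c3 : lam l (p + 1) f (kern (f y) ∘ f) =
        lam l (p + 1) f (a • (fun z => deriv f z * kern y z) + r₁) := by
      have hv2 := (vanishing 2).add_mem ((vanishing 2).smul_mem a hkyv) hr₁v
      refine lam_congr hf (by omega) (vanishing_analyticAt hv2)
        (vanishing_of_eventually_zero _ ?_)
      filter_upwards [hnear] with z hz
      have e1 := hr₁e z hz.2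
      simp only [Pi.sub_apply, Pi.add_apply, Pi.smul_apply, smul_eq_mul, Function.comp,
        Pi.zero_apply]
      rw [hker z hz.1 hz.2, ← e1]; ring
    rw [lam_add hf (by omega) (vanishing_analyticAt hkyv).const_smul (vanishing_analyticAt hr₁v),
      lam_smul hf (by omega) _ (vanishing_analyticAt hkyv)] at c3
    rw [← c3, c2]; ring
  have E₂ : l ^ (p + 1) * gam l (p + 1) f (kern (f y)) =
      b * gam l (p + 1) f (kern y) + gam l (p + 1) f r₂ := by
    have m1 : ∀ {u : ℂ → ℂ}, u ∈ vanishing 2 → u ∈ vanishing 1 := fun hu =>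
      vanishing_mono (by norm_num) hu
    rw [← gam_comp hf hfl (by omega) (m1 (kern_mem hfy)),
      ← gam_smul hf _ (m1 (kern_mem hy0)),
      ← gam_add hf ((vanishing 1).smul_mem _ (m1 (kern_mem hy0))) (m1 hr₂v)]
    refine gam_eventually_congr hf ((vanishing 1).add_mem
      ((vanishing 1).smul_mem b (m1 (kern_mem hy0))) (m1 hr₂v)) ?_
    filter_upwards [hnear] with z hz
    have e1 := hr₂e z hz.2
    simp only [Pi.add_apply, Pi.smul_apply, smul_eq_mul, Function.comp]
    rw [hker z hz.1 hz.2, ← e1]; ring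
  rw [pot_eq hf p hy0, pot_eq hf p hfy]
  have han' : 3 / 5 ≤ ‖a‖ := by
    rw [ha, norm_div, le_div_iff₀ (by linarith)]
    nlinarith only [hdy.2, hqy.1, hbval, hdy.1, hbn]
  have := pot_near_aux han' hbn (by rw [norm_pow, hl, one_pow]) he₁ he₂ E₁ E₂
  calc _ ≤ ‖l ^ (p + 1) - l‖ * (4 * max _ _ + 8 * N₁) :=
        mul_le_mul_of_nonneg_left this (norm_nonneg _)
    _ = _ := by rw [hN₁]; ring

end

end YoccozBrjuno

namespace YoccozBrjuno

open Topology Filter Polynomial Metric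

theorem norm_sum_coeff_mul_le {c : ℂ[X]} {C : ℝ} (hC : (c.sum fun _ a => ‖a‖) ≤ C) {u : ℕ → ℂ}
    (hu : ∀ k ≤ c.natDegree, ‖u k‖ ≤ 1) : ‖c.sum fun k a => a * u k‖ ≤ C := by
  refine le_trans ?_ hC
  rw [Polynomial.sum, Polynomial.sum]
  refine (norm_sum_le _ _).trans (Finset.sum_le_sum fun k hk => ?_)
  rw [norm_mul]
  exact mul_le_of_le_one_right (norm_nonneg _) (hu k (le_natDegree_of_mem_supp k hk))

theorem analyticAt_iterate {f : ℂ → ℂ} {y : ℂ} (k : ℕ)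
    (h : ∀ i < k, AnalyticAt ℂ f (f^[i] y)) : AnalyticAt ℂ (f^[k]) y := by
  induction k with
  | zero => simpa using analyticAt_id
  | succ k ih =>
    rw [Function.iterate_succ']
    exact (h k (by omega)).comp (ih fun i hi => h i (by omega))

theorem analyticAt_act {f v : ℂ → ℂ} {c : ℂ[X]} {y : ℂ}
    (hf : ∀ i ≤ c.natDegree, AnalyticAt ℂ f (f^[i] y))
    (hv : ∀ i ≤ c.natDegree, AnalyticAt ℂ v (f^[i] y)) : AnalyticAt ℂ (act f c v) y := by
  have h1 : act f c v = fun z => ∑ k ∈ c.support, c.coeff k * v (f^[k] z) := by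
    ext z; rw [act_apply]; rfl
  rw [h1]
  refine Finset.analyticAt_fun_sum _ fun k hk => ?_
  have hk' : k ≤ c.natDegree := le_natDegree_of_mem_supp k hk
  have h2 : AnalyticAt ℂ (fun z => v (f^[k] z)) y :=
    AnalyticAt.fun_comp (g := v) (hv k hk') (analyticAt_iterate k fun i hi => hf i (by omega))
  exact analyticAt_const.mul h2

theorem pot_orbit {T : ℂ → ℝ} {f : ℂ → ℂ} {r N : ℝ} {K : ℕ} {y : ℂ} (hN : 0 < N)
    (hfar : ∀ w, r ≤ ‖w‖ → T w ≤ N)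
    (hnear : ∀ y, y ≠ 0 → ‖y‖ < r → f y ≠ 0 ∧ T y ≤ 4 * T (f y) + 4 * N)
    (hy0 : y ≠ 0) (hy : 4 ^ (K + 2) * N ≤ T y) :
    ∀ k ≤ K, ‖f^[k] y‖ < r := by
  have key : ∀ k ≤ K, f^[k] y ≠ 0 ∧ (T y + 4 / 3 * N) / 4 ^ k ≤ T (f^[k] y) + 4 / 3 * N ∧
      ‖f^[k] y‖ < r := by
    intro k hk
    have aux : (T y + 4 / 3 * N) / 4 ^ k ≤ T (f^[k] y) + 4 / 3 * N → ‖f^[k] y‖ < r := by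
      intro h
      by_contra! hr
      have h1 := hfar _ hr
      have h2 : (4 : ℝ) ^ k ≤ 4 ^ K := by gcongr; norm_num
      rw [div_le_iff₀ (by positivity)] at h
      have h3 : (T (f^[k] y) + 4 / 3 * N) * 4 ^ k ≤ (N + 4 / 3 * N) * 4 ^ K := by
        gcongr
      have h4 : (4 : ℝ) ^ (K + 2) * N = 16 * (4 ^ K * N) := by ring
      have h5 : 0 < 4 ^ K * N := by positivity
      nlinarith
    induction k with
    | zero =>
      have h0 : (T y + 4 / 3 * N) / 4 ^ 0 ≤ T (f^[0] y) + 4 / 3 * N := by simp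
      exact ⟨by simpa using hy0, h0, aux h0⟩
    | succ k ih =>
      obtain ⟨i1, i2, i3⟩ := ih (by omega) (fun h => by
        by_contra! hr
        have h1 := hfar _ hr
        have h2 : (4 : ℝ) ^ k ≤ 4 ^ K := pow_le_pow_right₀ (by norm_num) (by omega)
        rw [div_le_iff₀ (by positivity)] at h
        have h3 : (T (f^[k] y) + 4 / 3 * N) * 4 ^ k ≤ (N + 4 / 3 * N) * 4 ^ K := by
          gcongr
        have h4 : (4 : ℝ) ^ (K + 2) * N = 16 * (4 ^ K * N) := by ring
        have h5 : 0 < 4 ^ K * N := by positivity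
        nlinarith)
      obtain ⟨j1, j2⟩ := hnear _ i1 i3
      have h0 : (T y + 4 / 3 * N) / 4 ^ (k + 1) ≤ T (f^[k + 1] y) + 4 / 3 * N := by
        rw [Function.iterate_succ_apply', pow_succ, ← div_div]
        linarith
      refine ⟨by rwa [Function.iterate_succ_apply'], h0, aux h0⟩
  exact fun k hk => (key k hk).2.2

section

variable {l : ℂ} {R δ ε κ A : ℝ} {p : ℕ}

theorem gamBound_step (hl : ‖l‖ = 1) (hp : 1 ≤ p) (hnl : nrm l (p + 1) ≠ 0) (hR : 0 < R) (hε : 0 < ε)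
    (hR2 : R + 2 * ε ≤ 2) (hκ : 0 < κ) (hκ1 : κ ≤ 1) (hδ : δ ≤ 1 / 8) (hA0 : 0 < A)
    (hA : GamBound l (p + 1) R δ A) {n : ℕ} (hn : 1 ≤ n) (hnl' : nrm l n ≠ 0) {d : ℂ[X]}
    (hd : (d * filt l n).eval (l ^ n) = 1) {K : ℕ} (hK : (d * filt l n).natDegree ≤ K) {C : ℝ}
    (hC : ((d * filt l n).sum fun _ a => ‖a‖) ≤ C) {A' : ℝ} (hA' : 0 ≤ A')
    (hCA : C ^ p * (4 ^ (K + 2) * (128 * ‖l ^ (p + 1) - l‖ * A / (ε ^ 2 * κ))) ^ n ≤ A' ^ p) :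
    GamBound l n (R + 2 * ε) (δ - κ) A' := by
  intro h hh v hv hv0 hv1
  have hbn : 0 < ‖l ^ (p + 1) - l‖ := by
    rw [norm_pos_iff]
    have := (Finset.prod_ne_zero_iff.1 hnl) 1 (by simp; omega)
    simpa using this
  set N : ℝ := 128 * ‖l ^ (p + 1) - l‖ * A / (ε ^ 2 * κ) with hN
  have hN0 : 0 < N := by positivity
  set M : ℝ := 4 ^ (K + 2) * N with hM
  have hM0 : 0 < M := by positivity
  have hfm : germ l h ∈ vanishing 1 := hh.germ_mem (by linarith)
  have hfl : deriv (germ l h) 0 = l := hh.deriv_germ_zero (by linarith)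
  have hfb : SmallPert (R + 2 * ε) (1 / 8) h := hh.mono le_rfl (by linarith)
  have hfa : ∀ z : ℂ, ‖z‖ < R + 2 * ε → AnalyticAt ℂ (germ l h) z := fun z hz =>
    hh.germ_analyticAt (by simpa using hz)
  have hva : ∀ z : ℂ, ‖z‖ < R + 2 * ε → AnalyticAt ℂ v z := fun z hz =>
    hv.analyticAt (isOpen_ball.mem_nhds (by simpa using hz))
  have hfar : ∀ w, R + ε ≤ ‖w‖ → pot l p (germ l h) w ≤ N := fun w hw =>
    pot_far hl hnl hR hε hR2 hκ hκ1 hδ hA0.le hA hh hw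
  have hnear : ∀ y, y ≠ 0 → ‖y‖ < R + ε →
      germ l h y ≠ 0 ∧ pot l p (germ l h) y ≤ 4 * pot l p (germ l h) (germ l h y) + 4 * N := by
    intro y hy0 hy
    refine ⟨?_, pot_near hl hnl hR hε hR2 hκ hκ1 hδ hA0.le hA hh hy0 hy⟩
    have h1 := (hfb.norm_germ hl (y := y) (by simp; linarith)).1
    have h2 : 0 < ‖y‖ := norm_pos_iff.2 hy0
    rw [← norm_pos_iff]; linarith
  have hB0 : ‖numB l p (germ l h) 0‖ = 1 := by rw [numB_zero hfm hfl hp hnl, hl]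
  have hv0' : v ∈ vanishing 1 := vanishing_one.2 ⟨hva 0 (by simp; linarith), hv0⟩
  set f := germ l h
  set B := numB l p f
  set D := numD l p f
  have hBd : Differentiable ℂ B := differentiable_numB p
  have hDd : Differentiable ℂ D := differentiable_numD p
  set E : Set ℂ := {y | M * ‖y‖ ^ p < max ‖B y‖ ‖D y‖} with hE
  have hl1 : Continuous fun y : ℂ => M * ‖y‖ ^ p := by fun_prop
  have hl2 : Continuous fun y : ℂ => max ‖B y‖ ‖D y‖ :=
    hBd.continuous.norm.max hDd.continuous.norm
  have hEo : IsOpen E := isOpen_lt hl1 hl2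
  have hcl : closure E ⊆ {y | M * ‖y‖ ^ p ≤ max ‖B y‖ ‖D y‖} :=
    closure_minimal (fun y hy => by simp only [hE, Set.mem_ofPred_eq] at hy ⊢; exact hy.le)
      (isClosed_le hl1 hl2)
  have h0E : (0 : ℂ) ∈ E := by
    have : (1 : ℝ) ≤ max ‖B 0‖ ‖D 0‖ := hB0 ▸ le_max_left _ _
    simp only [hE, Set.mem_ofPred_eq, norm_zero, zero_pow (by omega : p ≠ 0), mul_zero]
    linarith
  have horb : ∀ y ∈ closure E, ∀ k ≤ K, ‖f^[k] y‖ < R + ε := by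
    intro y hy
    by_cases hy0 : y = 0
    · intro k _
      have : f^[k] 0 = 0 := Function.iterate_fixed (vanishing_one.1 hfm).2 k
      rw [hy0, this, norm_zero]; linarith
    · refine pot_orbit hN0 hfar hnear hy0 ?_
      have hyp : 0 < ‖y‖ ^ p := by positivity
      rw [pot, le_div_iff₀ hyp]
      exact hcl hy
  set c := d * filt l n with hc
  set X := act f c v with hX
  have hXa : ∀ y ∈ closure E, AnalyticAt ℂ X y := fun y hy =>
    analyticAt_act (fun i hi => hfa _ (by linarith [horb y hy i (hi.trans hK)]))
      (fun i hi => hva _ (by linarith [horb y hy i (hi.trans hK)]))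
  have hXb : ∀ y ∈ closure E, ‖X y‖ ≤ C := by
    intro y hy
    rw [hX, act_apply]
    exact norm_sum_coeff_mul_le hC fun k hk =>
      hv1 _ (by simpa using by linarith [horb y hy k (hk.trans hK)])
  obtain ⟨w, hw, hwe⟩ := act_mul_filt_mem hfm hfl hn d hv0'
  have hcoef : w 0 = gam l n f v := by
    have := coef_act_mul_filt hfm hfl hn hnl' d hv0'
    rw [hd, one_mul, coef_of_eventuallyEq hw hwe] at this
    exact this
  set Y : ℂ → ℂ := fun z => if z = 0 then w 0 else X z / z ^ n with hY
  have hY0 : Y =ᶠ[𝓝 0] w := by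
    filter_upwards [hwe] with z hz
    by_cases hz0 : z = 0
    · simp [hY, hz0]
    · simp only [hY, if_neg hz0, hX, hc, hz]
      field_simp
  have hYa : ∀ y ∈ closure E, AnalyticAt ℂ Y y := by
    intro y hy
    by_cases hy0 : y = 0
    · rw [hy0]; exact hw.congr hY0.symm
    · have h1 : AnalyticAt ℂ (fun z => X z / z ^ n) y :=
        (hXa y hy).div (by fun_prop) (pow_ne_zero _ hy0)
      refine h1.congr ?_
      filter_upwards [isOpen_ne.mem_nhds hy0] with z hz
      simp only [hY, if_neg hz]
  have hFd : DiffContOnCl ℂ (fun z => Y z ^ p * B z ^ n) E := by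
    refine DifferentiableOn.diffContOnCl fun z hz => ?_
    have := (hYa z hz).differentiableAt
    have h2 := hBd z
    exact ((this.pow p).mul (h2.pow n)).differentiableWithinAt
  have hEb : Bornology.IsBounded E := by
    refine isBounded_ball.subset (s := E) (t := ball (0 : ℂ) (R + ε)) fun y hy => ?_
    simpa using horb y (subset_closure hy) 0 (Nat.zero_le _)
  have hmain := Complex.norm_le_of_forall_mem_frontier_norm_le hEb hFd (C := C ^ p * M ^ n) (by
    intro y hy
    have hyE : y ∉ E := fun h => by
      have := hEo.frontier_eq ▸ hy
      exact this.2 h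
    have hyc : y ∈ closure E := frontier_subset_closure hy
    have hy0 : y ≠ 0 := fun h => hyE (h ▸ h0E)
    have hyp : 0 < ‖y‖ := norm_pos_iff.2 hy0
    have hBy : ‖B y‖ ≤ M * ‖y‖ ^ p := (le_max_left _ _).trans (not_lt.1 hyE)
    have hXy := hXb y hyc
    have hC0 : 0 ≤ C := (norm_nonneg _).trans hXy
    simp only [hY, if_neg hy0, norm_mul, norm_pow, norm_div]
    calc (‖X y‖ / ‖y‖ ^ n) ^ p * ‖B y‖ ^ n ≤ (C / ‖y‖ ^ n) ^ p * (M * ‖y‖ ^ p) ^ n := by gcongr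
      _ = _ := by
        rw [div_pow, mul_pow, ← pow_mul, ← pow_mul, mul_comm p n]
        field_simp) (subset_closure h0E)
  simp only [norm_mul, norm_pow] at hmain
  rw [hB0, one_pow, mul_one, hY0.self_of_nhds, hcoef] at hmain
  exact le_of_pow_le_pow_left₀ (by omega) hA' (hmain.trans hCA)

end

end YoccozBrjuno

namespace YoccozBrjuno


open Topology Filter

/-- Denominators of the continued fraction convergents. -/
noncomputable def cfQ (θ : ℝ) : ℕ → ℕ
  | 0 => 1
  | 1 => ⌊1 / brjunoSeq θ 0⌋₊
  | n + 2 => ⌊1 / brjunoSeq θ (n + 1)⌋₊ * cfQ θ (n + 1) + cfQ θ n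

/-- Numerators of the continued fraction convergents. -/
noncomputable def cfP (θ : ℝ) : ℕ → ℕ
  | 0 => 0
  | 1 => 1
  | n + 2 => ⌊1 / brjunoSeq θ (n + 1)⌋₊ * cfP θ (n + 1) + cfP θ n

/-- The products of the first `n` iterates of the Gauss map. -/
noncomputable def gaussProd (θ : ℝ) (n : ℕ) : ℝ := ∏ k ∈ Finset.range n, brjunoSeq θ k

section

variable {θ : ℝ}

theorem brjunoSeq_irrational (hirr : Irrational θ) (n : ℕ) : Irrational (brjunoSeq θ n) := by
  induction n with
  | zero => exact hirr
  | succ n ih =>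
    have h1 : Irrational (1 / brjunoSeq θ n) := by rw [one_div]; exact ih.inv
    have h2 : Int.fract (1 / brjunoSeq θ n) = 1 / brjunoSeq θ n - (⌊1 / brjunoSeq θ n⌋ : ℤ) := rfl
    rw [brjunoSeq, h2]
    exact h1.sub_intCast _

theorem brjunoSeq_mem (hθ : θ ∈ Set.Ioo (0 : ℝ) 1) (hirr : Irrational θ) (n : ℕ) :
    0 < brjunoSeq θ n ∧ brjunoSeq θ n < 1 := by
  cases n with
  | zero => exact hθ
  | succ n =>
    have h0 := (brjunoSeq_irrational hirr (n + 1)).ne_zero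
    rw [brjunoSeq] at h0 ⊢
    exact ⟨lt_of_le_of_ne (Int.fract_nonneg _) h0.symm, Int.fract_lt_one _⟩

theorem one_le_floor (hθ : θ ∈ Set.Ioo (0 : ℝ) 1) (hirr : Irrational θ) (n : ℕ) :
    1 ≤ ⌊1 / brjunoSeq θ n⌋₊ := by
  obtain ⟨h1, h2⟩ := brjunoSeq_mem hθ hirr n
  rw [Nat.one_le_floor_iff, le_div_iff₀ h1]
  linarith

theorem brjunoSeq_succ (hθ : θ ∈ Set.Ioo (0 : ℝ) 1) (hirr : Irrational θ) (n : ℕ) :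
    brjunoSeq θ (n + 1) = 1 / brjunoSeq θ n - ⌊1 / brjunoSeq θ n⌋₊ := by
  have h1 := (brjunoSeq_mem hθ hirr n).1
  have h2 : (0 : ℝ) ≤ 1 / brjunoSeq θ n := by positivity
  rw [brjunoSeq, Int.fract, natCast_floor_eq_intCast_floor h2]

theorem gaussProd_pos (hθ : θ ∈ Set.Ioo (0 : ℝ) 1) (hirr : Irrational θ) (n : ℕ) :
    0 < gaussProd θ n := Finset.prod_pos fun k _ => (brjunoSeq_mem hθ hirr k).1

theorem gaussProd_succ (n : ℕ) : gaussProd θ (n + 1) = gaussProd θ n * brjunoSeq θ n :=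
  Finset.prod_range_succ _ _

theorem gaussProd_succ_lt (hθ : θ ∈ Set.Ioo (0 : ℝ) 1) (hirr : Irrational θ) (n : ℕ) :
    gaussProd θ (n + 1) < gaussProd θ n := by
  rw [gaussProd_succ]
  exact mul_lt_of_lt_one_right (gaussProd_pos hθ hirr n) (brjunoSeq_mem hθ hirr n).2

theorem gaussProd_le_one (hθ : θ ∈ Set.Ioo (0 : ℝ) 1) (hirr : Irrational θ) (n : ℕ) :
    gaussProd θ n ≤ 1 :=
  Finset.prod_le_one (fun k _ => (brjunoSeq_mem hθ hirr k).1.le)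
    fun k _ => (brjunoSeq_mem hθ hirr k).2.le

theorem gaussProd_add_two (hθ : θ ∈ Set.Ioo (0 : ℝ) 1) (hirr : Irrational θ) (n : ℕ) :
    gaussProd θ (n + 2) = gaussProd θ n - ⌊1 / brjunoSeq θ n⌋₊ * gaussProd θ (n + 1) := by
  have h := (brjunoSeq_mem hθ hirr n).1.ne'
  rw [gaussProd_succ (n + 1), brjunoSeq_succ hθ hirr, gaussProd_succ n]
  field_simp

theorem cfQ_mul_sub_cfP (hθ : θ ∈ Set.Ioo (0 : ℝ) 1) (hirr : Irrational θ) (n : ℕ) :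
    cfQ θ n * θ - cfP θ n = (-1) ^ n * gaussProd θ (n + 1) := by
  induction n using Nat.twoStepInduction with
  | zero => simp [cfQ, cfP, gaussProd, brjunoSeq]
  | one =>
    rw [gaussProd_add_two hθ hirr]
    simp [cfQ, cfP, gaussProd, brjunoSeq]
  | more n h1 h2 =>
    rw [gaussProd_add_two hθ hirr (n + 1), cfQ, cfP]
    push_cast
    linear_combination (⌊1 / brjunoSeq θ (n + 1)⌋₊ : ℝ) * h2 + h1

theorem cfQ_mul_add (hθ : θ ∈ Set.Ioo (0 : ℝ) 1) (hirr : Irrational θ) (n : ℕ) :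
    cfQ θ (n + 1) * gaussProd θ (n + 1) + cfQ θ n * gaussProd θ (n + 2) = 1 := by
  induction n with
  | zero =>
    rw [gaussProd_add_two hθ hirr]
    simp [cfQ, gaussProd, brjunoSeq]
  | succ n ih =>
    rw [gaussProd_add_two hθ hirr (n + 1), cfQ]
    push_cast
    linear_combination ih

theorem cfQ_coprime (θ : ℝ) (n : ℕ) : (cfP θ n).Coprime (cfQ θ n) := by
  have h : ∀ n, (cfP θ (n + 1) : ℤ) * cfQ θ n - cfP θ n * cfQ θ (n + 1) = (-1) ^ n := by
    intro n
    induction n with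
    | zero => simp [cfP, cfQ]
    | succ n ih =>
      rw [cfP, cfQ]; push_cast
      linear_combination -ih
  rw [← Nat.isCoprime_iff_coprime]
  have h2 : ((-1 : ℤ) ^ n) * (-1) ^ n = 1 := by rw [← mul_pow]; simp
  exact ⟨-(-1) ^ n * cfQ θ (n + 1), (-1) ^ n * cfP θ (n + 1),
    by linear_combination (-1) ^ n * h n + h2⟩

theorem cfQ_pos (hθ : θ ∈ Set.Ioo (0 : ℝ) 1) (hirr : Irrational θ) (n : ℕ) : 1 ≤ cfQ θ n := by
  induction n using Nat.twoStepInduction with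
  | zero => simp [cfQ]
  | one => exact one_le_floor hθ hirr 0
  | more n h1 h2 => rw [cfQ]; exact le_add_left h1

theorem cfQ_add_two (hθ : θ ∈ Set.Ioo (0 : ℝ) 1) (hirr : Irrational θ) (n : ℕ) :
    cfQ θ (n + 1) + cfQ θ n ≤ cfQ θ (n + 2) := by
  have h := Nat.mul_le_mul_right (cfQ θ (n + 1)) (one_le_floor hθ hirr (n + 1))
  rw [cfQ]; omega

theorem cfQ_mono (hθ : θ ∈ Set.Ioo (0 : ℝ) 1) (hirr : Irrational θ) : Monotone (cfQ θ) := by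
  refine monotone_nat_of_le_succ fun n => ?_
  cases n with
  | zero => exact cfQ_pos hθ hirr 1
  | succ n => exact (Nat.le_add_right _ _).trans (cfQ_add_two hθ hirr n)

theorem gaussProd_le (hθ : θ ∈ Set.Ioo (0 : ℝ) 1) (hirr : Irrational θ) (n : ℕ) :
    gaussProd θ n ≤ 1 / cfQ θ n := by
  have hq : (0 : ℝ) < cfQ θ n := by exact_mod_cast cfQ_pos hθ hirr n
  rw [le_div_iff₀ hq]
  cases n with
  | zero => simp [gaussProd, cfQ]
  | succ n =>
    have h1 := cfQ_mul_add hθ hirr n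
    have h2 := gaussProd_pos hθ hirr (n + 2)
    nlinarith [mul_nonneg (Nat.cast_nonneg (α := ℝ) (cfQ θ n)) h2.le]

theorem one_div_gaussProd_le (hθ : θ ∈ Set.Ioo (0 : ℝ) 1) (hirr : Irrational θ) (n : ℕ) :
    1 / gaussProd θ (n + 1) ≤ 2 * cfQ θ (n + 1) := by
  have hb := gaussProd_pos hθ hirr (n + 1)
  rw [div_le_iff₀ hb]
  have h1 := cfQ_mul_add hθ hirr n
  have h2 := gaussProd_succ_lt hθ hirr (n + 1)
  have h3 : (cfQ θ n : ℝ) ≤ cfQ θ (n + 1) := by exact_mod_cast cfQ_mono hθ hirr (Nat.le_succ n)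
  have h4 := gaussProd_pos hθ hirr (n + 2)
  nlinarith [mul_le_mul h3 h2.le h4.le (Nat.cast_nonneg _)]

theorem cfQ_growth (hθ : θ ∈ Set.Ioo (0 : ℝ) 1) (hirr : Irrational θ) (n : ℕ) :
    (4 / 3 : ℝ) ^ n ≤ 4 / 3 * cfQ θ n := by
  induction n using Nat.twoStepInduction with
  | zero => simp [cfQ]; norm_num
  | one =>
    have : (1 : ℝ) ≤ cfQ θ 1 := by exact_mod_cast cfQ_pos hθ hirr 1
    linarith
  | more n h1 h2 =>
    have h3 : (cfQ θ (n + 1) : ℝ) + cfQ θ n ≤ cfQ θ (n + 2) := by exact_mod_cast cfQ_add_two hθ hirr n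
    have h4 : (4 / 3 : ℝ) ^ (n + 2) = 16 / 9 * (4 / 3) ^ n := by ring
    have h5 : (cfQ θ n : ℝ) ≤ cfQ θ (n + 1) := by exact_mod_cast cfQ_mono hθ hirr (Nat.le_succ n)
    rw [h4]; linarith

/-- The main part of the `n`-th term of the Brjuno sum. -/
noncomputable def brjunoMain (θ : ℝ) (n : ℕ) : ℝ := Real.log (1 / gaussProd θ (n + 1)) / cfQ θ n

theorem brjunoMain_nonneg (hθ : θ ∈ Set.Ioo (0 : ℝ) 1) (hirr : Irrational θ) (n : ℕ) :
    0 ≤ brjunoMain θ n := by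
  refine div_nonneg (Real.log_nonneg ?_) (Nat.cast_nonneg _)
  rw [le_div_iff₀ (gaussProd_pos hθ hirr _), one_mul]
  exact gaussProd_le_one hθ hirr _

theorem brjunoTerm_nonneg (hθ : θ ∈ Set.Ioo (0 : ℝ) 1) (hirr : Irrational θ) (n : ℕ) :
    0 ≤ brjunoTerm θ n := by
  obtain ⟨h1, h2⟩ := brjunoSeq_mem hθ hirr n
  refine mul_nonneg (gaussProd_pos hθ hirr n).le (Real.log_nonneg ?_)
  rw [le_div_iff₀ h1]; linarith

theorem brjunoTerm_le (hθ : θ ∈ Set.Ioo (0 : ℝ) 1) (hirr : Irrational θ) (n : ℕ) :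
    brjunoTerm θ n ≤ brjunoMain θ n := by
  obtain ⟨h1, h2⟩ := brjunoSeq_mem hθ hirr n
  have hb := gaussProd_pos hθ hirr n
  have hb' := gaussProd_pos hθ hirr (n + 1)
  have h3 : Real.log (1 / brjunoSeq θ n) ≤ Real.log (1 / gaussProd θ (n + 1)) := by
    refine Real.log_le_log (by positivity) ?_
    refine one_div_le_one_div_of_le hb' ?_
    rw [gaussProd_succ]
    exact mul_le_of_le_one_left h1.le (gaussProd_le_one hθ hirr n)
  have h4 : 0 ≤ Real.log (1 / gaussProd θ (n + 1)) := by
    refine Real.log_nonneg ?_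
    rw [le_div_iff₀ hb', one_mul]
    exact gaussProd_le_one hθ hirr _
  calc brjunoTerm θ n = gaussProd θ n * Real.log (1 / brjunoSeq θ n) := rfl
    _ ≤ gaussProd θ n * Real.log (1 / gaussProd θ (n + 1)) := by gcongr
    _ ≤ 1 / cfQ θ n * Real.log (1 / gaussProd θ (n + 1)) := by
      gcongr; exact gaussProd_le hθ hirr n
    _ = _ := by rw [brjunoMain]; ring

theorem log_le_two_mul_sqrt {x : ℝ} (hx : 1 ≤ x) : Real.log x ≤ 2 * √x := by
  have h0 : 0 < √x := Real.sqrt_pos.2 (by linarith)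
  have h1 : Real.log x = 2 * Real.log (√x) := by
    rw [Real.log_sqrt (by linarith)]; ring
  rw [h1]
  have := Real.log_le_self h0.le
  linarith

theorem summable_error (hθ : θ ∈ Set.Ioo (0 : ℝ) 1) (hirr : Irrational θ) :
    Summable fun n : ℕ => (n + 1 + Real.log (cfQ θ n)) / cfQ θ n := by
  have hr : ‖(√(3 / 4) : ℝ)‖ < 1 := by
    rw [Real.norm_of_nonneg (Real.sqrt_nonneg _), Real.sqrt_lt' (by norm_num)]; norm_num
  have hr2 : ‖(3 / 4 : ℝ)‖ < 1 := by rw [Real.norm_of_nonneg] <;> norm_num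
  have s1 := summable_pow_mul_geometric_of_norm_lt_one 1 hr2
  have s2 := summable_geometric_of_norm_lt_one hr2
  have s3 := summable_geometric_of_norm_lt_one hr
  have s := ((s1.add s2).mul_left (4 / 3 : ℝ)).add (s3.mul_left (2 * √(4 / 3) : ℝ))
  refine Summable.of_nonneg_of_le (fun n => ?_) (fun n => ?_) s
  · have : (1 : ℝ) ≤ cfQ θ n := by exact_mod_cast cfQ_pos hθ hirr n
    have := Real.log_nonneg this
    positivity
  · have hq : (1 : ℝ) ≤ cfQ θ n := by exact_mod_cast cfQ_pos hθ hirr n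
    have hg := cfQ_growth hθ hirr n
    have hinv : 1 / (cfQ θ n : ℝ) ≤ 4 / 3 * (3 / 4) ^ n := by
      rw [div_le_iff₀ (by linarith)]
      have e : (3 / 4 : ℝ) ^ n * (4 / 3) ^ n = 1 := by rw [← mul_pow]; norm_num
      have : (0 : ℝ) < (3 / 4) ^ n := by positivity
      nlinarith
    have h1 := log_le_two_mul_sqrt hq
    have h2 : Real.log (cfQ θ n) / cfQ θ n ≤ 2 * √(4 / 3) * (√(3 / 4)) ^ n := by
      calc _ ≤ 2 * √(cfQ θ n) / cfQ θ n := by gcongr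
        _ = 2 * √(1 / cfQ θ n) := by
          rw [Real.sqrt_div (by norm_num), Real.sqrt_one, mul_div_assoc, Real.sqrt_div_self]; ring
        _ ≤ 2 * √(4 / 3 * (3 / 4) ^ n) := by gcongr
        _ = _ := by
          have e : √((3 / 4 : ℝ) ^ n) = √(3 / 4) ^ n := by
            rw [Real.sqrt_eq_iff_mul_self_eq (by positivity) (by positivity), ← mul_pow,
              Real.mul_self_sqrt (by norm_num)]
          rw [Real.sqrt_mul (by norm_num), e]; ring
    calc (n + 1 + Real.log (cfQ θ n)) / cfQ θ n
        = (n + 1) * (1 / cfQ θ n) + Real.log (cfQ θ n) / cfQ θ n := by ring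
      _ ≤ (n + 1) * (4 / 3 * (3 / 4) ^ n) + 2 * √(4 / 3) * (√(3 / 4)) ^ n := by gcongr
      _ = _ := by ring

end

end YoccozBrjuno

namespace YoccozBrjuno

open Topology Filter Polynomial Metric

/-! ### Filter polynomials at a good rational approximation -/

/-- The point `e^{2πix}` of the unit circle. -/
noncomputable def rot (x : ℝ) : ℂ := Complex.exp (2 * Real.pi * Complex.I * x)

theorem rot_eq (x : ℝ) : rot x = Complex.exp (Complex.I * ((2 * Real.pi * x : ℝ) : ℂ)) := by
  rw [rot]; congr 1; push_cast; ring

theorem norm_rot (x : ℝ) : ‖rot x‖ = 1 := by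
  rw [rot_eq, mul_comm, Complex.norm_exp_ofReal_mul_I]

theorem rot_ne_zero (x : ℝ) : rot x ≠ 0 := Complex.exp_ne_zero _

theorem rot_add (x y : ℝ) : rot (x + y) = rot x * rot y := by
  simp only [rot]; rw [← Complex.exp_add]; congr 1; push_cast; ring

theorem rot_pow (x : ℝ) (n : ℕ) : rot x ^ n = rot (n * x) := by
  simp only [rot]; rw [← Complex.exp_nat_mul]; congr 1; push_cast; ring

theorem rot_int (m : ℤ) : rot m = 1 := by
  have := Complex.exp_int_mul_two_pi_mul_I m
  rw [rot, ← this]; congr 1; push_cast; ring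

theorem norm_rot_sub_le (x y : ℝ) : ‖rot x - rot y‖ ≤ 2 * π * |x - y| := by
  have h : rot x - rot y = rot y * (rot (x - y) - 1) := by
    rw [mul_sub, ← rot_add]; simp
  rw [h, norm_mul, norm_rot, one_mul, rot_eq]
  refine Real.norm_exp_I_mul_ofReal_sub_one_le.trans (le_of_eq ?_)
  rw [Real.norm_eq_abs, abs_mul, abs_of_pos (by positivity : (0:ℝ) < 2 * π)]

theorem le_norm_rot_sub_one {x : ℝ} (m : ℤ) (h : |x - m| ≤ 1 / 2) : 4 * |x - m| ≤ ‖rot x - 1‖ := by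
  have h1 : rot x = rot (x - m) := by
    have := rot_add (x - m) m
    rw [rot_int, mul_one] at this
    simpa using this
  rw [h1]
  generalize x - m = y at h
  rw [rot_eq, Complex.norm_exp_I_mul_ofReal_sub_one, Real.norm_eq_abs, abs_mul,
    show 2 * π * y / 2 = π * y by ring, ← abs_of_nonneg (abs_nonneg (Real.sin (π * y)))]
  have h2 : |Real.sin (π * y)| = Real.sin (π * |y|) := by
    have h3 : 0 ≤ Real.sin (π * |y|) := Real.sin_nonneg_of_nonneg_of_le_pi (by positivity)
      (by nlinarith [Real.pi_pos])
    rcases abs_cases y with ⟨h', _⟩ | ⟨h', _⟩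
    · rw [h'] at h3 ⊢; exact abs_of_nonneg h3
    · rw [h'] at h3 ⊢
      rw [mul_neg, Real.sin_neg] at h3 ⊢
      exact abs_of_nonpos (by linarith)
  have h3 := Real.mul_le_sin (x := π * |y|) (by positivity) (by nlinarith [Real.pi_pos])
  have h4 : 2 / π * (π * |y|) = 2 * |y| := by field_simp
  rw [h4] at h3
  rw [abs_abs, h2]
  norm_num
  linarith

/-- If `x = k i / P` is not an integer, `rot x` is at distance at least `4 / P` from `1`. -/
theorem le_norm_pow_sub_one {k P i : ℕ} (hP : 0 < P) (hk : k.Coprime P) (hi : 0 < i) (hiP : i < P) :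
    4 / P ≤ ‖rot (k / P) ^ i - 1‖ := by
  have hP' : (0:ℝ) < P := by exact_mod_cast hP
  rw [rot_pow]
  set x : ℝ := i * (k / P)
  have h1 := abs_sub_round x
  refine le_trans ?_ (le_norm_rot_sub_one (round x) h1)
  have h2 : (i * k - round x * P : ℤ) ≠ 0 := by
    intro h
    have : (P : ℤ) ∣ ((i * k : ℕ) : ℤ) := ⟨round x, by push_cast; linarith⟩
    have := Int.natCast_dvd_natCast.1 this
    have := Nat.le_of_dvd hi (hk.symm.dvd_of_dvd_mul_right this)
    omega
  have h3 : (1:ℝ) ≤ |((i * k - round x * P : ℤ) : ℝ)| := by exact_mod_cast Int.one_le_abs h2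
  have h4 : x - round x = ((i * k - round x * P : ℤ) : ℝ) / P := by
    simp only [x]; push_cast; field_simp
  rw [h4, abs_div, abs_of_pos hP']
  rw [mul_div_assoc']
  gcongr
  linarith

theorem isPrimitiveRoot_rot {k P : ℕ} (hP : 0 < P) (hk : k.Coprime P) :
    IsPrimitiveRoot (rot (k / P)) P := by
  have := Complex.isPrimitiveRoot_exp_of_coprime k P hP.ne' hk
  rw [rot]; convert this using 2; push_cast; ring

/-- The `ℓ¹` norm of the coefficients of a polynomial. -/
noncomputable def coeffNorm (p : ℂ[X]) : ℝ := p.sum fun _ a => ‖a‖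

theorem coeffNorm_eq {p : ℂ[X]} {n : ℕ} (h : p.natDegree < n) :
    coeffNorm p = ∑ i ∈ Finset.range n, ‖p.coeff i‖ :=
  p.sum_over_range' (by simp) n h

theorem coeffNorm_add_le (p q : ℂ[X]) : coeffNorm (p + q) ≤ coeffNorm p + coeffNorm q := by
  set n := max (p + q).natDegree (max p.natDegree q.natDegree) + 1
  rw [coeffNorm_eq (n := n) (by omega), coeffNorm_eq (n := n) (by omega),
    coeffNorm_eq (n := n) (by omega), ← Finset.sum_add_distrib]
  exact Finset.sum_le_sum fun i _ => by rw [coeff_add]; exact norm_add_le _ _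

theorem coeffNorm_C_mul (a : ℂ) (p : ℂ[X]) : coeffNorm (C a * p) = ‖a‖ * coeffNorm p := by
  set n := max (C a * p).natDegree p.natDegree + 1
  rw [coeffNorm_eq (n := n) (by omega), coeffNorm_eq (n := n) (by omega), Finset.mul_sum]
  exact Finset.sum_congr rfl fun i _ => by rw [coeff_C_mul, norm_mul]

theorem coeffNorm_X_pow_mul (k : ℕ) (p : ℂ[X]) : coeffNorm (X ^ k * p) = coeffNorm p := by
  by_cases hp : p = 0
  · simp [hp]
  rw [coeffNorm_eq (n := k + (p.natDegree + 1)) (by rw [natDegree_X_pow_mul _ hp]; omega),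
    coeffNorm_eq (n := p.natDegree + 1) (by omega), Finset.sum_range_add]
  rw [Finset.sum_eq_zero, zero_add]
  · exact Finset.sum_congr rfl fun i _ => by rw [add_comm k i, coeff_X_pow_mul]
  · intro i hi
    rw [coeff_X_pow_mul', if_neg (by simpa using hi), norm_zero]

theorem iteratedDeriv_polynomial (p : ℂ[X]) (k : ℕ) :
    iteratedDeriv k (fun z => p.eval z) = fun z => (derivative^[k] p).eval z := by
  induction k with
  | zero => simp
  | succ k ih =>
    rw [iteratedDeriv_succ, ih]
    funext z
    rw [Polynomial.deriv, Function.iterate_succ_apply']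

theorem norm_coeff_le {p : ℂ[X]} {r M : ℝ} (hr : 1 ≤ r) (hM : 0 ≤ M)
    (h : ∀ z : ℂ, ‖z‖ = r → ‖p.eval z‖ ≤ M) (k : ℕ) : ‖p.coeff k‖ ≤ M := by
  have h1 := Complex.norm_iteratedDeriv_le_of_forall_mem_sphere_norm_le (c := 0) (R := r) (C := M)
    k (f := fun z => p.eval z) (by linarith) (p.differentiable.diffContOnCl) (by simpa using h)
  rw [iteratedDeriv_polynomial] at h1
  have h2 : (derivative^[k] p).eval 0 = (k.factorial : ℂ) * p.coeff k := by
    rw [← coeff_zero_eq_eval_zero, coeff_iterate_derivative, zero_add, Nat.descFactorial_self,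
      nsmul_eq_mul]
  simp only [h2] at h1
  rw [norm_mul, Complex.norm_natCast, mul_div_assoc] at h1
  have h3 := le_of_mul_le_mul_left h1 (by exact_mod_cast k.factorial_pos)
  exact h3.trans (div_le_self hM (one_le_pow₀ hr))

end YoccozBrjuno

namespace YoccozBrjuno

open Topology Filter Polynomial Metric

section

variable {θ : ℝ} {k P : ℕ}

theorem norm_rot_pow_sub_le (hP : 0 < P) {j : ℕ} (hj : j ≤ P) :
    ‖rot θ ^ j - rot (k / P) ^ j‖ ≤ 2 * π * |P * θ - k| := by
  have hP' : (0:ℝ) < P := by exact_mod_cast hP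
  rw [rot_pow, rot_pow]
  refine (norm_rot_sub_le _ _).trans ?_
  have h1 : (j * θ - j * (k / P) : ℝ) = j / P * (P * θ - k) := by field_simp
  rw [h1, abs_mul, abs_of_nonneg (by positivity)]
  have h2 : (j / P : ℝ) ≤ 1 := by rw [div_le_one hP']; exact_mod_cast hj
  have := mul_le_of_le_one_left (abs_nonneg (P * θ - k)) h2
  gcongr

theorem prod_norm_one_sub (hP : 0 < P) (hk : k.Coprime P) :
    ∏ i ∈ Finset.range (P - 1), ‖rot (k / P) ^ (i + 1) - 1‖ = P := by
  have h := isPrimitiveRoot_rot hP hk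
  obtain ⟨n, rfl⟩ : ∃ n, P = n + 1 := ⟨P - 1, by omega⟩
  have := h.prod_one_sub_pow_eq_order
  have h2 := congrArg norm this
  rw [norm_prod] at h2
  simp only [norm_sub_rev (1 : ℂ)] at h2
  rw [Nat.add_sub_cancel, h2]
  have : ((n:ℂ) + 1) = ((n + 1 : ℕ) : ℂ) := by push_cast; ring
  rw [this, Complex.norm_natCast]

theorem le_prod_norm_pow_sub_one (hP : 2 ≤ P) (hk : k.Coprime P)
    (hβ : |P * θ - k| * (P:ℝ) ^ 8 ≤ 1) :
    (P : ℝ) / 2 ≤ ∏ i ∈ Finset.range (P - 1), ‖rot θ ^ (i + 1) - 1‖ := by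
  have hP' : (2:ℝ) ≤ P := by exact_mod_cast hP
  set β := |P * θ - k| with hβd
  have hβ0 : 0 ≤ β := abs_nonneg _
  set c : ℝ := 1 - π * β * P / 2 with hc
  have hP6 : (64:ℝ) ≤ (P:ℝ) ^ 6 := by
    calc (64:ℝ) = 2 ^ 6 := by norm_num
      _ ≤ _ := by gcongr
  have hβ2 : β * P ^ 2 ≤ 1 / 64 := by
    rw [le_div_iff₀ (by norm_num)]
    calc β * P ^ 2 * 64 ≤ β * P ^ 2 * P ^ 6 := by gcongr
      _ = β * P ^ 8 := by ring
      _ ≤ 1 := hβ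
  have hβ1 : β * P ≤ β * P ^ 2 := by nlinarith [mul_nonneg hβ0 (by linarith : (0:ℝ) ≤ P)]
  have hπ := Real.pi_lt_four
  have hπ0 := Real.pi_pos
  have hc0 : 0 ≤ c := by nlinarith
  have h1 : ∀ i ∈ Finset.range (P - 1), c * ‖rot (k / P) ^ (i + 1) - 1‖ ≤ ‖rot θ ^ (i + 1) - 1‖ := by
    intro i hi
    rw [Finset.mem_range] at hi
    have h2 := norm_rot_pow_sub_le (θ := θ) (k := k) (P := P) (by omega) (j := i + 1) (by omega)
    have h3 := le_norm_pow_sub_one (by omega) hk (i := i + 1) (by omega) (by omega)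
    rw [div_le_iff₀ (by linarith)] at h3
    have h4 : ‖rot (k / P) ^ (i + 1) - 1‖ ≤ ‖rot θ ^ (i + 1) - 1‖ +
        ‖rot θ ^ (i + 1) - rot (k / P) ^ (i + 1)‖ := by
      have := norm_sub_le_norm_sub_add_norm_sub (rot (k / P) ^ (i + 1)) (rot θ ^ (i + 1)) 1
      rw [norm_sub_rev (rot (k / P) ^ (i + 1)) (rot θ ^ (i + 1))] at this
      linarith
    rw [hc]
    nlinarith [mul_nonneg hπ0.le hβ0]
  calc (P : ℝ) / 2 ≤ c ^ (P - 1) * P := by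
        have := one_add_mul_sub_le_pow (a := c) (by linarith) (P - 1)
        have h5 : ((P - 1 : ℕ) : ℝ) = P - 1 := by push_cast [show 1 ≤ P by omega]; ring
        rw [h5] at this
        have h6 : 1 / 2 ≤ c ^ (P - 1) := by
          refine le_trans ?_ this
          rw [hc]
          nlinarith [mul_nonneg hπ0.le hβ0]
        nlinarith
    _ = ∏ i ∈ Finset.range (P - 1), c * ‖rot (k / P) ^ (i + 1) - 1‖ := by
        rw [Finset.prod_mul_distrib, prod_norm_one_sub (by omega) hk]; simp
    _ ≤ _ := Finset.prod_le_prod (fun i _ => by positivity) h1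

/-- The product of `X - λ ^ j` over `2 ≤ j ≤ P`. -/
noncomputable def cofilt (l : ℂ) (P : ℕ) : ℂ[X] := ∏ j ∈ Finset.Ico 2 (P + 1), (X - C (l ^ j))

theorem filt_eq_mul_cofilt (l : ℂ) (hP : 1 ≤ P) : filt l (P + 1) = (X - C l) * cofilt l P := by
  rw [filt, cofilt, Finset.prod_eq_prod_Ico_succ_bot (by omega), pow_one]

theorem natDegree_cofilt (l : ℂ) (P : ℕ) : (cofilt l P).natDegree = P - 1 := by
  rw [cofilt, natDegree_prod_of_monic _ _ fun j _ => monic_X_sub_C _]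
  simp only [natDegree_X_sub_C, Finset.sum_const, Nat.card_Ico, smul_eq_mul]
  omega

theorem X_sub_C_mul_cofilt_root (hP : 0 < P) (hk : k.Coprime P) :
    (X - C (rot (k / P))) * cofilt (rot (k / P)) P = X ^ P - 1 := by
  have h := isPrimitiveRoot_rot hP hk
  rw [← filt_eq_mul_cofilt _ hP, filt, Finset.prod_Ico_eq_prod_range, ← C_1,
    X_pow_sub_C_eq_prod h hP h.pow_eq_one, Nat.add_sub_cancel]
  refine Finset.prod_congr rfl fun i _ => ?_
  rw [pow_add, pow_one, mul_comm]

theorem norm_cofilt_eval_le (hP : 2 ≤ P) (hk : k.Coprime P)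
    (hβ : |P * θ - k| * (P:ℝ) ^ 8 ≤ 1) {x : ℂ} (hx : ‖x‖ = 1 + 1 / P) :
    ‖(cofilt (rot θ) P).eval x‖ ≤ 6 * P := by
  have hP' : (2:ℝ) ≤ P := by exact_mod_cast hP
  set β := |P * θ - k| with hβd
  have hβ0 : 0 ≤ β := abs_nonneg _
  have hP6 : (64:ℝ) ≤ (P:ℝ) ^ 6 := by
    calc (64:ℝ) = 2 ^ 6 := by norm_num
      _ ≤ _ := by gcongr
  have hβ2 : β * P ^ 2 ≤ 1 / 64 := by
    rw [le_div_iff₀ (by norm_num)]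
    calc β * P ^ 2 * 64 ≤ β * P ^ 2 * P ^ 6 := by gcongr
      _ = β * P ^ 8 := by ring
      _ ≤ 1 := hβ
  have hπ := Real.pi_lt_four
  have hπ0 := Real.pi_pos
  set ω := rot (k / P) with hω
  have hdist : ∀ j, 1 / P ≤ ‖x - ω ^ j‖ := by
    intro j
    have := norm_sub_norm_le x (ω ^ j)
    rw [hx, norm_pow, hω, norm_rot, one_pow] at this
    linarith
  set c : ℝ := 1 + 2 * π * β * P with hc
  have hc0 : 0 ≤ c := by positivity
  have h1 : ∀ j ∈ Finset.Ico 2 (P + 1), ‖x - rot θ ^ j‖ ≤ c * ‖x - ω ^ j‖ := by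
    intro j hj
    rw [Finset.mem_Ico] at hj
    have h2 := norm_rot_pow_sub_le (θ := θ) (k := k) (P := P) (by omega) (j := j) (by omega)
    have h3 := hdist j
    rw [div_le_iff₀ (by linarith)] at h3
    have h4 := norm_sub_le_norm_sub_add_norm_sub x (ω ^ j) (rot θ ^ j)
    rw [norm_sub_rev (ω ^ j)] at h4
    nlinarith [mul_nonneg hπ0.le hβ0]
  have h2 : ‖(cofilt (rot θ) P).eval x‖ ≤ c ^ (P - 1) * ‖(cofilt ω P).eval x‖ := by
    simp only [cofilt, eval_prod, norm_prod, eval_sub, eval_X, eval_C]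
    refine (Finset.prod_le_prod (fun i _ => norm_nonneg _) h1).trans (le_of_eq ?_)
    rw [Finset.prod_mul_distrib, Finset.prod_const, Nat.card_Ico]; congr 2
  have h3 : c ^ (P - 1) ≤ 3 / 2 := by
    have e1 : c ≤ Real.exp (2 * π * β * P) := by
      have := Real.add_one_le_exp (2 * π * β * P); rw [hc]; linarith
    calc c ^ (P - 1) ≤ Real.exp (2 * π * β * P) ^ P :=
          (pow_le_pow_left₀ hc0 e1 _).trans (pow_le_pow_right₀ (Real.one_le_exp (by positivity))
            (by omega))
      _ = Real.exp (2 * π * (β * P ^ 2)) := by rw [← Real.exp_nat_mul]; congr 1; ring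
      _ ≤ Real.exp (1 / 8) := by gcongr; nlinarith
      _ ≤ 3 / 2 := by
          have := Real.exp_bound' (x := 1 / 8) (by norm_num) (by norm_num) (n := 2) (by norm_num)
          norm_num [Finset.sum_range_succ] at this ⊢
          linarith
  have h4 : ‖(cofilt ω P).eval x‖ ≤ 4 * P := by
    have e1 := congrArg (fun p => ‖eval x p‖) (X_sub_C_mul_cofilt_root (by omega) hk)
    simp only [eval_mul, eval_sub, eval_X, eval_C, eval_pow, eval_one, norm_mul] at e1
    have e2 := hdist 1
    rw [pow_one] at e2
    have e3 : ‖x ^ P - 1‖ ≤ 4 := by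
      refine (norm_sub_le _ _).trans ?_
      rw [norm_pow, hx, norm_one]
      have : (1 + 1 / (P:ℝ)) ^ P ≤ Real.exp 1 := by
        have e4 : 1 + 1 / (P:ℝ) ≤ Real.exp (1 / P) := by
          have := Real.add_one_le_exp (1 / (P:ℝ)); linarith
        refine (pow_le_pow_left₀ (by positivity) e4 _).trans (le_of_eq ?_)
        rw [← Real.exp_nat_mul]; congr 1; field_simp
      linarith [Real.exp_one_lt_d9]
    rw [← e1, ← hω] at e3
    have e5 : 1 / P * ‖(cofilt ω P).eval x‖ ≤ 4 := (mul_le_mul_of_nonneg_right e2 (norm_nonneg _)).trans e3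
    rw [one_div, inv_mul_le_iff₀ (by linarith)] at e5
    linarith
  calc _ ≤ _ := h2
    _ ≤ 3 / 2 * (4 * P) := by gcongr
    _ = _ := by ring

theorem coeffNorm_cofilt_le (hP : 2 ≤ P) (hk : k.Coprime P)
    (hβ : |P * θ - k| * (P:ℝ) ^ 8 ≤ 1) : coeffNorm (cofilt (rot θ) P) ≤ 6 * P ^ 2 := by
  have h1 := norm_coeff_le (p := cofilt (rot θ) P) (r := 1 + 1 / P) (M := 6 * P)
    (by have : (0:ℝ) ≤ 1 / P := by positivity
        linarith) (by positivity) (fun z hz => norm_cofilt_eval_le hP hk hβ hz)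
  rw [coeffNorm_eq (n := P) (by rw [natDegree_cofilt]; omega)]
  refine (Finset.sum_le_sum fun i _ => h1 i).trans (le_of_eq ?_)
  simp; ring

theorem norm_cofilt_eval (θ : ℝ) (P : ℕ) : ‖(cofilt (rot θ) P).eval (rot θ ^ (P + 1))‖ =
    ∏ i ∈ Finset.range (P - 1), ‖rot θ ^ (i + 1) - 1‖ := by
  simp only [cofilt, eval_prod, norm_prod, eval_sub, eval_X, eval_C]
  rw [Finset.prod_Ico_eq_prod_range, ← Finset.prod_range_reflect]
  refine Finset.prod_congr (by congr 1) fun i hi => ?_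
  rw [Finset.mem_range] at hi
  have : P + 1 = (2 + (P + 1 - 2 - 1 - i)) + (i + 1) := by omega
  nth_rewrite 1 [this]
  rw [pow_add, ← mul_sub_one, norm_mul, norm_pow, norm_rot, one_pow, one_mul]

/-- A multiple of `filt λ (P + 1)`, of moderate degree and `ℓ¹` norm, equal to `1` at `λ ^ (P + 1)`. -/
theorem exists_filter (hP : 2 ≤ P) (hk : k.Coprime P) (hβ0 : 0 < |P * θ - k|)
    (hβ : |P * θ - k| * (P:ℝ) ^ 8 ≤ 1) :
    ∃ d : ℂ[X], (d * filt (rot θ) (P + 1)).eval (rot θ ^ (P + 1)) = 1 ∧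
      ((d * filt (rot θ) (P + 1)).natDegree : ℝ) ≤ 1 / (P ^ 2 * |P * θ - k|) + P ∧
      coeffNorm (d * filt (rot θ) (P + 1)) ≤ 6 * P ^ 3 := by
  have hP' : (2:ℝ) ≤ P := by exact_mod_cast hP
  set β := |P * θ - k| with hβd
  set l := rot θ with hl
  set W := cofilt l P with hW
  set K := ⌈1 / (P ^ 2 * β)⌉₊ with hK
  have hK1 : 1 / (P ^ 2 * β) ≤ K := Nat.le_ceil _
  have hK2 : (K:ℝ) < 1 / (P ^ 2 * β) + 1 := Nat.ceil_lt_add_one (by positivity)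
  have hP6 : (64:ℝ) ≤ (P:ℝ) ^ 6 := by
    calc (64:ℝ) = 2 ^ 6 := by norm_num
      _ ≤ _ := by gcongr
  have hβ2 : β * P ^ 2 ≤ 1 / 64 := by
    rw [le_div_iff₀ (by norm_num)]
    calc β * P ^ 2 * 64 ≤ β * P ^ 2 * P ^ 6 := by gcongr
      _ = β * P ^ 8 := by ring
      _ ≤ 1 := hβ
  have hP2 : (4:ℝ) ≤ (P:ℝ) ^ 2 := by nlinarith
  have hKβ1 : 1 / (P:ℝ) ^ 2 ≤ K * β := by
    rw [div_le_iff₀ (by positivity)] at hK1 ⊢; linarith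
  have hKβ2 : K * β ≤ 1 / 2 := by
    have e1 : K * β ≤ (1 / (P ^ 2 * β) + 1) * β := by gcongr
    have e2 : (1 / (P ^ 2 * β) + 1) * β = 1 / P ^ 2 + β := by field_simp
    have e3 : 1 / (P:ℝ) ^ 2 ≤ 1 / 4 := by gcongr
    nlinarith
  set ν : ℂ := ((l ^ (P + 1)) ^ K - l ^ K) * W.eval (l ^ (P + 1)) with hν
  have hnu : 2 / (P:ℝ) ≤ ‖ν‖ := by
    have e1 : (l ^ (P + 1)) ^ K - l ^ K = l ^ K * (rot (K * (P * θ)) - 1) := by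
      rw [mul_sub, mul_one, hl, rot_pow, rot_pow, rot_pow, ← rot_add]
      congr 2; push_cast; ring
    have e2 : |(K * (P * θ) : ℝ) - ((K * k : ℕ) : ℤ)| = K * β := by
      push_cast
      rw [← mul_sub, abs_mul, abs_of_nonneg (by positivity : (0:ℝ) ≤ K)]
    have e3 := le_norm_rot_sub_one (x := K * (P * θ)) ((K * k : ℕ) : ℤ) (by rw [e2]; exact hKβ2)
    rw [e2] at e3
    rw [hν, norm_mul, e1, norm_mul, norm_pow, hl, norm_rot, one_pow, one_mul, hW, hl, norm_cofilt_eval]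
    have e4 := le_prod_norm_pow_sub_one hP hk hβ
    calc 2 / (P:ℝ) = (4 * (1 / P ^ 2)) * (P / 2) := by field_simp; norm_num
      _ ≤ _ := by gcongr; linarith
  have hν0 : ν ≠ 0 := by rw [← norm_pos_iff]; exact lt_of_lt_of_le (by positivity) hnu
  refine ⟨C ν⁻¹ * ∑ i ∈ Finset.range K, X ^ i * C l ^ (K - 1 - i), ?_⟩
  have key : C ν⁻¹ * (∑ i ∈ Finset.range K, X ^ i * C l ^ (K - 1 - i)) * filt l (P + 1) =
      C ν⁻¹ * (X ^ K * W + C (- l ^ K) * W) := by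
    rw [filt_eq_mul_cofilt _ (by omega), mul_assoc, ← mul_assoc (∑ i ∈ _, _), geom_sum₂_mul]
    simp only [C_neg, C_pow]; ring
  rw [key]
  refine ⟨?_, ?_, ?_⟩
  · simp only [eval_mul, eval_add, eval_C, eval_pow, eval_X]
    rw [← add_mul, ← sub_eq_add_neg, ← hν, inv_mul_cancel₀ hν0]
  · have : (C ν⁻¹ * (X ^ K * W + C (- l ^ K) * W)).natDegree ≤ K + (P - 1) := by
      refine (natDegree_C_mul_le _ _).trans ?_
      refine (natDegree_add_le _ _).trans (max_le ?_ ?_)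
      · refine natDegree_mul_le.trans ?_
        rw [natDegree_X_pow, hW, natDegree_cofilt]
      · refine (natDegree_C_mul_le _ _).trans ?_
        rw [hW, natDegree_cofilt]; omega
    have : ((C ν⁻¹ * (X ^ K * W + C (- l ^ K) * W)).natDegree : ℝ) ≤ ((K + (P - 1) : ℕ) : ℝ) := by
      exact_mod_cast this
    push_cast [show 1 ≤ P by omega] at this
    linarith
  · rw [coeffNorm_C_mul]
    have e1 := coeffNorm_add_le (X ^ K * W) (C (- l ^ K) * W)
    rw [coeffNorm_X_pow_mul, coeffNorm_C_mul, norm_neg, norm_pow, hl, norm_rot, one_pow, one_mul,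
      ← hl] at e1
    have e2 := coeffNorm_cofilt_le hP hk hβ
    rw [← hl, ← hW] at e2
    have e3 : ‖ν⁻¹‖ ≤ P / 2 := by
      rw [norm_inv, inv_le_comm₀ (norm_pos_iff.2 hν0) (by positivity), inv_div]
      exact hnu
    calc _ ≤ P / 2 * (6 * P ^ 2 + 6 * P ^ 2 : ℝ) :=
          mul_le_mul e3 (e1.trans (add_le_add e2 e2)) (Finset.sum_nonneg fun _ _ => norm_nonneg _)
            (by positivity)
      _ = _ := by ring

end

end YoccozBrjuno

namespace YoccozBrjuno

open Topology Filter Polynomial Metric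

theorem nrm_rot_ne_zero {θ : ℝ} (hirr : Irrational θ) (n : ℕ) : nrm (rot θ) n ≠ 0 := by
  refine nrm_ne_zero fun j hj h => ?_
  rw [Finset.mem_Ico] at hj
  have h1 : rot ((n - j : ℕ) * θ) = 1 := by
    rw [← rot_pow]
    have h2 : rot θ ^ n = rot θ ^ j * rot θ ^ (n - j) := by rw [← pow_add]; congr 1; omega
    rw [h2] at h
    exact mul_left_cancel₀ (pow_ne_zero _ (rot_ne_zero θ)) (h.trans (mul_one _).symm)
  have h3 := le_norm_rot_sub_one (round ((n - j : ℕ) * θ)) (abs_sub_round _)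
  rw [h1, sub_self, norm_zero] at h3
  have h4 : |((n - j : ℕ) * θ) - round (((n - j : ℕ) : ℝ) * θ)| = 0 :=
    le_antisymm (by linarith) (abs_nonneg _)
  rw [abs_eq_zero, sub_eq_zero] at h4
  exact (hirr.natCast_mul (m := n - j) (by omega)).ne_int _ h4

theorem GamBound.mono {l : ℂ} {n : ℕ} {R δ A R' δ' A' : ℝ} (h : GamBound l n R δ A) (hR : R ≤ R')
    (hδ : δ' ≤ δ) (hA : A ≤ A') : GamBound l n R' δ' A' := fun u hu v hv hv0 hv1 =>
  (h u (hu.mono hR hδ) v (hv.mono (ball_subset_ball hR)) hv0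
    fun z hz => hv1 z (ball_subset_ball hR hz)).trans hA

theorem le_of_gamBound {l : ℂ} {n : ℕ} {R δ A : ℝ} (hn : 1 ≤ n) (hnl : nrm l n ≠ 0) (hδ : 0 ≤ δ)
    (hR : R ≤ 2) (h : GamBound l n R δ A) : (1 / 2) ^ n ≤ A := by
  have h0 : SmallPert R δ (fun _ => 0) := ⟨by fun_prop, rfl, by simp, by simpa using fun _ _ => hδ⟩
  have hv : (fun z : ℂ => (1 / 2 : ℂ) ^ n * z ^ n) ∈ vanishing n :=
    (vanishing n).smul_mem _ (vanishing_pow_self n)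
  have h1 := h _ h0 (fun z => (1 / 2 : ℂ) ^ n * z ^ n) (by fun_prop)
    (by simp [show n ≠ 0 by omega]) (fun z hz => by
      rw [mem_ball_zero_iff] at hz
      rw [← mul_pow, norm_pow, norm_mul]
      refine pow_le_one₀ (by positivity) ?_
      norm_num; linarith)
  rw [gam_vanishing (vanishing_one.2 ⟨by unfold germ; fun_prop, by simp [germ]⟩)
    (by unfold germ; simp) hnl hv] at h1
  have h2 : coef n (fun z : ℂ => (1 / 2 : ℂ) ^ n * z ^ n) = (1 / 2) ^ n := by
    have := coef_smul (n := n) ((1 / 2 : ℂ) ^ n) (u := fun z => z ^ n) (by fun_prop)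
    rw [coef_pow_self, mul_one] at this
    exact this
  rw [h2] at h1
  simpa using h1

section

variable {θ : ℝ}

theorem abs_cfQ_mul_sub (hθ : θ ∈ Set.Ioo (0 : ℝ) 1) (hirr : Irrational θ) (n : ℕ) :
    |cfQ θ n * θ - cfP θ n| = gaussProd θ (n + 1) := by
  rw [cfQ_mul_sub_cfP hθ hirr, abs_mul, abs_pow, abs_neg, abs_one, one_pow, one_mul,
    abs_of_pos (gaussProd_pos hθ hirr _)]

theorem norm_rot_pow_succ_sub_le (hθ : θ ∈ Set.Ioo (0 : ℝ) 1) (hirr : Irrational θ) (n : ℕ) :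
    ‖rot θ ^ (cfQ θ n + 1) - rot θ‖ ≤ 2 * π * gaussProd θ (n + 1) := by
  rw [← abs_cfQ_mul_sub hθ hirr, pow_succ, ← sub_one_mul, norm_mul, norm_rot, mul_one, rot_pow]
  have := norm_rot_sub_le (cfQ θ n * θ) ((cfP θ n : ℤ) : ℝ)
  rw [rot_int] at this
  simpa using this

/-- The summable error term of the renormalization estimate. -/
noncomputable def cfErr (θ : ℝ) (n : ℕ) : ℝ := (n + 1 + Real.log (cfQ θ n)) / cfQ θ n

/-- The level `n` has a very good rational approximation. -/
def GoodLevel (θ : ℝ) (n : ℕ) : Prop := 2 ≤ cfQ θ n ∧ gaussProd θ (n + 1) * (cfQ θ n : ℝ) ^ 8 ≤ 1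

theorem step_exponent {P p K m β x u U L : ℝ} (hP : 2 ≤ P) (hpP : P ^ 2 ≤ p)
    (hK : K ≤ 2 * p / P ^ 2 + P) (hx : p * x = -β) (hm : 0 ≤ m) (hL : 0 ≤ L) (huU : u ≤ U) :
    p * (2 + 3 * L) + ((K + 2) * 1.4 + (3 * m + 20 + β + (p + 1) * u)) * (P + 1) ≤
      (P + 1) * (u - x + 30 * ((m + 1 + L) / P) + U / p) * p := by
  have hp0 : 0 < p := by nlinarith
  have hP0 : 0 < P := by linarith
  set t := p / P with ht
  have hpt : p = t * P := by rw [ht]; field_simp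
  have htP : P ≤ t := by rw [ht, le_div_iff₀ hP0]; nlinarith
  have e1 : (P + 1) * (u - x + 30 * ((m + 1 + L) / P) + U / p) * p =
      (P + 1) * (p * u + β + 30 * t * (m + 1 + L) + U) := by
    have : U / p * p = U := by field_simp
    have h2 : 30 * ((m + 1 + L) / P) * p = 30 * t * (m + 1 + L) := by rw [hpt]; field_simp
    calc _ = (P + 1) * (p * u - p * x + 30 * ((m + 1 + L) / P) * p + U / p * p) := by ring
      _ = _ := by rw [this, h2, hx]; ring
  have e2 : 2 * p / P ^ 2 ≤ t := by
    rw [hpt, div_le_iff₀ (by positivity)]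
    nlinarith [mul_pos hP0 (by linarith : 0 < t)]
  rw [e1]
  have e3 : (K + 2) * 1.4 ≤ 5.6 * t := by linarith
  have e4 : 3 * m + 20 ≤ (3 * m + 20) * t := by nlinarith
  have e5 : p * (2 + 3 * L) ≤ (P + 1) * (t * (2 + 3 * L)) := by
    rw [hpt]; nlinarith [mul_nonneg (by linarith : 0 ≤ t) (by linarith : 0 ≤ 2 + 3 * L)]
  have e6 : 0 ≤ t * m := mul_nonneg (by linarith) hm
  have e7 : 0 ≤ t * L := mul_nonneg (by linarith) hL
  have e8 : t * (2 + 3 * L) + ((K + 2) * 1.4 + (3 * m + 20 + β + (p + 1) * u)) ≤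
      p * u + β + 30 * t * (m + 1 + L) + U := by nlinarith
  have := mul_le_mul_of_nonneg_left e8 (by linarith : 0 ≤ P + 1)
  nlinarith

theorem log_six_mul_pow {P : ℝ} (hP : 2 ≤ P) : 6 * P ^ 3 ≤ Real.exp (2 + 3 * Real.log P) := by
  have h1 : Real.exp (2 + 3 * Real.log P) = Real.exp 2 * P ^ 3 := by
    rw [Real.exp_add, show 3 * Real.log P = Real.log P * (3 : ℕ) by push_cast; ring, Real.exp_mul,
      Real.exp_log (by linarith), Real.rpow_natCast]
  rw [h1]
  have h2 : (6:ℝ) ≤ Real.exp 2 := by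
    have := Real.exp_one_gt_d9
    have h3 : Real.exp 2 = Real.exp 1 * Real.exp 1 := by rw [← Real.exp_add]; norm_num
    nlinarith
  gcongr

/-- One step of the renormalization induction, from level `n` to a lower level `m`. -/
theorem gamBound_level (hθ : θ ∈ Set.Ioo (0 : ℝ) 1) (hirr : Irrational θ) {m n : ℕ} (hmn : m < n)
    (hm : GoodLevel θ m) {R δ u U : ℝ} (hR : 0 < R) (hRm : R + (1 / 2) ^ (m + 1) ≤ 2)
    (hδ : δ ≤ 1 / 8) (huU : u ≤ U)
    (h : GamBound (rot θ) (cfQ θ n + 1) R δ (Real.exp ((cfQ θ n + 1) * u))) :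
    GamBound (rot θ) (cfQ θ m + 1) (R + (1 / 2) ^ (m + 1)) (δ - (1 / 2) ^ (m + 6))
      (Real.exp ((cfQ θ m + 1) * (u - brjunoMain θ n + 30 * cfErr θ m + U / cfQ θ n))) := by
  obtain ⟨hP, hβm⟩ := hm
  have hmono : cfQ θ (m + 1) ≤ cfQ θ n := cfQ_mono hθ hirr hmn
  have h1β := one_div_gaussProd_le hθ hirr m
  have hβ0 := gaussProd_pos hθ hirr (m + 1)
  have hβn0 := gaussProd_pos hθ hirr (n + 1)
  have hcop := cfQ_coprime θ m
  have hgap := abs_cfQ_mul_sub hθ hirr m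
  have hlam := norm_rot_pow_succ_sub_le hθ hirr n
  set P := cfQ θ m with hPd
  set p := cfQ θ n with hpd
  have hP' : (2:ℝ) ≤ P := by exact_mod_cast hP
  obtain ⟨d, hd1, hd2, hd3⟩ := exists_filter (θ := θ) hP hcop (by rw [hgap]; exact hβ0)
    (by rw [hgap]; exact hβm)
  rw [hgap] at hd2
  have hp2 : 1 / gaussProd θ (m + 1) ≤ 2 * p := by
    refine h1β.trans ?_
    gcongr
  have hpP : (P:ℝ) ^ 2 ≤ p := by
    have e1 : (P:ℝ) ^ 8 ≤ 1 / gaussProd θ (m + 1) := by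
      rw [le_div_iff₀ hβ0]; linarith
    have e2 : (2:ℝ) ≤ (P:ℝ) ^ 6 := by
      calc (2:ℝ) ≤ 2 ^ 6 := by norm_num
        _ ≤ _ := by gcongr
    nlinarith [sq_nonneg (P:ℝ)]
  have hp0 : (0:ℝ) < p := by nlinarith
  have hp1 : 1 ≤ p := by exact_mod_cast hp0
  set D := (d * filt (rot θ) (P + 1)).natDegree with hD
  have hK : (D:ℝ) ≤ 2 * p / P ^ 2 + P := by
    refine hd2.trans (add_le_add_left ?_ _)
    rw [mul_comm, ← div_div]
    gcongr
  have hx : p * brjunoMain θ n = -Real.log (gaussProd θ (n + 1)) := by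
    rw [brjunoMain, ← hpd, one_div, Real.log_inv]; field_simp
  have key := step_exponent (β := Real.log (gaussProd θ (n + 1))) (m := m) (L := Real.log P)
    hP' hpP hK hx (Nat.cast_nonneg m) (Real.log_nonneg (by linarith)) huU
  have hε : (1 / 2 : ℝ) ^ (m + 1) = 2 * (1 / 2) ^ (m + 2) := by ring
  rw [hε] at hRm ⊢
  refine gamBound_step (norm_rot θ) hp1 (nrm_rot_ne_zero hirr _) hR (by positivity) hRm
    (by positivity) (pow_le_one₀ (by norm_num) (by norm_num)) hδ (Real.exp_pos _) h (by omega)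
    (nrm_rot_ne_zero hirr _) hd1 le_rfl hd3 (Real.exp_pos _).le ?_
  have f1 : (6 * (P:ℝ) ^ 3) ^ p ≤ Real.exp (p * (2 + 3 * Real.log P)) := by
    rw [Real.exp_nat_mul]
    exact pow_le_pow_left₀ (by positivity) (log_six_mul_pow hP') _
  have f2 : (4:ℝ) ^ (D + 2) ≤ Real.exp ((D + 2) * 1.4) := by
    have : Real.log 4 ≤ 1.4 := by
      rw [show (4:ℝ) = 2 ^ 2 by norm_num, Real.log_pow]
      have := Real.log_two_lt_d9
      push_cast; linarith
    calc (4:ℝ) ^ (D + 2) = Real.exp (Real.log 4) ^ (D + 2) := by rw [Real.exp_log (by norm_num)]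
      _ = Real.exp ((D + 2) * Real.log 4) := by rw [← Real.exp_nat_mul]; push_cast; rfl
      _ ≤ _ := by gcongr
  have f3 : 128 * ‖rot θ ^ (p + 1) - rot θ‖ * Real.exp ((p + 1) * u) /
      (((1 / 2) ^ (m + 2)) ^ 2 * (1 / 2) ^ (m + 6)) ≤
      Real.exp (3 * m + 20 + Real.log (gaussProd θ (n + 1)) + (p + 1) * u) := by
    rw [Real.exp_add, Real.exp_add, Real.exp_log hβn0]
    have e1 : ((((1 / 2 : ℝ) ^ (m + 2)) ^ 2 * (1 / 2) ^ (m + 6)))⁻¹ = 2 ^ (3 * m + 10) := by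
      rw [← pow_mul, ← pow_add, one_div, inv_pow, inv_inv]; congr 1; ring
    have e2 : (2:ℝ) ^ (3 * m + 20) ≤ Real.exp (3 * m + 20) := by
      have : (2:ℝ) ≤ Real.exp 1 := by linarith [Real.exp_one_gt_d9]
      calc (2:ℝ) ^ (3 * m + 20) ≤ Real.exp 1 ^ (3 * m + 20) := by gcongr
        _ = _ := by rw [← Real.exp_nat_mul]; push_cast; rw [mul_one]
    have e3 : 128 * ‖rot θ ^ (p + 1) - rot θ‖ ≤ 2 ^ 10 * gaussProd θ (n + 1) := by
      have : 2 * π * gaussProd θ (n + 1) ≤ 2 * 4 * gaussProd θ (n + 1) := by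
        have := Real.pi_le_four
        gcongr
      linarith
    rw [div_eq_mul_inv, e1]
    calc 128 * ‖rot θ ^ (p + 1) - rot θ‖ * Real.exp ((p + 1) * u) * 2 ^ (3 * m + 10) ≤
        2 ^ 10 * gaussProd θ (n + 1) * Real.exp ((p + 1) * u) * 2 ^ (3 * m + 10) := by gcongr
      _ = 2 ^ (3 * m + 20) * gaussProd θ (n + 1) * Real.exp ((p + 1) * u) := by ring
      _ ≤ _ := by gcongr
  calc _ ≤ Real.exp (p * (2 + 3 * Real.log P)) * (Real.exp ((D + 2) * 1.4) *
        Real.exp (3 * m + 20 + Real.log (gaussProd θ (n + 1)) + (p + 1) * u)) ^ (P + 1) := by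
        gcongr
    _ = Real.exp (p * (2 + 3 * Real.log P) + ((D + 2) * 1.4 +
        (3 * m + 20 + Real.log (gaussProd θ (n + 1)) + (p + 1) * u)) * (P + 1)) := by
        rw [← Real.exp_add ((D + 2) * 1.4), ← Real.exp_nat_mul, ← Real.exp_add]; push_cast; congr 1; ring
    _ ≤ _ := by
        rw [← Real.exp_nat_mul, cfErr, ← hPd]
        refine Real.exp_le_exp.2 (key.trans (le_of_eq ?_))
        ring

end

end YoccozBrjuno

namespace YoccozBrjuno

open Topology Filter Polynomial Metric

section

variable {θ : ℝ}

/-- The radius and derivative bounds used at level `n` of the renormalization induction. -/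
def LevelBound (θ : ℝ) (n : ℕ) (u : ℝ) : Prop :=
  GamBound (rot θ) (cfQ θ n + 1) (1 + (1 / 2) ^ n) (1 / 16 * (1 - (1 / 2) ^ (n + 1)))
    (Real.exp ((cfQ θ n + 1) * u))

theorem LevelBound.mono {n : ℕ} {u u' : ℝ} (h : LevelBound θ n u) (hu : u ≤ u') :
    LevelBound θ n u' :=
  GamBound.mono h le_rfl le_rfl (by gcongr)

theorem LevelBound.step (hθ : θ ∈ Set.Ioo (0 : ℝ) 1) (hirr : Irrational θ) {m n : ℕ} (hmn : m < n)
    (hm : GoodLevel θ m) {u U : ℝ} (huU : u ≤ U) (h : LevelBound θ n u) :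
    LevelBound θ m (u - brjunoMain θ n + 30 * cfErr θ m + U / cfQ θ n) := by
  have h1 : (1 / 2 : ℝ) ^ n ≤ (1 / 2) ^ (m + 1) := pow_le_pow_of_le_one (by norm_num) (by norm_num) hmn
  have h2 : (1 / 2 : ℝ) ^ (m + 1) ≤ 1 / 2 := by
    rw [pow_succ]; have : (1 / 2 : ℝ) ^ m ≤ 1 := pow_le_one₀ (by norm_num) (by norm_num)
    linarith
  have h3 : 0 < (1 / 2 : ℝ) ^ n := by positivity
  have h4 : (1 / 2 : ℝ) ^ m = 2 * (1 / 2) ^ (m + 1) := by ring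
  have h5 : (1 / 2 : ℝ) ^ (m + 6) = (1 / 2) ^ (m + 1) / 32 := by ring
  have h6 : (1 / 2 : ℝ) ^ (n + 1) = (1 / 2) ^ n / 2 := by ring
  refine GamBound.mono (gamBound_level hθ hirr hmn hm (by positivity) (by linarith) (by linarith)
    huU h) (by linarith) ?_ le_rfl
  rw [h5, h6]; linarith

theorem LevelBound.ge (hirr : Irrational θ) {n : ℕ} {u : ℝ} (h : LevelBound θ n u) :
    -Real.log 2 ≤ u := by
  have h0 : (1 / 2 : ℝ) ^ n ≤ 1 := pow_le_one₀ (by norm_num) (by norm_num)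
  have h1 : (1 / 2 : ℝ) ^ (n + 1) ≤ 1 := pow_le_one₀ (by norm_num) (by norm_num)
  have h2 := le_of_gamBound (by omega) (nrm_rot_ne_zero hirr _) (by linarith) (by linarith) h
  have h3 : (1 / 2 : ℝ) ^ (cfQ θ n + 1) = Real.exp ((cfQ θ n + 1) * (-Real.log 2)) := by
    have : (1 / 2 : ℝ) = Real.exp (-Real.log 2) := by
      rw [Real.exp_neg, Real.exp_log (by norm_num)]; norm_num
    rw [this, ← Real.exp_nat_mul]; push_cast; rfl
  rw [h3, Real.exp_le_exp] at h2
  exact le_of_mul_le_mul_left h2 (by positivity)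

theorem cfErr_nonneg (hθ : θ ∈ Set.Ioo (0 : ℝ) 1) (hirr : Irrational θ) (n : ℕ) :
    0 ≤ cfErr θ n := by
  have : 0 ≤ Real.log (cfQ θ n) := Real.log_nonneg (by exact_mod_cast cfQ_pos hθ hirr n)
  rw [cfErr]; positivity

theorem one_div_cfQ_le (hθ : θ ∈ Set.Ioo (0 : ℝ) 1) (hirr : Irrational θ) (n : ℕ) :
    1 / cfQ θ n ≤ cfErr θ n := by
  have : 0 ≤ Real.log (cfQ θ n) := Real.log_nonneg (by exact_mod_cast cfQ_pos hθ hirr n)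
  rw [cfErr]; gcongr; linarith [Nat.cast_nonneg (α := ℝ) n]

theorem levelBound_finset (hθ : θ ∈ Set.Ioo (0 : ℝ) 1) (hirr : Irrational θ) {U₀ : ℝ}
    (hU₀ : 0 ≤ U₀) (base : ∀ n, LevelBound θ n U₀) {E : ℝ}
    (hE : ∀ F : Finset ℕ, ∑ k ∈ F, cfErr θ k ≤ E) {m₀ : ℕ}
    (hm₀ : ∀ F : Finset ℕ, (∀ k ∈ F, m₀ ≤ k) → ∑ k ∈ F, 1 / (cfQ θ k : ℝ) ≤ 1 / 2) (F : Finset ℕ) :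
    (∀ k ∈ F, m₀ ≤ k ∧ GoodLevel θ k) → ∀ n, GoodLevel θ n → (∀ k ∈ F, n < k) →
      LevelBound θ n (U₀ - ∑ k ∈ F, brjunoMain θ k +
        2 * (U₀ + 30 * E) * ∑ k ∈ F, 1 / (cfQ θ k : ℝ) + 30 * ∑ k ∈ insert n F, cfErr θ k) := by
  have hE0 : 0 ≤ E := by simpa using hE ∅
  induction F using Finset.induction_on_min with
  | empty =>
    intro _ n _ _
    refine (base n).mono ?_
    have := cfErr_nonneg hθ hirr n
    simp; exact this
  | insert a s ha ih =>
    intro hF n hn hnF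
    have hs : ∀ k ∈ s, m₀ ≤ k ∧ GoodLevel θ k := fun k hk => hF k (by simp [hk])
    have h1 := ih hs a (hF a (by simp)).2 ha
    have hx : 0 ≤ ∑ k ∈ s, brjunoMain θ k := Finset.sum_nonneg fun k _ => brjunoMain_nonneg hθ hirr k
    have hq := mul_le_mul_of_nonneg_left (hm₀ s fun k hk => (hs k hk).1)
      (by positivity : 0 ≤ 2 * (U₀ + 30 * E))
    have h2 := h1.step hθ hirr (hnF a (by simp)) hn (U := 2 * (U₀ + 30 * E))
      (by linarith [hE (insert a s)])
    have has : a ∉ s := fun h => (ha a h).ne rfl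
    have hns : n ∉ insert a s := fun h => (hnF n h).ne rfl
    convert h2 using 1
    rw [Finset.sum_insert hns, Finset.sum_insert has, Finset.sum_insert has, div_eq_mul_one_div]
    ring

/-- A uniform exponential bound at every level implies convergence of the Brjuno series. -/
theorem summable_of_levelBound (hθ : θ ∈ Set.Ioo (0 : ℝ) 1) (hirr : Irrational θ) {U₀ : ℝ}
    (hU₀ : 0 ≤ U₀) (base : ∀ n, LevelBound θ n U₀) : Summable (brjunoTerm θ) := by
  have herr : Summable (cfErr θ) := summable_error hθ hirr
  have hinv : Summable fun n => 1 / (cfQ θ n : ℝ) :=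
    Summable.of_nonneg_of_le (fun n => by positivity) (one_div_cfQ_le hθ hirr) herr
  set E := ∑' k, cfErr θ k
  have hE : ∀ F : Finset ℕ, ∑ k ∈ F, cfErr θ k ≤ E := fun F =>
    herr.sum_le_tsum F fun k _ => cfErr_nonneg hθ hirr k
  obtain ⟨s, hs⟩ := summable_iff_vanishing_norm.1 hinv (1 / 2) (by norm_num)
  obtain ⟨m₀, hm₀4, hm₀s⟩ : ∃ m₀ : ℕ, 4 ≤ m₀ ∧ ∀ k ∈ s, k < m₀ := by
    refine ⟨s.sup id + 4 + 1, by omega, fun k hk => ?_⟩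
    have := Finset.le_sup (f := id) hk
    simp only [id] at this; omega
  have hm₀ : ∀ F : Finset ℕ, (∀ k ∈ F, m₀ ≤ k) → ∑ k ∈ F, 1 / (cfQ θ k : ℝ) ≤ 1 / 2 := by
    intro F hF
    have := hs F (Finset.disjoint_left.2 fun k hk hks => by
      have := hF k hk; have := hm₀s k hks; omega)
    exact (Real.le_norm_self _).trans this.le
  classical
  set y : ℕ → ℝ := fun k => if m₀ ≤ k ∧ GoodLevel θ k then brjunoMain θ k else 0 with hy
  have hy0 : ∀ k, 0 ≤ y k := fun k => by
    simp only [hy]; split_ifs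
    · exact brjunoMain_nonneg hθ hirr k
    · exact le_rfl
  have hysum : Summable y := by
    by_cases hne : ∃ k, m₀ ≤ k ∧ GoodLevel θ k
    · set n₀ := Nat.find hne
      have hn₀ : m₀ ≤ n₀ ∧ GoodLevel θ n₀ := Nat.find_spec hne
      refine summable_of_sum_le (c := brjunoMain θ n₀ + (U₀ + (U₀ + 30 * E) + 30 * E + Real.log 2))
        hy0 fun F => ?_
      set G := (F.filter fun k => m₀ ≤ k ∧ GoodLevel θ k).erase n₀ with hG
      have e1 : ∑ k ∈ F, y k ≤ brjunoMain θ n₀ + ∑ k ∈ G, brjunoMain θ k := by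
        rw [hy, ← Finset.sum_filter, hG]
        by_cases hmem : n₀ ∈ F.filter fun k => m₀ ≤ k ∧ GoodLevel θ k
        · rw [Finset.add_sum_erase _ _ hmem]
        · rw [Finset.erase_eq_of_notMem hmem]
          linarith [brjunoMain_nonneg hθ hirr n₀]
      have hGmem : ∀ k ∈ G, m₀ ≤ k ∧ GoodLevel θ k := fun k hk =>
        (Finset.mem_filter.1 (Finset.mem_of_mem_erase hk)).2
      have e2 := (levelBound_finset hθ hirr hU₀ base hE hm₀ G hGmem n₀ hn₀.2 (fun k hk =>
        lt_of_le_of_ne (Nat.find_min' hne (hGmem k hk)) (Finset.ne_of_mem_erase hk).symm)).ge hirr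
      have hE0 : 0 ≤ E := by simpa using hE ∅
      have hq := mul_le_mul_of_nonneg_left (hm₀ G fun k hk => (hGmem k hk).1)
        (by positivity : 0 ≤ 2 * (U₀ + 30 * E))
      linarith [hE (insert n₀ G)]
    · push Not at hne
      have : y = fun _ => 0 := by
        funext k; simp only [hy]; rw [if_neg]; rintro ⟨h1, h2⟩; exact hne k h1 h2
      rw [this]; exact summable_zero
  refine Summable.of_norm_bounded_eventually_nat (hysum.add (herr.mul_left 8)) ?_
  filter_upwards [eventually_ge_atTop m₀] with k hk
  rw [Real.norm_of_nonneg (brjunoTerm_nonneg hθ hirr k)]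
  refine (brjunoTerm_le hθ hirr k).trans ?_
  have hek := cfErr_nonneg hθ hirr k
  by_cases hg : GoodLevel θ k
  · simp only [hy, if_pos (And.intro hk hg)]; linarith
  · have hq2 : 2 ≤ cfQ θ k := by
      by_contra hlt
      have h1 : cfQ θ k ≤ 1 := by omega
      have h2 := cfQ_growth hθ hirr k
      have h3 : (4 / 3 : ℝ) ^ 4 ≤ (4 / 3) ^ k := pow_le_pow_right₀ (by norm_num) (by omega)
      have h4 : (cfQ θ k : ℝ) ≤ 1 := by exact_mod_cast h1
      norm_num at h3
      linarith
    have hb := gaussProd_pos hθ hirr (k + 1)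
    have hqpos : (0:ℝ) < cfQ θ k := by exact_mod_cast (by omega : 0 < cfQ θ k)
    have h1 : 1 / gaussProd θ (k + 1) ≤ (cfQ θ k : ℝ) ^ 8 := by
      rw [div_le_iff₀ hb]
      by_contra hlt
      exact hg ⟨hq2, by linarith⟩
    have h2 : Real.log (1 / gaussProd θ (k + 1)) ≤ 8 * Real.log (cfQ θ k) := by
      have := Real.log_le_log (by positivity) h1
      rwa [Real.log_pow] at this
    have h3 : brjunoMain θ k ≤ 8 * cfErr θ k := by
      rw [brjunoMain, cfErr, mul_div_assoc']
      gcongr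
      linarith [Nat.cast_nonneg (α := ℝ) k]
    linarith [hy0 k]

end

end YoccozBrjuno

namespace YoccozBrjuno

open Topology Filter Polynomial Metric

/-- Nonvanishing holomorphic functions on a disc have holomorphic logarithms. -/
theorem exists_log_on_ball {f : ℂ → ℂ} {r : ℝ} (hf : DifferentiableOn ℂ f (ball 0 r))
    (h0 : ∀ z ∈ ball (0 : ℂ) r, f z ≠ 0) :
    ∃ L : ℂ → ℂ, DifferentiableOn ℂ L (ball 0 r) ∧ ∀ z ∈ ball (0 : ℂ) r, Complex.exp (L z) = f z := by
  rcases le_or_gt r 0 with hr | hr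
  · exact ⟨0, by simp [ball_eq_empty.2 hr], by simp [ball_eq_empty.2 hr]⟩
  have hd : DifferentiableOn ℂ (fun z => deriv f z / f z) (ball 0 r) :=
    (hf.deriv isOpen_ball).div hf h0
  obtain ⟨L, hL0, hL⟩ := hd.isExactOn_ball.with_val_at 0 (Complex.log (f 0))
  refine ⟨L, fun z hz => (hL z hz).differentiableAt.differentiableWithinAt, fun z hz => ?_⟩
  have h1 : ∀ w ∈ ball (0 : ℂ) r, HasDerivAt (fun w => Complex.exp (-L w) * f w) 0 w := by
    intro w hw
    have h2 := (hL w hw).fun_neg.cexp.fun_mul (hf.hasDerivAt (isOpen_ball.mem_nhds hw))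
    refine h2.congr_deriv ?_
    have := h0 w hw
    field_simp
    ring
  have hc := isOpen_ball.is_const_of_deriv_eq_zero (convex_ball (0 : ℂ) r).isPreconnected
    (fun w hw => (h1 w hw).differentiableAt.differentiableWithinAt)
    (fun w hw => (h1 w hw).deriv) hz (mem_ball_self hr)
  have h00 := h0 0 (mem_ball_self hr)
  simp only [hL0, Complex.exp_neg, Complex.exp_log h00, inv_mul_cancel₀ h00] at hc
  have := Complex.exp_ne_zero (L z)
  field_simp at hc
  exact hc.symm

/-- Nonvanishing holomorphic functions on a disc have holomorphic square roots. -/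
theorem exists_sqrt_on_ball {f : ℂ → ℂ} {r : ℝ} (hf : DifferentiableOn ℂ f (ball 0 r))
    (h0 : ∀ z ∈ ball (0 : ℂ) r, f z ≠ 0) {s : ℂ} (hs : s ^ 2 = f 0) :
    ∃ S : ℂ → ℂ, DifferentiableOn ℂ S (ball 0 r) ∧ S 0 = s ∧
      ∀ z ∈ ball (0 : ℂ) r, S z ^ 2 = f z := by
  rcases le_or_gt r 0 with hr | hr
  · exact ⟨fun _ => s, by simp [ball_eq_empty.2 hr], rfl, by simp [ball_eq_empty.2 hr]⟩
  obtain ⟨L, hLd, hL⟩ := exists_log_on_ball hf h0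
  have hsq : ∀ z ∈ ball (0 : ℂ) r, Complex.exp (L z / 2) ^ 2 = f z := by
    intro z hz
    rw [← Complex.exp_nat_mul, ← hL z hz]
    congr 1
    push_cast
    ring
  have hd : DifferentiableOn ℂ (fun z => Complex.exp (L z / 2)) (ball 0 r) :=
    (hLd.div_const 2).cexp
  have h1 : Complex.exp (L 0 / 2) ^ 2 = s ^ 2 := (hsq 0 (mem_ball_self hr)).trans hs.symm
  rcases sq_eq_sq_iff_eq_or_eq_neg.1 h1 with h | h
  · exact ⟨_, hd, h, hsq⟩
  · exact ⟨_, hd.fun_neg, by simp [h], fun z hz => by rw [neg_sq, hsq z hz]⟩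

/-- A Harnack-type inequality for nonvanishing bounded holomorphic functions. -/
theorem harnack_norm {f : ℂ → ℂ} {M : ℝ} (hM : 0 < M) (hf : DifferentiableOn ℂ f (ball 0 2))
    (h0 : ∀ z ∈ ball (0 : ℂ) 2, f z ≠ 0) (hb : ∀ z ∈ ball (0 : ℂ) 2, ‖f z‖ ≤ M) :
    ‖f 0‖ ^ 3 / M ^ 2 ≤ ‖f 1‖ := by
  obtain ⟨L, hLd, hL⟩ := exists_log_on_ball hf h0
  have hn : ∀ z ∈ ball (0 : ℂ) 2, ‖f z‖ = Real.exp (L z).re := by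
    intro z hz
    rw [← hL z hz, Complex.norm_exp]
  have hre : ∀ z ∈ ball (0 : ℂ) 2, (L z).re ≤ Real.log M := by
    intro z hz
    rw [Real.le_log_iff_exp_le hM, ← hn z hz]
    exact hb z hz
  have m0 : (0 : ℂ) ∈ ball (0 : ℂ) 2 := by simp
  have m1 : (1 : ℂ) ∈ ball (0 : ℂ) 2 := by simp
  have key : ∀ ε > 0, (L 0).re - 2 * (Real.log M - (L 0).re + ε) ≤ (L 1).re := by
    intro ε hε
    have h1 := Complex.borelCaratheodory_zero (f := fun z => L z - L 0) (R := 2) (z := 1)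
      (M := Real.log M - (L 0).re + ε) (by linarith [hre 0 m0]) (hLd.sub_const _)
      (fun z hz => by
        have := hre z hz
        simp only [Set.mem_ofPred_eq, sub_re]
        linarith) two_pos m1 (by simp)
    have h2 := Complex.abs_re_le_norm (L 1 - L 0)
    have h3 := neg_abs_le (L 1 - L 0).re
    rw [sub_re] at *
    norm_num at h1
    linarith
  have key' : 3 * (L 0).re - 2 * Real.log M ≤ (L 1).re := by
    refine le_of_forall_pos_le_add fun ε hε => ?_
    linarith [key (ε / 2) (by linarith)]
  rw [hn 0 m0, hn 1 m1, div_le_iff₀ (by positivity)]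
  rw [← Real.exp_log hM]
  rw [← Real.exp_nat_mul, ← Real.exp_nat_mul, ← Real.exp_add]
  refine Real.exp_le_exp.2 ?_
  push_cast
  linarith

/-- Near-identity maps are invertible on definite discs. -/
theorem exists_inverse {K : ℂ → ℂ} (hK : SmallPert 10 (1 / 4) K) :
    ∃ G : ℂ → ℂ, DifferentiableOn ℂ G (ball 0 3) ∧
      (∀ w ∈ ball (0 : ℂ) 3, ‖G w‖ ≤ 4 / 3 * ‖w‖ ∧ G w + K (G w) = w) ∧
      ∀ z ∈ ball (0 : ℂ) 10, z + K z ∈ ball (0 : ℂ) 3 → G (z + K z) = z := by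
  have hlip : ∀ x ∈ ball (0 : ℂ) 10, ∀ y ∈ ball (0 : ℂ) 10, ‖K x - K y‖ ≤ 1 / 4 * ‖x - y‖ :=
    fun x hx y hy => hK.lip hy hx
  have hexp : ∀ x ∈ ball (0 : ℂ) 10, ∀ y ∈ ball (0 : ℂ) 10,
      3 / 4 * ‖x - y‖ ≤ ‖(x + K x) - (y + K y)‖ := by
    intro x hx y hy
    have h1 := hlip x hx y hy
    have h2 := norm_sub_le ((x + K x) - (y + K y)) (K x - K y)
    rw [show (x + K x) - (y + K y) - (K x - K y) = x - y by ring] at h2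
    linarith
  have happ : ApproximatesLinearOn (fun z => z + K z) (ContinuousLinearMap.id ℂ ℂ)
      (ball 0 10) (1 / 4) := by
    intro x hx y hy
    have := hlip x hx y hy
    simp only [ContinuousLinearMap.id_apply]
    rw [show x + K x - (y + K y) - (x - y) = K x - K y by ring]
    exact_mod_cast this
  have hsurj : ∀ w ∈ ball (0 : ℂ) 3, ∃ z ∈ ball (0 : ℂ) 10, z + K z = w := by
    intro w hw
    have h1 := happ.surjOn_closedBall_of_nonlinearRightInverse
      (ContinuousLinearEquiv.refl ℂ ℂ).toNonlinearRightInverse (ε := 4) (b := 0) (by norm_num)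
      (closedBall_subset_ball (by norm_num))
    have h2 : ((ContinuousLinearEquiv.refl ℂ ℂ).toNonlinearRightInverse.nnnorm : ℝ) = 1 := by
      have : (ContinuousLinearEquiv.refl ℂ ℂ).toNonlinearRightInverse.nnnorm =
        ‖((ContinuousLinearEquiv.refl ℂ ℂ).symm : ℂ →L[ℂ] ℂ)‖₊ := rfl
      rw [this]
      simp
    have h3 : w ∈ closedBall (0 + K 0) ((((ContinuousLinearEquiv.refl ℂ
        ℂ).toNonlinearRightInverse.nnnorm : ℝ)⁻¹ - (1 / 4 : NNReal)) * 4) := by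
      rw [h2, hK.zero]
      simp only [mem_ball, mem_closedBall, add_zero] at *
      push_cast
      linarith
    obtain ⟨z, hz, hz2⟩ := h1 h3
    exact ⟨z, closedBall_subset_ball (by norm_num) hz, hz2⟩
  choose! G hG10 hG using hsurj
  have hinj : ∀ z ∈ ball (0 : ℂ) 10, z + K z ∈ ball (0 : ℂ) 3 → G (z + K z) = z := by
    intro z hz hw
    have h1 := hexp _ (hG10 _ hw) z hz
    rw [hG _ hw, sub_self, norm_zero] at h1
    have : ‖G (z + K z) - z‖ ≤ 0 := by linarith
    exact sub_eq_zero.1 (norm_le_zero_iff.1 this)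
  have h010 : (0 : ℂ) ∈ ball (0 : ℂ) 10 := by simp
  refine ⟨G, fun w hw => ?_, fun w hw => ⟨?_, hG w hw⟩, hinj⟩
  · have hGw := hG10 w hw
    have hcont : ContinuousAt G w := by
      rw [Metric.continuousAt_iff]
      intro ε hε
      obtain ⟨δ, hδ, hδ3⟩ := Metric.isOpen_iff.1 isOpen_ball w hw
      refine ⟨min δ (3 / 4 * ε), by positivity, fun {x} hx => ?_⟩
      have hx3 := hδ3 (mem_ball.2 (hx.trans_le (min_le_left _ _)))
      have h1 := hexp _ (hG10 x hx3) _ hGw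
      rw [hG x hx3, hG w hw] at h1
      have h2 := hx.trans_le (min_le_right _ _)
      rw [dist_eq_norm] at *
      linarith
    have hd : HasDerivAt (fun z => z + K z) (1 + deriv K (G w)) (G w) :=
      (hasDerivAt_id _).add (hK.analyticAt hGw).differentiableAt.hasDerivAt
    have hne : 1 + deriv K (G w) ≠ 0 := by
      intro h
      have h1 := hK.bound _ hGw
      rw [← neg_eq_iff_add_eq_zero.2 h, norm_neg, norm_one] at h1
      norm_num at h1
    exact (HasDerivAt.of_local_left_inverse hcont hd hne
      (by filter_upwards [isOpen_ball.mem_nhds hw] with x hx using hG x hx)).differentiableAt.differentiableWithinAt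
  · have h1 := hexp _ (hG10 w hw) 0 h010
    rw [hG w hw, hK.zero] at h1
    simp only [sub_zero, add_zero] at h1
    linarith

end YoccozBrjuno

namespace YoccozBrjuno

open Topology Filter Polynomial Metric

/-- Koenigs' linearization theorem for attracting fixed points. -/
theorem exists_koenigs {g : ℂ → ℂ} {m : ℂ} (hg : AnalyticAt ℂ g 0) (hg0 : g 0 = 0)
    (hm : deriv g 0 = m) (hm0 : m ≠ 0) (hm1 : ‖m‖ < 1) :
    ∃ κ : ℂ → ℂ, AnalyticAt ℂ κ 0 ∧ κ 0 = 0 ∧ deriv κ 0 = 1 ∧ ∀ᶠ z in 𝓝 0, κ (g z) = m * κ z := by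
  have hmpos : 0 < ‖m‖ := norm_pos_iff.2 hm0
  have hmvan : (fun z => g z - m * z) ∈ vanishing 2 := by
    refine vanishing_two (by fun_prop) (by simp [hg0]) ?_
    have := (hg.differentiableAt.hasDerivAt.sub ((hasDerivAt_id (0 : ℂ)).const_mul m)).deriv
    rw [hm, mul_one, sub_self] at this
    exact this
  obtain ⟨w, hw, hweq⟩ := mem_vanishing.1 hmvan
  set C : ℝ := ‖w 0‖ + 1 with hC
  have hCpos : 0 < C := by positivity
  obtain ⟨b, hb1, hb2, hbm⟩ : ∃ b : ℝ, ‖m‖ < b ∧ b < 1 ∧ b ^ 2 < ‖m‖ := by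
    have h1 : ‖m‖ < √‖m‖ := by
      rw [Real.lt_sqrt hmpos.le]; nlinarith
    obtain ⟨b, hb, hb'⟩ := exists_between h1
    have hb0 : 0 < b := hmpos.trans hb
    have hsq := Real.sq_sqrt hmpos.le
    refine ⟨b, hb, ?_, ?_⟩
    · have : √‖m‖ < 1 := by rw [Real.sqrt_lt' one_pos]; simpa using hm1
      linarith
    · rw [← hsq]; gcongr
  have hb0 : 0 < b := hmpos.trans hb1
  obtain ⟨r0, hr0, hball⟩ : ∃ r > 0, ∀ z ∈ ball (0 : ℂ) r, DifferentiableAt ℂ g z ∧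
      g z - m * z = z ^ 2 * w z ∧ ‖w z‖ ≤ C := by
    have h1 : ∀ᶠ z in 𝓝 (0 : ℂ), ‖w z‖ < C :=
      hw.continuousAt.norm.eventually_lt continuousAt_const (by simp [hC])
    have h2 := (hg.eventually_analyticAt.and hweq).and h1
    obtain ⟨r, hr, h⟩ := Metric.eventually_nhds_iff_ball.1 h2
    exact ⟨r, hr, fun z hz => ⟨(h z hz).1.1.differentiableAt, (h z hz).1.2, (h z hz).2.le⟩⟩
  set r : ℝ := min r0 ((b - ‖m‖) / C) with hr
  have hrpos : 0 < r := lt_min hr0 (div_pos (by linarith) hCpos)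
  have hsub : ∀ z ∈ ball (0 : ℂ) r, z ∈ ball (0 : ℂ) r0 := fun z hz =>
    ball_subset_ball (min_le_left _ _) hz
  have hquad : ∀ z ∈ ball (0 : ℂ) r, ‖g z - m * z‖ ≤ C * ‖z‖ ^ 2 := by
    intro z hz
    obtain ⟨-, h2, h3⟩ := hball z (hsub z hz)
    rw [h2, norm_mul, norm_pow, mul_comm]
    gcongr
  have hcontr : ∀ z ∈ ball (0 : ℂ) r, ‖g z‖ ≤ b * ‖z‖ := by
    intro z hz
    have h1 := hquad z hz
    have h2 : C * ‖z‖ ≤ b - ‖m‖ := by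
      have : ‖z‖ < (b - ‖m‖) / C := (mem_ball_zero_iff.1 hz).trans_le (min_le_right _ _)
      rw [lt_div_iff₀ hCpos] at this
      linarith
    have h3 := norm_add_le (g z - m * z) (m * z)
    rw [sub_add_cancel, norm_mul] at h3
    nlinarith [norm_nonneg z]
  have hiter : ∀ n : ℕ, ∀ z ∈ ball (0 : ℂ) r, ‖g^[n] z‖ ≤ b ^ n * ‖z‖ ∧ g^[n] z ∈ ball (0 : ℂ) r := by
    intro n
    induction n with
    | zero => intro z hz; simpa using hz
    | succ n ih =>
      intro z hz
      obtain ⟨h1, h2⟩ := ih z hz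
      rw [Function.iterate_succ_apply']
      have h3 := hcontr _ h2
      have h4 : ‖g (g^[n] z)‖ ≤ b ^ (n + 1) * ‖z‖ := by
        rw [pow_succ']
        nlinarith
      refine ⟨h4, mem_ball_zero_iff.2 (lt_of_le_of_lt ?_ (mem_ball_zero_iff.1 hz))⟩
      have : b ^ (n + 1) ≤ 1 := pow_le_one₀ hb0.le hb2.le
      nlinarith [norm_nonneg z]
  have hidiff : ∀ n : ℕ, DifferentiableOn ℂ (g^[n]) (ball 0 r) := by
    intro n
    induction n with
    | zero => exact differentiableOn_id
    | succ n ih =>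
      rw [Function.iterate_succ']
      intro z hz
      exact ((hball _ (hsub _ (hiter n z hz).2)).1.comp_differentiableWithinAt z (ih z hz))
  let T : ℕ → ℂ → ℂ := fun n z => (g (g^[n] z) - m * g^[n] z) / m ^ (n + 1)
  let u : ℕ → ℝ := fun n => C / ‖m‖ * (b ^ 2 / ‖m‖) ^ n
  have hu : Summable u := (summable_geometric_of_lt_one (by positivity)
    ((div_lt_one hmpos).2 hbm)).mul_left _
  have hT : ∀ n, ∀ z ∈ ball (0 : ℂ) r, ‖T n z‖ ≤ u n * ‖z‖ ^ 2 := by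
    intro n z hz
    obtain ⟨h1, h2⟩ := hiter n z hz
    have h3 := hquad _ h2
    simp only [T, u, norm_div, norm_pow]
    rw [div_le_iff₀ (by positivity)]
    calc _ ≤ C * ‖g^[n] z‖ ^ 2 := h3
      _ ≤ C * (b ^ n * ‖z‖) ^ 2 := by gcongr
      _ = _ := by
        rw [div_pow, pow_succ ‖m‖ n]
        field_simp
        ring
  have hrsum : ∀ z ∈ ball (0 : ℂ) r, Summable fun n => T n z := fun z hz =>
    Summable.of_norm_bounded (hu.mul_right _) fun n => hT n z hz
  let κ : ℂ → ℂ := fun z => z + ∑' n, T n z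
  have hTdiff : ∀ n, DifferentiableOn ℂ (T n) (ball 0 r) := by
    intro n
    have h1 := hidiff (n + 1)
    rw [Function.iterate_succ'] at h1
    exact (h1.sub ((hidiff n).const_mul m)).div_const _
  have hκd : DifferentiableOn ℂ κ (ball 0 r) := by
    refine differentiableOn_id.add (differentiableOn_tsum_of_summable_norm (hu.mul_right (r ^ 2))
      hTdiff isOpen_ball fun n z hz => (hT n z hz).trans ?_)
    have : ‖z‖ ≤ r := (mem_ball_zero_iff.1 hz).le
    have : 0 ≤ u n := by positivity
    gcongr
  have hlim : ∀ z ∈ ball (0 : ℂ) r, Tendsto (fun n => g^[n] z / m ^ n) atTop (𝓝 (κ z)) := by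
    intro z hz
    have h1 := ((hrsum z hz).hasSum.tendsto_sum_nat).const_add z
    refine h1.congr fun n => ?_
    have h2 : ∀ k, T k z = g^[k + 1] z / m ^ (k + 1) - g^[k] z / m ^ k := by
      intro k
      simp only [T, Function.iterate_succ_apply']
      field_simp
      ring
    simp only [h2]
    rw [Finset.sum_range_sub (fun k => g^[k] z / m ^ k)]
    simp
  have hκ0 : κ 0 = 0 := by
    have h1 : ∀ n, T n 0 = 0 := fun n => by
      have := hT n 0 (mem_ball_self hrpos)
      simpa using this
    simp [κ, h1]
  have hsq : ∀ z ∈ ball (0 : ℂ) r, ‖κ z - z‖ ≤ (∑' n, u n) * ‖z‖ ^ 2 := by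
    intro z hz
    simp only [κ, add_sub_cancel_left]
    refine (tsum_of_norm_bounded (hu.mul_right (‖z‖ ^ 2)).hasSum fun n => hT n z hz).trans ?_
    rw [tsum_mul_right]
  refine ⟨κ, hκd.analyticAt (ball_mem_nhds _ hrpos), hκ0, ?_, ?_⟩
  · refine HasDerivAt.deriv ?_
    rw [hasDerivAt_iff_isLittleO]
    have h1 : (fun z => κ z - z) =O[𝓝 0] fun z : ℂ => z ^ 2 := by
      refine Asymptotics.IsBigO.of_bound (∑' n, u n) ?_
      filter_upwards [ball_mem_nhds (0 : ℂ) hrpos] with z hz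
      simpa using hsq z hz
    have h2 : (fun z : ℂ => z ^ 2) =o[𝓝 0] fun z : ℂ => z := by
      simpa using Asymptotics.isLittleO_pow_pow (𝕜 := ℂ) (m := 1) (n := 2) one_lt_two
    simpa [hκ0] using h1.trans_isLittleO h2
  · filter_upwards [ball_mem_nhds (0 : ℂ) hrpos] with z hz
    have hgz : g z ∈ ball (0 : ℂ) r := (hiter 1 z hz).2
    have h1 := hlim (g z) hgz
    have h2 := (((tendsto_add_atTop_iff_nat 1).2 (hlim z hz))).const_mul m
    refine tendsto_nhds_unique h1 (h2.congr fun n => ?_)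
    rw [Function.iterate_succ_apply]
    field_simp
    ring

/-- Local inverses of germs tangent to the identity. -/
theorem exists_local_inverse {κ : ℂ → ℂ} (hκ : AnalyticAt ℂ κ 0) (hκ0 : κ 0 = 0)
    (hκ1 : deriv κ 0 = 1) : ∃ φ : ℂ → ℂ, AnalyticAt ℂ φ 0 ∧ φ 0 = 0 ∧ deriv φ 0 = 1 ∧
      (∀ᶠ x in 𝓝 0, φ (κ x) = x) ∧ ∀ᶠ x in 𝓝 0, κ (φ x) = x := by
  have hs : HasStrictDerivAt κ 1 0 := hκ1 ▸ hκ.hasStrictDerivAt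
  have hsf : HasStrictFDerivAt κ (ContinuousLinearEquiv.refl ℂ ℂ : ℂ →L[ℂ] ℂ) 0 := by
    have h := hs.hasStrictFDerivAt
    rwa [show ContinuousLinearMap.toSpanSingleton ℂ (1 : ℂ) =
      ((ContinuousLinearEquiv.refl ℂ ℂ : ℂ ≃L[ℂ] ℂ) : ℂ →L[ℂ] ℂ) by ext; simp] at h
  have hcd : ContDiffAt ℂ 1 κ 0 := hκ.contDiffAt
  have hφc := hcd.to_localInverse hsf.hasFDerivAt one_ne_zero
  have h0 := hcd.localInverse_apply_image hsf.hasFDerivAt one_ne_zero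
  have hl : ∀ᶠ x in 𝓝 (0 : ℂ), hcd.localInverse hsf.hasFDerivAt one_ne_zero (κ x) = x :=
    (hcd.hasStrictFDerivAt' hsf.hasFDerivAt one_ne_zero).eventually_left_inverse
  have hr : ∀ᶠ x in 𝓝 (κ 0), κ (hcd.localInverse hsf.hasFDerivAt one_ne_zero x) = x :=
    (hcd.hasStrictFDerivAt' hsf.hasFDerivAt one_ne_zero).eventually_right_inverse
  rw [hκ0] at hφc h0 hr
  set φ := hcd.localInverse hsf.hasFDerivAt one_ne_zero
  have hφa : AnalyticAt ℂ φ 0 := by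
    have h1 := hφc.eventually (by simp)
    rw [analyticAt_iff_eventually_differentiableAt]
    filter_upwards [h1] with x hx using hx.differentiableAt one_ne_zero
  refine ⟨φ, hφa, h0, ?_, hl, hr⟩
  have h2 : HasDerivAt (κ ∘ φ) (1 * deriv φ 0) 0 := by
    refine HasDerivAt.comp 0 ?_ hφa.differentiableAt.hasDerivAt
    rw [h0]
    exact hs.hasDerivAt
  have h3 : HasDerivAt (κ ∘ φ) 1 0 := (hasDerivAt_id 0).congr_of_eventuallyEq hr
  simpa using h2.unique h3

/-- Koenigs' linearization: existence of a local parametrization. -/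
theorem exists_linearization {g : ℂ → ℂ} {m : ℂ} (hg : AnalyticAt ℂ g 0) (hg0 : g 0 = 0)
    (hm : deriv g 0 = m) (hm0 : m ≠ 0) (hm1 : ‖m‖ < 1) :
    ∃ φ : ℂ → ℂ, AnalyticAt ℂ φ 0 ∧ φ 0 = 0 ∧ deriv φ 0 = 1 ∧ ∀ᶠ z in 𝓝 0, φ (m * z) = g (φ z) := by
  obtain ⟨κ, hκ, hκ0, hκ1, hκg⟩ := exists_koenigs hg hg0 hm hm0 hm1
  obtain ⟨φ, hφ, hφ0, hφ1, hl, hr⟩ := exists_local_inverse hκ hκ0 hκ1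
  refine ⟨φ, hφ, hφ0, hφ1, ?_⟩
  have ht : Tendsto φ (𝓝 0) (𝓝 0) := by simpa [hφ0] using hφ.continuousAt.tendsto
  have htg : Tendsto g (𝓝 0) (𝓝 0) := by simpa [hg0] using hg.continuousAt.tendsto
  filter_upwards [ht.eventually hκg, hr, (htg.comp ht).eventually hl] with z h1 h2 h3
  rw [h2] at h1
  rw [← h1]
  exact h3

end YoccozBrjuno

namespace YoccozBrjuno

open Topology Filter Polynomial Metric

/-- The quadratic map with multiplier `a * l`, precomposed with a near-identity map. -/
def qmap (a : ℝ) (l : ℂ) (K : ℂ → ℂ) (z : ℂ) : ℂ := a * (l * (z + K z) + (z + K z) ^ 2)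

/-- A normalized parametrization linearizing `qmap a l K` on the disc of radius `ρ`. -/
structure Lin (a : ℝ) (l : ℂ) (K : ℂ → ℂ) (ρ : ℝ) (φ : ℂ → ℂ) : Prop where
  diff : DifferentiableOn ℂ φ (ball 0 ρ)
  zero : φ 0 = 0
  deriv_one : deriv φ 0 = 1
  bound : ∀ s ∈ ball (0 : ℂ) ρ, ‖φ s‖ ≤ 4
  eq : ∀ s ∈ ball (0 : ℂ) ρ, φ (a * l * s) = qmap a l K (φ s)

section

variable {a : ℝ} {l : ℂ} {K : ℂ → ℂ}

theorem qmap_analyticAt (hK : SmallPert 10 (1 / 4) K) {z : ℂ} (hz : z ∈ ball (0 : ℂ) 10) :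
    AnalyticAt ℂ (qmap a l K) z := by
  have := hK.analyticAt hz
  unfold qmap
  fun_prop

theorem qmap_zero (hK : SmallPert 10 (1 / 4) K) : qmap a l K 0 = 0 := by
  simp [qmap, hK.zero]

theorem qmap_deriv (hK : SmallPert 10 (1 / 4) K) : deriv (qmap a l K) 0 = a * l := by
  have h1 : HasDerivAt (fun z => z + K z) (1 + deriv K 0) 0 :=
    (hasDerivAt_id _).add (hK.analyticAt (by simp)).differentiableAt.hasDerivAt
  have h2 := (((h1.const_mul l).fun_add (h1.fun_pow 2)).const_mul (a : ℂ))
  exact (h2.congr_deriv (by simp [hK.deriv_zero, hK.zero])).deriv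

theorem norm_mul_mul_lt (ha0 : 0 ≤ a) (ha1 : a ≤ 1) (hl : ‖l‖ = 1) (s : ℂ) :
    ‖(a : ℂ) * l * s‖ ≤ ‖s‖ := by
  rw [norm_mul, norm_mul, hl, mul_one, Complex.norm_real, Real.norm_of_nonneg ha0]
  nlinarith [norm_nonneg s]

theorem exists_lin (ha : 9 / 10 ≤ a) (ha1 : a < 1) (hl : ‖l‖ = 1)
    (hK : SmallPert 10 (1 / 4) K) : ∃ ρ > 0, ∃ φ, Lin a l K ρ φ := by
  have hnorm : ‖(a : ℂ) * l‖ = a := by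
    rw [norm_mul, hl, mul_one, Complex.norm_real, Real.norm_of_nonneg (by linarith)]
  obtain ⟨φ, hφ, hφ0, hφ1, hφe⟩ := exists_linearization (qmap_analyticAt hK (by simp))
    (qmap_zero hK) (qmap_deriv hK) (by rw [← norm_pos_iff, hnorm]; linarith)
    (by rw [hnorm]; exact ha1)
  have h1 : ∀ᶠ z in 𝓝 (0 : ℂ), ‖φ z‖ < 4 :=
    hφ.continuousAt.norm.eventually_lt continuousAt_const (by simp [hφ0])
  obtain ⟨r, hr, h⟩ := Metric.eventually_nhds_iff_ball.1 ((hφe.and h1).and hφ.eventually_analyticAt)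
  exact ⟨r, hr, φ, fun z hz => (h z hz).2.differentiableAt.differentiableWithinAt, hφ0, hφ1,
    fun z hz => (h z hz).1.2.le, fun z hz => (h z hz).1.1⟩

theorem Lin.extend {ρ : ℝ} {φ : ℂ → ℂ} (hρ : 0 < ρ) (ha : 9 / 10 ≤ a) (ha1 : a < 1) (hl : ‖l‖ = 1)
    (hK : SmallPert 10 (1 / 4) K) (h : Lin a l K ρ φ)
    (hv : ∀ s ∈ ball (0 : ℂ) ρ, φ s ≠ -a * l ^ 2 / 4) : ∃ ψ, Lin a l K (ρ / a) ψ := by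
  have ha0 : 0 < a := by linarith
  have hac : (a : ℂ) ≠ 0 := by exact_mod_cast ha0.ne'
  obtain ⟨G, hGd, hG, hGl⟩ := exists_inverse hK
  have hle : ρ ≤ ρ / a := by rw [le_div_iff₀ ha0]; nlinarith
  have hmaps : ∀ s ∈ ball (0 : ℂ) (ρ / a), (a : ℂ) * l * s ∈ ball (0 : ℂ) ρ := by
    intro s hs
    rw [mem_ball_zero_iff, lt_div_iff₀ ha0] at hs
    rw [mem_ball_zero_iff, norm_mul, norm_mul, hl, mul_one, Complex.norm_real,
      Real.norm_of_nonneg ha0.le]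
    linarith
  let D : ℂ → ℂ := fun s => l ^ 2 / 4 + φ (a * l * s) / a
  have hDd : DifferentiableOn ℂ D (ball 0 (ρ / a)) := by
    have : DifferentiableOn ℂ (fun s => φ (a * l * s)) (ball 0 (ρ / a)) :=
      h.diff.comp (by fun_prop) hmaps
    exact (this.div_const _).const_add _
  have hD0 : ∀ s ∈ ball (0 : ℂ) (ρ / a), D s ≠ 0 := by
    intro s hs h0
    apply hv _ (hmaps s hs)
    simp only [D] at h0
    field_simp at h0 ⊢
    linear_combination h0
  obtain ⟨S, hSd, hS0, hS⟩ := exists_sqrt_on_ball (s := l / 2) hDd hD0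
    (by simp [D, h.zero]; ring)
  have hSn : ∀ s ∈ ball (0 : ℂ) (ρ / a), ‖S s - l / 2‖ ≤ 27 / 10 := by
    intro s hs
    have h1 : ‖S s‖ ^ 2 ≤ 4.7 := by
      rw [← norm_pow, hS s hs]
      have h2 := norm_add_le (l ^ 2 / 4) (φ (a * l * s) / a)
      have h3 : ‖φ (a * l * s) / a‖ ≤ 4.45 := by
        rw [norm_div, Complex.norm_real, Real.norm_of_nonneg ha0.le, div_le_iff₀ ha0]
        linarith [h.bound _ (hmaps s hs)]
      have h4 : ‖l ^ 2 / 4‖ = 1 / 4 := by simp [hl]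
      rw [h4] at h2
      refine h2.trans ?_
      linarith
    have h5 : ‖S s‖ ≤ 2.2 := by nlinarith [norm_nonneg (S s)]
    have h6 := norm_sub_le (S s) (l / 2)
    have h7 : ‖l / 2‖ = 1 / 2 := by simp [hl]
    linarith
  have hS3 : ∀ s ∈ ball (0 : ℂ) (ρ / a), S s - l / 2 ∈ ball (0 : ℂ) 3 := by
    intro s hs
    rw [mem_ball_zero_iff]
    linarith [hSn s hs]
  let ψ : ℂ → ℂ := fun s => G (S s - l / 2)
  have hψφ : ∀ s ∈ ball (0 : ℂ) ρ, ψ s = φ s := by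
    have hsub := ball_subset_ball (x := (0 : ℂ)) hle
    have hφ10 : ∀ s ∈ ball (0 : ℂ) ρ, φ s ∈ ball (0 : ℂ) 10 := by
      intro s hs
      rw [mem_ball_zero_iff]
      linarith [h.bound s hs]
    have heq : Set.EqOn (fun s => φ s + K (φ s) + l / 2) S (ball 0 ρ) := by
      refine (convex_ball (0 : ℂ) ρ).isPreconnected.eq_of_sq_eq (y := 0) ?_
        (hSd.continuousOn.mono hsub) ?_ ?_ (mem_ball_self hρ) ?_
      · exact (h.diff.continuousOn.add (hK.diff.continuousOn.comp h.diff.continuousOn hφ10)).add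
          continuousOn_const
      · intro s hs
        have h1 := h.eq s hs
        have h2 := hS s (hsub hs)
        simp only [Pi.pow_apply, h2, D, h1, qmap]
        field_simp
        ring
      · intro s hs h0
        have := hS s (hsub hs)
        rw [h0] at this
        exact hD0 s (hsub hs) (by rw [← this]; simp)
      · simp [h.zero, hK.zero, hS0]
    intro s hs
    have h1 := heq hs
    simp only at h1
    have h2 : S s - l / 2 = φ s + K (φ s) := by rw [← h1]; ring
    simp only [ψ]
    have h3 := hS3 s (hsub hs)
    rw [h2] at h3 ⊢
    exact hGl _ (hφ10 s hs) h3
  refine ⟨ψ, hGd.comp (hSd.sub_const _) hS3, ?_, ?_, ?_, ?_⟩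
  · rw [hψφ 0 (mem_ball_self hρ), h.zero]
  · rw [← h.deriv_one]
    exact Filter.EventuallyEq.deriv_eq (by
      filter_upwards [ball_mem_nhds (0 : ℂ) hρ] with s hs using hψφ s hs)
  · intro s hs
    have h1 := (hG _ (hS3 s hs)).1
    have h2 := hSn s hs
    simp only [ψ]
    linarith
  · intro s hs
    rw [hψφ _ (hmaps s hs)]
    have h1 := (hG _ (hS3 s hs)).2
    have h2 := hS s hs
    simp only [qmap, ψ, h1]
    have h3 : l * (S s - l / 2) + (S s - l / 2) ^ 2 = S s ^ 2 - l ^ 2 / 4 := by ring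
    rw [h3, h2]
    simp only [D]
    field_simp
    ring

/-- The linearizing parametrization extends until it reaches the critical value. -/
theorem exists_lin_crit (ha : 9 / 10 ≤ a) (ha1 : a < 1) (hl : ‖l‖ = 1)
    (hK : SmallPert 10 (1 / 4) K) :
    ∃ ρ φ, Lin a l K ρ φ ∧ ∃ σ ∈ ball (0 : ℂ) ρ, φ σ = -a * l ^ 2 / 4 := by
  by_contra! hcon
  obtain ⟨ρ, hρ, φ, hφ⟩ := exists_lin ha ha1 hl hK
  have ha0 : 0 < a := by linarith
  have key : ∀ k : ℕ, ∃ ψ, Lin a l K (ρ / a ^ k) ψ := by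
    intro k
    induction k with
    | zero => exact ⟨φ, by simpa using hφ⟩
    | succ k ih =>
      obtain ⟨ψ, hψ⟩ := ih
      have := hψ.extend (by positivity) ha ha1 hl hK (fun s hs => hcon _ _ hψ s hs)
      rwa [div_div, ← pow_succ] at this
  obtain ⟨k, hk⟩ := exists_pow_lt_of_lt_one (show 0 < ρ / 8 by positivity) ha1
  obtain ⟨ψ, hψ⟩ := key k
  have h1 := norm_deriv_le_of_ball (show 0 < ρ / a ^ k by positivity) hψ.diff hψ.bound
  have h2 : 8 < ρ / a ^ k := by
    rw [lt_div_iff₀ (by positivity)]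
    linarith
  rw [hψ.deriv_one, norm_one, le_div_iff₀ (by positivity)] at h1
  linarith

end

end YoccozBrjuno

namespace YoccozBrjuno

open Topology Filter Polynomial Metric

theorem coef_pow_of_lt {n j : ℕ} (h : j < n) : coef n (fun z => z ^ j) = 0 := by
  have h1 := iteratedDeriv_eq_iterate (𝕜 := ℂ) (n := n) (f := fun z : ℂ => z ^ j)
  rw [coef, h1, iter_deriv_pow, Finset.prod_eq_zero (Finset.mem_range.2 h) (sub_self _)]
  simp

/-- For a linear germ the coefficient functionals are the Taylor coefficients. -/
theorem gam_linear {m : ℂ} {n : ℕ} (hm0 : m ≠ 0) (hm1 : ‖m‖ < 1) (hn : 1 ≤ n) {v : ℂ → ℂ}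
    (hv : v ∈ vanishing 1) (hnl : nrm m n ≠ 0) : gam m n (fun z => m * z) v = coef n v := by
  have hf : (fun z : ℂ => m * z) ∈ vanishing 1 := by
    rw [vanishing_one]
    exact ⟨by fun_prop, by simp⟩
  have hd : deriv (fun z : ℂ => m * z) 0 = m := by simp
  have hpow : ∀ j : ℕ, 1 ≤ j → j < n → gam m n (fun z => m * z) (fun z => z ^ j) = 0 := by
    intro j hj hjn
    have hvj : (fun z : ℂ => z ^ j) ∈ vanishing 1 := vanishing_mono hj (vanishing_pow_self j)
    have h1 := gam_comp (l := m) hf hd hn hvj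
    have h2 : (fun z : ℂ => z ^ j) ∘ (fun z => m * z) = m ^ j • fun z : ℂ => z ^ j := by
      ext z; simp [mul_pow]
    rw [h2, gam_smul hf _ hvj] at h1
    have h3 : m ^ j ≠ m ^ n := by
      intro h
      have h4 := congrArg norm h
      rw [norm_pow, norm_pow] at h4
      have := pow_lt_pow_right_of_lt_one₀ (norm_pos_iff.2 hm0) hm1 hjn
      linarith
    have h4 : (m ^ j - m ^ n) * gam m n (fun z => m * z) (fun z => z ^ j) = 0 := by
      linear_combination h1
    exact (mul_eq_zero.1 h4).resolve_left (sub_ne_zero.2 h3)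
  have key : ∀ k : ℕ, k ≤ n - 1 → ∀ u ∈ vanishing (n - k),
      gam m n (fun z => m * z) u = coef n u := by
    intro k
    induction k with
    | zero => intro _ u hu; exact gam_vanishing hf hd hnl (by simpa using hu)
    | succ k ih =>
      intro hk u hu
      have h1 : n - (k + 1) + 1 = n - k := by omega
      have h2 := sub_coef_mem hu
      set j := n - (k + 1) with hj
      rw [h1] at h2
      have hj1 : 1 ≤ j := by omega
      have hvj : (fun z : ℂ => z ^ j) ∈ vanishing 1 := vanishing_mono hj1 (vanishing_pow_self j)
      have hrest : u - (coef j u) • (fun z : ℂ => z ^ j) ∈ vanishing (n - k) := h2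
      have hr1 := vanishing_mono (show 1 ≤ n - k by omega) hrest
      have h3 : u = (u - (coef j u) • (fun z : ℂ => z ^ j)) + (coef j u) • (fun z : ℂ => z ^ j) := by
        simp
      rw [h3, gam_add hf hr1 ((vanishing 1).smul_mem _ hvj), gam_smul hf _ hvj,
        hpow j hj1 (by omega), ih (by omega) _ hrest,
        coef_add (vanishing_analyticAt hr1) (vanishing_analyticAt ((vanishing 1).smul_mem _ hvj)),
        coef_smul _ (vanishing_analyticAt hvj), coef_pow_of_lt (by omega)]
  exact key (n - 1) le_rfl v (by rwa [show n - (n - 1) = 1 by omega])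

section

variable {a : ℝ} {l : ℂ} {K φ : ℂ → ℂ} {ρ : ℝ} {σ : ℂ}

theorem norm_ofReal_mul (ha : 0 ≤ a) (hl : ‖l‖ = 1) : ‖(a : ℂ) * l‖ = a := by
  rw [norm_mul, hl, mul_one, Complex.norm_real, Real.norm_of_nonneg ha]

theorem Lin.analyticAt (h : Lin a l K ρ φ) {s : ℂ} (hs : s ∈ ball (0 : ℂ) ρ) :
    AnalyticAt ℂ φ s := h.diff.analyticAt (isOpen_ball.mem_nhds hs)

theorem Lin.gam_bound (ha : 9 / 10 ≤ a) (ha1 : a < 1) (hl : ‖l‖ = 1)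
    (hK : SmallPert 10 (1 / 4) K) (h : Lin a l K ρ φ) (hσ : σ ∈ ball (0 : ℂ) ρ) (hσ0 : σ ≠ 0)
    {n : ℕ} (hn : 1 ≤ n) (hnl : nrm (a * l) n ≠ 0) :
    ‖gam (a * l) n (qmap a l K) id‖ ≤ 4 * (1 / ‖σ‖) ^ n := by
  have hnorm : ‖(a : ℂ) * l‖ = a := norm_ofReal_mul (by linarith) hl
  have hm0 : (a : ℂ) * l ≠ 0 := by rw [← norm_pos_iff, hnorm]; linarith
  have hρ : 0 < ρ := (norm_nonneg σ).trans_lt (mem_ball_zero_iff.1 hσ)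
  have hf : (fun z : ℂ => a * l * z) ∈ vanishing 1 := by
    rw [vanishing_one]
    exact ⟨by fun_prop, by simp⟩
  have hg : qmap a l K ∈ vanishing 1 := by
    rw [vanishing_one]
    exact ⟨qmap_analyticAt hK (by simp), qmap_zero hK⟩
  have hφ : φ ∈ vanishing 1 := by
    rw [vanishing_one]
    exact ⟨h.analyticAt (mem_ball_self hρ), h.zero⟩
  have h1 := gam_semiconj hf hg hφ (qmap_deriv hK) hn (by
    filter_upwards [ball_mem_nhds (0 : ℂ) hρ] with s hs using h.eq s hs) id_mem_vanishing
  rw [Function.id_comp, h.deriv_one, one_pow, one_mul,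
    gam_linear hm0 (by rw [hnorm]; exact ha1) hn hφ hnl] at h1
  rw [← h1, coef]
  have hσp : 0 < ‖σ‖ := norm_pos_iff.2 hσ0
  have hsub : closedBall (0 : ℂ) ‖σ‖ ⊆ ball 0 ρ :=
    closedBall_subset_ball (mem_ball_zero_iff.1 hσ)
  have h2 := Complex.norm_iteratedDeriv_le_of_forall_mem_sphere_norm_le n hσp
    (h.diff.diffContOnCl_ball hsub) (fun z hz => h.bound z (hsub (sphere_subset_closedBall hz)))
  rw [norm_div, Complex.norm_natCast, div_le_iff₀ (by positivity)]
  refine h2.trans (le_of_eq ?_)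
  rw [one_div, inv_pow]
  field_simp

theorem Lin.iterate_eq (ha0 : 0 ≤ a) (ha1 : a ≤ 1) (hl : ‖l‖ = 1) (h : Lin a l K ρ φ)
    (hσ : σ ∈ ball (0 : ℂ) ρ) (n : ℕ) :
    (a * l) ^ n * σ ∈ ball (0 : ℂ) ρ ∧ (qmap a l K)^[n] (φ σ) = φ ((a * l) ^ n * σ) := by
  induction n with
  | zero => simpa using hσ
  | succ n ih =>
    have h1 : (a * l) ^ (n + 1) * σ = a * l * ((a * l) ^ n * σ) := by ring
    refine ⟨?_, ?_⟩
    · rw [h1, mem_ball_zero_iff]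
      exact (norm_mul_mul_lt ha0 ha1 hl _).trans_lt (mem_ball_zero_iff.1 ih.1)
    · rw [Function.iterate_succ_apply', ih.2, h1, h.eq _ ih.1]

theorem Lin.norm_le (h : Lin a l K ρ φ) {s : ℂ} (hs : s ∈ ball (0 : ℂ) ρ) :
    ‖φ s‖ ≤ 4 / ρ * ‖s‖ := by
  have h1 := Complex.dist_le_div_mul_dist_of_mapsTo_ball (R₂ := 4) h.diff (by
    intro z hz
    rw [h.zero, mem_closedBall_zero_iff]
    exact h.bound z hz) hs
  simpa [h.zero] using h1

theorem Lin.tendsto_div (h : Lin a l K ρ φ) (hρ : 0 < ρ) {s : ℕ → ℂ}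
    (hs : Tendsto s atTop (𝓝 0)) (hs0 : ∀ n, s n ≠ 0) :
    Tendsto (fun n => φ (s n) / s n) atTop (𝓝 1) := by
  have h1 := (h.analyticAt (mem_ball_self hρ)).differentiableAt.hasDerivAt.tendsto_slope
  rw [h.deriv_one] at h1
  have h2 := h1.comp (tendsto_nhdsWithin_iff.2 ⟨hs, Eventually.of_forall hs0⟩)
  refine h2.congr fun n => ?_
  simp [slope_def_field, h.zero]

theorem Lin.tendsto_iterate (ha0 : 0 < a) (ha1 : a < 1) (hl : ‖l‖ = 1) (h : Lin a l K ρ φ)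
    (hσ : σ ∈ ball (0 : ℂ) ρ) (hσ0 : σ ≠ 0) :
    Tendsto (fun n => (qmap a l K)^[n] (φ σ) / (a * l) ^ n) atTop (𝓝 σ) := by
  have hnorm : ‖(a : ℂ) * l‖ = a := norm_ofReal_mul ha0.le hl
  have hm0 : (a : ℂ) * l ≠ 0 := by rw [← norm_pos_iff, hnorm]; linarith
  have hρ : 0 < ρ := (norm_nonneg σ).trans_lt (mem_ball_zero_iff.1 hσ)
  have hs : Tendsto (fun n : ℕ => ((a : ℂ) * l) ^ n * σ) atTop (𝓝 0) := by
    simpa using (tendsto_pow_atTop_nhds_zero_of_norm_lt_one (by rwa [hnorm])).mul_const σ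
  have h1 := (h.tendsto_div hρ hs fun n => mul_ne_zero (pow_ne_zero _ hm0) hσ0).mul_const σ
  rw [one_mul] at h1
  refine h1.congr fun n => ?_
  rw [(h.iterate_eq ha0.le ha1.le hl hσ n).2]
  field_simp

theorem Lin.ne_zero (ha0 : 0 < a) (ha1 : a < 1) (hl : ‖l‖ = 1) (hK : SmallPert 10 (1 / 4) K)
    (h : Lin a l K ρ φ) (hσ : σ ∈ ball (0 : ℂ) ρ) (hσ0 : σ ≠ 0) : φ σ ≠ 0 := by
  intro h0
  have h1 := h.tendsto_iterate ha0 ha1 hl hσ hσ0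
  have h2 : ∀ n, (qmap a l K)^[n] (φ σ) = 0 := by
    intro n
    rw [h0]
    exact Function.iterate_fixed (qmap_zero hK) n
  simp only [h2, zero_div] at h1
  exact hσ0 (tendsto_nhds_unique h1 tendsto_const_nhds)

end

end YoccozBrjuno

namespace YoccozBrjuno

open Topology Filter Polynomial Metric

theorem smallPert_zero {R δ : ℝ} (hδ : 0 ≤ δ) : SmallPert R δ (fun _ => 0) :=
  ⟨differentiableOn_const _, rfl, by simp, fun _ _ => by simpa using hδ⟩

section

variable {a : ℝ} {l : ℂ} {H : ℂ → ℂ}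

/-- The position of the critical value in the linearizing coordinate cannot shrink too much when
the map is perturbed. -/
theorem crit_harnack (ha : 9 / 10 ≤ a) (ha1 : a < 1) (hl : ‖l‖ = 1)
    (hH : SmallPert 10 (1 / 8) H) {ρ₀ ρ₁ : ℝ} {φ₀ φ₁ : ℂ → ℂ} {σ₀ σ₁ : ℂ}
    (h₀ : Lin a l (fun _ => 0) ρ₀ φ₀) (hσ₀ : σ₀ ∈ ball (0 : ℂ) ρ₀) (hv₀ : φ₀ σ₀ = -a * l ^ 2 / 4)
    (h₁ : Lin a l H ρ₁ φ₁) (hσ₁ : σ₁ ∈ ball (0 : ℂ) ρ₁) (hv₁ : φ₁ σ₁ = -a * l ^ 2 / 4) :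
    ‖σ₀‖ ^ 3 / 16 ≤ ‖σ₁‖ := by
  have ha0 : 0 < a := by linarith
  have hac : (a : ℂ) ≠ 0 := by exact_mod_cast ha0.ne'
  have hl0 : l ≠ 0 := by rw [← norm_pos_iff, hl]; exact one_pos
  have hm0 : (a : ℂ) * l ≠ 0 := mul_ne_zero hac hl0
  set v : ℂ := -a * l ^ 2 / 4 with hv
  have hvne : v ≠ 0 := by simp [hv, hac, hl0]
  have hK : ∀ t ∈ ball (0 : ℂ) 2, SmallPert 10 (1 / 4) (fun z => t * H z) := by
    intro t ht
    have h1 : SmallPert 10 (1 / 4 - 1 / 4) (fun _ => (0 : ℂ)) := smallPert_zero (by norm_num)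
    have h2 := h1.add_mul (by norm_num) hH (t := t) (by
      rw [mem_ball_zero_iff] at ht
      linarith)
    simpa using h2
  let f : ℕ → ℂ → ℂ := fun n t => (qmap a l (fun z => t * H z))^[n] v / (a * l) ^ n
  have hprop : ∀ n, ∀ t ∈ ball (0 : ℂ) 2, f n t ≠ 0 ∧ ‖f n t‖ ≤ 4 ∧
      ‖(qmap a l (fun z => t * H z))^[n] v‖ ≤ 4 := by
    intro n t ht
    obtain ⟨ρ, φ, h, σ, hσ, hσv⟩ := exists_lin_crit ha ha1 hl (hK t ht)
    have hρ : 0 < ρ := (norm_nonneg σ).trans_lt (mem_ball_zero_iff.1 hσ)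
    have hσ0 : σ ≠ 0 := by
      rintro rfl
      exact hvne (hσv.symm.trans h.zero)
    obtain ⟨h1, h2⟩ := h.iterate_eq ha0.le ha1.le hl hσ n
    rw [hσv, ← hv] at h2
    have h3 : (a * l) ^ n * σ ≠ 0 := mul_ne_zero (pow_ne_zero _ hm0) hσ0
    refine ⟨?_, ?_, ?_⟩
    · simp only [f]
      rw [h2]
      exact div_ne_zero (h.ne_zero ha0 ha1 hl (hK t ht) h1 h3) (pow_ne_zero _ hm0)
    · simp only [f]
      rw [h2, norm_div, div_le_iff₀ (norm_pos_iff.2 (pow_ne_zero _ hm0))]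
      refine (h.norm_le h1).trans ?_
      rw [norm_mul]
      have h5 : ‖σ‖ ≤ ρ := (mem_ball_zero_iff.1 hσ).le
      rw [div_mul_eq_mul_div, div_le_iff₀ hρ]
      nlinarith [norm_nonneg (((a : ℂ) * l) ^ n)]
    · rw [h2]
      exact h.bound _ h1
  have hdiff : ∀ n, DifferentiableOn ℂ (fun t => (qmap a l (fun z => t * H z))^[n] v)
      (ball 0 2) := by
    intro n
    induction n with
    | zero => exact differentiableOn_const _
    | succ n ih =>
      simp only [Function.iterate_succ_apply']
      have h1 : DifferentiableOn ℂ (fun t => H ((qmap a l (fun z => t * H z))^[n] v)) (ball 0 2) :=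
        hH.diff.comp ih fun t ht => by
          rw [mem_ball_zero_iff]
          linarith [(hprop n t ht).2.2]
      have h2 := ih.fun_add (differentiableOn_id.fun_mul h1)
      exact (((h2.const_mul l).fun_add (h2.fun_pow 2)).const_mul (a : ℂ))
  have hineq : ∀ n, ‖f n 0‖ ^ 3 / 4 ^ 2 ≤ ‖f n 1‖ := fun n =>
    harnack_norm (by norm_num) ((hdiff n).div_const _) (fun t ht => (hprop n t ht).1)
      (fun t ht => (hprop n t ht).2.1)
  have hne₀ : σ₀ ≠ 0 := by
    rintro rfl
    exact hvne (hv₀.symm.trans h₀.zero)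
  have hne₁ : σ₁ ≠ 0 := by
    rintro rfl
    exact hvne (hv₁.symm.trans h₁.zero)
  have hlim₀ : Tendsto (fun n => f n 0) atTop (𝓝 σ₀) := by
    have := h₀.tendsto_iterate ha0 ha1 hl hσ₀ hne₀
    simpa [f, hv₀, hv] using this
  have hlim₁ : Tendsto (fun n => f n 1) atTop (𝓝 σ₁) := by
    have := h₁.tendsto_iterate ha0 ha1 hl hσ₁ hne₁
    simpa [f, hv₁, hv] using this
  have := le_of_tendsto_of_tendsto' ((hlim₀.norm.pow 3).div_const (4 ^ 2)) hlim₁.norm hineq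
  norm_num at this ⊢
  exact this

end

end YoccozBrjuno

namespace YoccozBrjuno

open Topology Filter Polynomial Metric

/-- Quantitative local behaviour of germs tangent to the identity. -/
theorem tangent_local {Φ : ℂ → ℂ} (h : AnalyticAt ℂ Φ 0) (h0 : Φ 0 = 0) (h1 : deriv Φ 0 = 1)
    {p : ℂ → Prop} (hp : ∀ᶠ z in 𝓝 0, p z) :
    ∃ ρ > 0, ∃ C > 0, ∃ ε > 0,
      (∀ x ∈ ball (0 : ℂ) ρ, ∀ y ∈ ball (0 : ℂ) ρ, ‖x - y‖ ≤ 2 * ‖Φ x - Φ y‖) ∧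
      (∀ x ∈ ball (0 : ℂ) ρ, ‖Φ x‖ ≤ 2 * ‖x‖) ∧
      (∀ x ∈ ball (0 : ℂ) ρ, ∀ a : ℝ, 0 ≤ a → a ≤ 1 →
        ‖a * Φ x - Φ (a * x)‖ ≤ a * (C * (1 - a) * ‖x‖ ^ 2)) ∧
      (∀ u : ℂ, ‖u‖ ≤ ε → ∃ x ∈ ball (0 : ℂ) ρ, Φ x = u) ∧
      ∀ x ∈ ball (0 : ℂ) ρ, p x := by
  have hs : HasStrictDerivAt Φ 1 0 := h1 ▸ h.hasStrictDerivAt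
  have hlit := hs.hasStrictFDerivAt.isLittleO.def (show (0 : ℝ) < 1 / 2 by norm_num)
  obtain ⟨C, s, hs, hC⟩ := (analyticAt_dslope (a := 0) h).hasStrictFDerivAt.exists_lipschitzOnWith
  obtain ⟨r, hr, hr0, -, -, hright⟩ := exists_local_inverse h h0 h1
  have hlit2 : ∀ᶠ q in 𝓝 (0 : ℂ) ×ˢ 𝓝 (0 : ℂ),
      ‖Φ q.1 - Φ q.2 - (q.1 - q.2)‖ ≤ 1 / 2 * ‖q.1 - q.2‖ := by
    rw [← nhds_prod_eq]
    filter_upwards [hlit] with q hq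
    simpa using hq
  obtain ⟨ρ, hρ, hρl⟩ : ∃ ρ > 0, ∀ x ∈ ball (0 : ℂ) ρ, ∀ y ∈ ball (0 : ℂ) ρ,
      ‖Φ x - Φ y - (x - y)‖ ≤ 1 / 2 * ‖x - y‖ ∧ x ∈ s ∧ p x := by
    obtain ⟨t, ht, hq⟩ := eventually_prod_self_iff'.1 hlit2
    have h3 := (show ∀ᶠ z in 𝓝 (0 : ℂ), z ∈ t from ht).and ((show ∀ᶠ z in 𝓝 (0 : ℂ), z ∈ s from hs).and hp)
    obtain ⟨ρ, hρ, hh⟩ := Metric.eventually_nhds_iff_ball.1 h3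
    exact ⟨ρ, hρ, fun x hx y hy => ⟨hq x (hh x hx).1 y (hh y hy).1, (hh x hx).2⟩⟩
  have hsurj : ∀ᶠ u in 𝓝 (0 : ℂ), Φ (r u) = u ∧ r u ∈ ball (0 : ℂ) ρ := by
    refine hright.and (hr.continuousAt.eventually_mem ?_)
    rw [hr0]
    exact ball_mem_nhds _ hρ
  obtain ⟨ε, hε, hεs⟩ := Metric.eventually_nhds_iff_ball.1 hsurj
  have hm0 : (0 : ℂ) ∈ ball (0 : ℂ) ρ := mem_ball_self hρ
  refine ⟨ρ, hρ, C + 1, by positivity, ε / 2, by positivity, ?_, ?_, ?_, ?_, ?_⟩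
  · intro x hx y hy
    have h2 := (hρl x hx y hy).1
    have h3 := norm_sub_le (Φ x - Φ y) (Φ x - Φ y - (x - y))
    rw [show Φ x - Φ y - (Φ x - Φ y - (x - y)) = x - y by ring] at h3
    linarith
  · intro x hx
    have h2 := (hρl x hx 0 hm0).1
    rw [h0, sub_zero, sub_zero] at h2
    have h3 := norm_add_le (Φ x - x) x
    rw [sub_add_cancel] at h3
    linarith [norm_nonneg x]
  · intro x hx a ha0 ha1
    have hax : (a : ℂ) * x ∈ ball (0 : ℂ) ρ := by
      rw [mem_ball_zero_iff] at hx ⊢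
      rw [norm_mul, Complex.norm_real, Real.norm_of_nonneg ha0]
      nlinarith [norm_nonneg x]
    have h2 := hC.dist_le_mul _ (hρl x hx 0 hm0).2.1 _ (hρl _ hax 0 hm0).2.1
    rw [dist_eq_norm, dist_eq_norm] at h2
    have h3 : ‖x - a * x‖ = (1 - a) * ‖x‖ := by
      rw [show x - a * x = ((1 - a : ℝ) : ℂ) * x by push_cast; ring, norm_mul, Complex.norm_real,
        Real.norm_of_nonneg (by linarith)]
    rw [h3] at h2
    rw [eq_mul_dslope h0 x, eq_mul_dslope h0 (a * x), show (a : ℂ) * (x * dslope Φ 0 x) -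
      a * x * dslope Φ 0 (a * x) = a * (x * (dslope Φ 0 x - dslope Φ 0 (a * x))) by ring,
      norm_mul, norm_mul, Complex.norm_real, Real.norm_of_nonneg ha0]
    refine mul_le_mul_of_nonneg_left ?_ ha0
    have h4 : 0 ≤ (1 - a) * ‖x‖ ^ 2 := mul_nonneg (by linarith) (by positivity)
    calc ‖x‖ * ‖dslope Φ 0 x - dslope Φ 0 (a * x)‖ ≤ ‖x‖ * (C * ((1 - a) * ‖x‖)) := by gcongr
      _ = C * ((1 - a) * ‖x‖ ^ 2) := by ring
      _ ≤ (C + 1) * ((1 - a) * ‖x‖ ^ 2) := by nlinarith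
      _ = _ := by ring
  · intro u hu
    have := hεs u (mem_ball_zero_iff.2 (by linarith))
    exact ⟨r u, this.2, this.1⟩
  · intro x hx
    exact (hρl x hx 0 hm0).2.2

theorem quad_recursion {X : ℕ → ℝ} {a C ε : ℝ} (ha0 : 0 < a) (ha1 : a < 1) (hC : 0 < C)
    (hX0 : ∀ n, 0 ≤ X n) (hXε : ∀ n, X n ≤ 2 * ε) (hCε : 8 * C * ε ≤ 1)
    (hrec : ∀ n, a * X n - 2 * a * C * (1 - a) * X n ^ 2 ≤ X (n + 1)) (n : ℕ) :
    a ^ n * (X 0 / 2) ≤ X n := by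
  have hCX : ∀ n, C * X n ≤ 1 / 4 := fun n => by nlinarith [hXε n]
  have key : ∀ n, a * (X n - 2 * C * X n ^ 2) ≤ X (n + 1) - 2 * C * X (n + 1) ^ 2 := by
    intro n
    have h1 := hrec n
    have h2 := hCX n
    have h3 := hCX (n + 1)
    have h4 := hX0 n
    set x := X n
    set x' := X (n + 1)
    set y := a * x - 2 * a * C * (1 - a) * x ^ 2 with hy
    have hyx : y ≤ a * x := by
      have : 0 ≤ 2 * a * C * (1 - a) * x ^ 2 := by
        have : 0 ≤ 1 - a := by linarith
        positivity
      linarith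
    have hy0 : 0 ≤ y := by
      have : y = a * x * (1 - 2 * (1 - a) * (C * x)) := by rw [hy]; ring
      rw [this]
      have : 0 ≤ C * x := by positivity
      refine mul_nonneg (by positivity) ?_
      nlinarith
    have hyC : C * y ≤ 1 / 4 := by nlinarith
    have hmono : y - 2 * C * y ^ 2 ≤ x' - 2 * C * x' ^ 2 := by
      have : 0 ≤ (x' - y) * (1 - 2 * (C * x' + C * y)) :=
        mul_nonneg (by linarith) (by linarith)
      nlinarith
    have hy2 : y ^ 2 ≤ (a * x) ^ 2 := by gcongr
    have : 2 * C * y ^ 2 ≤ 2 * C * (a * x) ^ 2 := by gcongr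
    have h5 : a * (x - 2 * C * x ^ 2) = y - 2 * C * (a * x) ^ 2 := by rw [hy]; ring
    linarith
  have hind : ∀ n, a ^ n * (X 0 - 2 * C * X 0 ^ 2) ≤ X n - 2 * C * X n ^ 2 := by
    intro n
    induction n with
    | zero => simp
    | succ n ih =>
      refine le_trans ?_ (key n)
      rw [pow_succ', mul_assoc]
      exact mul_le_mul_of_nonneg_left ih ha0.le
  have h1 := hind n
  have h2 : X 0 / 2 ≤ X 0 - 2 * C * X 0 ^ 2 := by nlinarith [hCX 0, hX0 0]
  have h3 : 0 ≤ 2 * C * X n ^ 2 := by positivity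
  have h4 : a ^ n * (X 0 / 2) ≤ a ^ n * (X 0 - 2 * C * X 0 ^ 2) := by gcongr
  linarith

/-- A Siegel linearization keeps the critical value away from the origin in the linearizing
coordinates of the contracting maps `a * P`. -/
theorem crit_lower_bound {l : ℂ} (hl : ‖l‖ = 1) {Φ : ℂ → ℂ} (h : AnalyticAt ℂ Φ 0) (h0 : Φ 0 = 0)
    (h1 : deriv Φ 0 = 1) (heq : ∀ᶠ z in 𝓝 0, l * Φ z + Φ z ^ 2 = Φ (l * z)) :
    ∃ c > 0, ∀ a : ℝ, 9 / 10 ≤ a → a < 1 → ∀ ρ φ, Lin a l (fun _ => 0) ρ φ →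
      ∀ σ ∈ ball (0 : ℂ) ρ, φ σ = -a * l ^ 2 / 4 → c ≤ ‖σ‖ := by
  obtain ⟨ρ₁, hρ₁, C, hC, ε₀, hε₀, hexp, hlip, hcomm, hsurj, heq⟩ := tangent_local h h0 h1 heq
  set ε : ℝ := min ε₀ (min (1 / 8) (1 / (8 * C))) with hε
  have hεpos : 0 < ε := by positivity
  have hε0 : ε ≤ ε₀ := min_le_left _ _
  have hε8 : ε ≤ 1 / 8 := (min_le_right _ _).trans (min_le_left _ _)
  have hεC : 8 * C * ε ≤ 1 := by
    have : ε ≤ 1 / (8 * C) := (min_le_right _ _).trans (min_le_right _ _)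
    rw [le_div_iff₀ (by positivity)] at this
    linarith
  have hl0 : l ≠ 0 := by rw [← norm_pos_iff, hl]; exact one_pos
  refine ⟨ε / 8, by positivity, fun a ha ha1 ρ φ hφ σ hσ hv => ?_⟩
  have ha0 : 0 < a := by linarith
  have hac : (a : ℂ) ≠ 0 := by exact_mod_cast ha0.ne'
  have hvn : ‖φ σ‖ = a / 4 := by
    rw [hv]
    simp [hl, abs_of_pos ha0]
  have hsub : closedBall (0 : ℂ) ‖σ‖ ⊆ ball 0 ρ :=
    closedBall_subset_ball (mem_ball_zero_iff.1 hσ)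
  obtain ⟨s, hsA, hsmin⟩ : ∃ s ∈ closedBall (0 : ℂ) ‖σ‖ ∩ {s | ε ≤ ‖φ s‖},
      ∀ s' ∈ closedBall (0 : ℂ) ‖σ‖ ∩ {s | ε ≤ ‖φ s‖}, ‖s‖ ≤ ‖s'‖ := by
    have hcl : IsClosed (closedBall (0 : ℂ) ‖σ‖ ∩ {s | ε ≤ ‖φ s‖}) :=
      ((hφ.diff.continuousOn.mono hsub).norm).preimage_isClosed_of_isClosed isClosed_closedBall
        isClosed_Ici
    have hcpt := (isCompact_closedBall (0 : ℂ) ‖σ‖).of_isClosed_subset hcl Set.inter_subset_left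
    refine hcpt.exists_isMinOn ⟨σ, by simp, ?_⟩ continuous_norm.continuousOn
    simp only [Set.mem_ofPred_eq, hvn]
    linarith
  have hsball := hsub hsA.1
  have hsε : ε ≤ ‖φ s‖ := hsA.2
  have hs0 : s ≠ 0 := by
    rintro rfl
    rw [hφ.zero, norm_zero] at hsε
    linarith
  have hsn : 0 < ‖s‖ := norm_pos_iff.2 hs0
  have hlt : ∀ s' : ℂ, ‖s'‖ < ‖s‖ → ‖φ s'‖ ≤ ε := by
    intro s' hs'
    by_contra hcon
    push Not at hcon
    have := hsmin s' ⟨by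
      rw [mem_closedBall_zero_iff]
      exact hs'.le.trans (mem_closedBall_zero_iff.1 hsA.1), hcon.le⟩
    linarith
  have hsle : ‖φ s‖ ≤ ε := by
    have ht : Tendsto (fun t : ℝ => (t : ℂ) * s) (𝓝[<] 1) (𝓝 s) := by
      have : ContinuousAt (fun t : ℝ => (t : ℂ) * s) 1 := by fun_prop
      simpa using this.tendsto.mono_left nhdsWithin_le_nhds
    refine le_of_tendsto ((hφ.analyticAt hsball).continuousAt.norm.tendsto.comp ht) ?_
    filter_upwards [Ioo_mem_nhdsLT (show (0 : ℝ) < 1 by norm_num)] with t ht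
    refine hlt _ ?_
    rw [norm_mul, Complex.norm_real, Real.norm_of_nonneg ht.1.le]
    nlinarith [ht.2]
  have hnorm : ‖(a : ℂ) * l‖ = a := norm_ofReal_mul ha0.le hl
  have hun : ∀ n : ℕ, ‖φ ((a * l) ^ n * s)‖ ≤ ε := by
    intro n
    rcases Nat.eq_zero_or_pos n with rfl | hn
    · simpa using hsle
    · refine hlt _ ?_
      rw [norm_mul, norm_pow, hnorm]
      have : a ^ n < 1 := pow_lt_one₀ ha0.le ha1 hn.ne'
      nlinarith
  choose x hxb hx using fun n => hsurj _ ((hun n).trans hε0)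
  have hx2 : ∀ n, ‖x n‖ ≤ 2 * ‖φ ((a * l) ^ n * s)‖ := by
    intro n
    have := hexp _ (hxb n) 0 (mem_ball_self hρ₁)
    rwa [h0, sub_zero, sub_zero, hx] at this
  have hstep : ∀ n, Φ (x (n + 1)) = a * Φ (l * x n) := by
    intro n
    rw [hx, ← heq _ (hxb n), hx]
    have h2 : ((a : ℂ) * l) ^ (n + 1) * s = a * l * ((a * l) ^ n * s) := by ring
    rw [h2, hφ.eq _ (hφ.iterate_eq ha0.le ha1.le hl hsball n).1]
    simp [qmap]
  have hrec : ∀ n, a * ‖x n‖ - 2 * a * C * (1 - a) * ‖x n‖ ^ 2 ≤ ‖x (n + 1)‖ := by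
    intro n
    have hlx : l * x n ∈ ball (0 : ℂ) ρ₁ := by
      rw [mem_ball_zero_iff, norm_mul, hl, one_mul]
      exact mem_ball_zero_iff.1 (hxb n)
    have halx : (a : ℂ) * (l * x n) ∈ ball (0 : ℂ) ρ₁ := by
      rw [← mul_assoc, mem_ball_zero_iff]
      exact (norm_mul_mul_lt ha0.le ha1.le hl _).trans_lt (mem_ball_zero_iff.1 (hxb n))
    have h2 := hexp _ (hxb (n + 1)) _ halx
    rw [hstep] at h2
    have h3 := hcomm _ hlx a ha0.le ha1.le
    rw [norm_mul, hl, one_mul] at h3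
    have h4 := norm_sub_norm_le ((a : ℂ) * (l * x n)) (x (n + 1))
    rw [norm_sub_rev, norm_mul, norm_mul, hl, one_mul, Complex.norm_real,
      Real.norm_of_nonneg ha0.le] at h4
    linarith
  have hquad := quad_recursion ha0 ha1 hC (fun n => norm_nonneg (x n))
    (fun n => (hx2 n).trans (by linarith [hun n])) hεC hrec
  have hx0 : ε / 2 ≤ ‖x 0‖ := by
    have h2 := hlip _ (hxb 0)
    rw [hx, pow_zero, one_mul] at h2
    linarith
  have hlim := (hφ.tendsto_iterate ha0 ha1 hl hsball hs0).norm
  have hfin : ε / 8 ≤ ‖s‖ := by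
    refine ge_of_tendsto' hlim fun n => ?_
    rw [(hφ.iterate_eq ha0.le ha1.le hl hsball n).2, norm_div, norm_pow, hnorm,
      le_div_iff₀ (by positivity)]
    have h2 := hquad n
    have h3 := hx2 n
    have h4 : a ^ n * (ε / 2) ≤ a ^ n * ‖x 0‖ := by gcongr
    linarith
  exact hfin.trans (mem_closedBall_zero_iff.1 hsA.1)

end YoccozBrjuno

namespace YoccozBrjuno

open Topology Filter Polynomial Metric

theorem nrm_ne_zero_of_contracting {m : ℂ} (hm0 : m ≠ 0) (hm1 : ‖m‖ < 1) (n : ℕ) :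
    nrm m n ≠ 0 := by
  refine nrm_ne_zero fun j hj h => ?_
  rw [Finset.mem_Ico] at hj
  have h1 : ‖m‖ ^ n < ‖m‖ ^ j := pow_lt_pow_right_of_lt_one₀ (norm_pos_iff.2 hm0) hm1 hj.2
  have h2 := congrArg norm h
  rw [norm_pow, norm_pow] at h2
  linarith

section

variable {l : ℂ} {Φ : ℂ → ℂ}

/-- If the quadratic polynomial is linearizable then the coefficient functionals of its small
perturbations grow at most geometrically. -/
theorem exists_qmap_gam_bound (hl : ‖l‖ = 1) (hnl : ∀ n, nrm l n ≠ 0) (h : AnalyticAt ℂ Φ 0)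
    (h0 : Φ 0 = 0) (h1 : deriv Φ 0 = 1) (heq : ∀ᶠ z in 𝓝 0, l * Φ z + Φ z ^ 2 = Φ (l * z)) :
    ∃ D > 0, ∀ H, SmallPert 10 (1 / 8) H → ∀ n : ℕ, 1 ≤ n →
      ‖gam l n (qmap 1 l H) id‖ ≤ 4 * D ^ n := by
  obtain ⟨c, hc, hcrit⟩ := crit_lower_bound hl h h0 h1 heq
  refine ⟨16 / c ^ 3, by positivity, fun H hH n hn => ?_⟩
  have hl0 : l ≠ 0 := by rw [← norm_pos_iff, hl]; exact one_pos
  have hH' : SmallPert 10 (1 / 4) H := hH.mono le_rfl (by norm_num)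
  let G : ℂ → ℂ := fun t => gam (t * l) n (fun z => t * (l * (z + H z) + (z + H z) ^ 2)) id
  have hG : ∀ a : ℝ, G a = gam (a * l) n (qmap a l H) id := fun a => rfl
  have hcont : ContinuousAt G 1 := by
    refine (differentiableAt_gam (t₀ := 1) (L := fun t => t * l)
      (F := fun x : ℂ × ℂ => x.1 * (l * (x.2 + H x.2) + (x.2 + H x.2) ^ 2)) (v := id) ?_ ?_ ?_
      analyticAt_id hn ?_).continuousAt
    · have h2 : AnalyticAt ℂ (fun x : ℂ × ℂ => H x.2) (1, 0) :=
        AnalyticAt.fun_comp (f := Prod.snd) (x := ((1 : ℂ), (0 : ℂ)))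
          (hH.analyticAt (mem_ball_self (by norm_num))) analyticAt_snd
      have h3 : AnalyticAt ℂ (fun x : ℂ × ℂ => x.2) (1, 0) := analyticAt_snd
      have h4 : AnalyticAt ℂ (fun x : ℂ × ℂ => x.1) (1, 0) := analyticAt_fst
      exact h4.mul ((analyticAt_const.mul (h3.add h2)).add ((h3.add h2).pow 2))
    · simp [hH.zero]
    · fun_prop
    · simpa using hnl n
  have hlim : Tendsto (fun a : ℝ => ‖G a‖) (𝓝[<] 1) (𝓝 ‖G 1‖) := by
    refine hcont.norm.tendsto.comp ?_
    have : Tendsto (fun a : ℝ => (a : ℂ)) (𝓝 1) (𝓝 ((1 : ℝ) : ℂ)) :=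
      Complex.continuous_ofReal.tendsto 1
    rw [Complex.ofReal_one] at this
    exact this.mono_left nhdsWithin_le_nhds
  have hG1 : G 1 = gam l n (qmap 1 l H) id := by
    have := hG 1
    simpa using this
  rw [← hG1]
  refine le_of_tendsto hlim ?_
  filter_upwards [Ioo_mem_nhdsLT (show (9 / 10 : ℝ) < 1 by norm_num)] with a ha
  have ha0 : 0 < a := by linarith [ha.1]
  have hac : (a : ℂ) ≠ 0 := by exact_mod_cast ha0.ne'
  obtain ⟨ρ₀, φ₀, hφ₀, σ₀, hσ₀, hv₀⟩ := exists_lin_crit ha.1.le ha.2 hl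
    (smallPert_zero (by norm_num))
  obtain ⟨ρ₁, φ₁, hφ₁, σ₁, hσ₁, hv₁⟩ := exists_lin_crit ha.1.le ha.2 hl hH'
  have h2 := hcrit a ha.1.le ha.2 ρ₀ φ₀ hφ₀ σ₀ hσ₀ hv₀
  have h3 := crit_harnack ha.1.le ha.2 hl hH hφ₀ hσ₀ hv₀ hφ₁ hσ₁ hv₁
  have h4 : c ^ 3 / 16 ≤ ‖σ₁‖ := le_trans (by gcongr) h3
  have hpos : 0 < c ^ 3 / 16 := by positivity
  have hσ10 : σ₁ ≠ 0 := norm_pos_iff.1 (hpos.trans_le h4)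
  have h5 := hφ₁.gam_bound ha.1.le ha.2 hl hH' hσ₁ hσ10 hn
    (nrm_ne_zero_of_contracting (mul_ne_zero hac hl0) (by
      rw [norm_ofReal_mul ha0.le hl]; exact ha.2) n)
  rw [hG]
  refine h5.trans ?_
  have h6 : 1 / ‖σ₁‖ ≤ 16 / c ^ 3 := by
    rw [div_le_div_iff₀ (hpos.trans_le h4) (by positivity)]
    linarith
  gcongr

/-- The perturbations of a rotation with small derivative are controlled by the perturbations
of the quadratic polynomial. -/
theorem exists_germ_gam_bound (hl : ‖l‖ = 1) (hnl : ∀ n, nrm l n ≠ 0) (h : AnalyticAt ℂ Φ 0)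
    (h0 : Φ 0 = 0) (h1 : deriv Φ 0 = 1) (heq : ∀ᶠ z in 𝓝 0, l * Φ z + Φ z ^ 2 = Φ (l * z)) :
    ∃ D > 0, ∀ H, SmallPert 1 (1 / 8) H → ∀ n : ℕ, 1 ≤ n →
      ‖gam l n (germ l H) id‖ ≤ D ^ n := by
  obtain ⟨D, hD, hB⟩ := exists_qmap_gam_bound hl hnl h h0 h1 heq
  refine ⟨4 * (10 * D), by positivity, fun H hH n hn => ?_⟩
  have hl0 : l ≠ 0 := by rw [← norm_pos_iff, hl]; exact one_pos
  have hHa := hH.analyticAt (z := 0) (mem_ball_self one_pos)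
  let f : ℂ → ℂ → ℂ := fun b z => l * z + H z + b * (z + H z / l) ^ 2
  have hfv : ∀ b, f b ∈ vanishing 1 := by
    intro b
    refine vanishing_one.2 ⟨?_, by simp [f, hH.zero]⟩
    simp only [f]
    fun_prop
  have hdiff : Differentiable ℂ fun b => gam l n (f b) id := by
    intro b
    refine differentiableAt_gam (t₀ := b) (L := fun _ => l)
      (F := fun x : ℂ × ℂ => l * x.2 + H x.2 + x.1 * (x.2 + H x.2 / l) ^ 2) (v := id) ?_ ?_
      analyticAt_const analyticAt_id hn (hnl n)
    · have h2 : AnalyticAt ℂ (fun x : ℂ × ℂ => H x.2) (b, 0) :=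
        AnalyticAt.fun_comp (f := Prod.snd) (x := (b, (0 : ℂ))) hHa analyticAt_snd
      have h3 : AnalyticAt ℂ (fun x : ℂ × ℂ => x.2) (b, 0) := analyticAt_snd
      have h4 : AnalyticAt ℂ (fun x : ℂ × ℂ => x.1) (b, 0) := analyticAt_fst
      fun_prop
    · simp [hH.zero]
  have hbd : ∀ b ∈ sphere (0 : ℂ) 10, ‖gam l n (f b) id‖ ≤ (4 * (10 * D)) ^ n := by
    intro b hb
    have hbn : ‖b‖ = 10 := by simpa using hb
    have hb0 : b ≠ 0 := by rw [← norm_pos_iff, hbn]; norm_num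
    let K : ℂ → ℂ := fun x => b / l * H (b⁻¹ * x)
    have hmaps : ∀ x ∈ ball (0 : ℂ) 10, b⁻¹ * x ∈ ball (0 : ℂ) 1 := by
      intro x hx
      rw [mem_ball_zero_iff] at hx ⊢
      rw [norm_mul, norm_inv, hbn]
      linarith
    have hKd : ∀ x ∈ ball (0 : ℂ) 10, HasDerivAt K (l⁻¹ * deriv H (b⁻¹ * x)) x := by
      intro x hx
      have h2 := (hH.analyticAt (hmaps x hx)).differentiableAt.hasDerivAt
      have h3 : HasDerivAt (fun x : ℂ => b⁻¹ * x) b⁻¹ x := by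
        simpa using (hasDerivAt_id x).const_mul b⁻¹
      exact ((h2.comp x h3).const_mul (b / l)).congr_deriv (by field_simp)
    have hK : SmallPert 10 (1 / 8) K := by
      refine ⟨fun x hx => (hKd x hx).differentiableAt.differentiableWithinAt, by simp [K, hH.zero],
        ?_, fun x hx => ?_⟩
      · rw [(hKd 0 (by simp)).deriv]
        simp [hH.deriv_zero]
      · rw [(hKd x hx).deriv, norm_mul, norm_inv, hl, inv_one, one_mul]
        exact hH.bound _ (hmaps x hx)
    have hK' : SmallPert 10 (1 / 4) K := hK.mono le_rfl (by norm_num)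
    have hqv : qmap 1 l K ∈ vanishing 1 :=
      vanishing_one.2 ⟨qmap_analyticAt hK' (by simp), qmap_zero hK'⟩
    have hψv : (fun z => b * z) ∈ vanishing 1 := vanishing_one.2 ⟨by fun_prop, by simp⟩
    have hψd : deriv (fun z => b * z) 0 = b := by simp
    have hsemi := gam_semiconj (l := l) (n := n) (hfv b) hqv hψv (by rw [qmap_deriv hK']; simp) hn
      (Eventually.of_forall fun z => by
        simp only [Function.comp, f, qmap, K]
        rw [inv_mul_cancel_left₀ hb0]
        push_cast
        field_simp) id_mem_vanishing
    rw [hψd, show (id : ℂ → ℂ) ∘ (fun z => b * z) = b • (id : ℂ → ℂ) by ext z; simp,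
      gam_smul (hfv b) _ id_mem_vanishing] at hsemi
    have h2 := congrArg norm hsemi
    rw [norm_mul, norm_mul, norm_pow, hbn] at h2
    have h3 := hB K hK n hn
    have h4 : (10 : ℝ) ^ n * ‖gam l n (qmap 1 l K) id‖ ≤ 10 ^ n * (4 * D ^ n) := by gcongr
    have h5 : (4 : ℝ) ≤ 4 ^ n := le_self_pow₀ (by norm_num) (by omega)
    have h6 : 4 * (10 * D) ^ n ≤ (4 * (10 * D)) ^ n := by
      rw [mul_pow 4]
      gcongr
    rw [mul_pow] at h6
    linarith [norm_nonneg (gam l n (f b) id)]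
  have h2 := Complex.norm_le_of_forall_mem_frontier_norm_le (U := ball (0 : ℂ) 10) isBounded_ball
    hdiff.diffContOnCl (by rwa [frontier_ball _ (by norm_num)])
    (z := 0) (subset_closure (mem_ball_self (by norm_num)))
  have h3 : f 0 = germ l H := by
    ext z
    simp [f, germ]
  rwa [h3] at h2

end

end YoccozBrjuno

namespace YoccozBrjuno

open Topology Filter Polynomial Metric

theorem gam_id_rescale {l : ℂ} {D r δ : ℝ} (hr : 0 < r) (hr1 : r ≤ 1) {n : ℕ} (hn : 1 ≤ n)
    (hB : ∀ H, SmallPert 1 δ H → ‖gam l n (germ l H) id‖ ≤ D ^ n) {K : ℂ → ℂ}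
    (hK : SmallPert r δ K) : ‖gam l n (germ l K) id‖ ≤ (D / r) ^ n := by
  have hrc : (r : ℂ) ≠ 0 := by exact_mod_cast hr.ne'
  let H : ℂ → ℂ := fun w => (r : ℂ)⁻¹ * K (r * w)
  have hmaps : ∀ w ∈ ball (0 : ℂ) 1, (r : ℂ) * w ∈ ball (0 : ℂ) r := by
    intro w hw
    rw [mem_ball_zero_iff] at hw ⊢
    rw [norm_mul, Complex.norm_real, Real.norm_of_nonneg hr.le]
    nlinarith
  have hHd : ∀ w ∈ ball (0 : ℂ) 1, HasDerivAt H (deriv K (r * w)) w := by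
    intro w hw
    have h2 := (hK.analyticAt (hmaps w hw)).differentiableAt.hasDerivAt
    have h3 : HasDerivAt (fun w : ℂ => (r : ℂ) * w) r w := by
      simpa using (hasDerivAt_id w).const_mul (r : ℂ)
    exact ((h2.comp w h3).const_mul (r : ℂ)⁻¹).congr_deriv (by field_simp)
  have hH : SmallPert 1 δ H := by
    refine ⟨fun w hw => (hHd w hw).differentiableAt.differentiableWithinAt, by simp [H, hK.zero],
      ?_, fun w hw => ?_⟩
    · rw [(hHd 0 (by simp)).deriv, mul_zero, hK.deriv_zero]
    · rw [(hHd w hw).deriv]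
      exact hK.bound _ (hmaps w hw)
  have hψv : (fun z => (r : ℂ)⁻¹ * z) ∈ vanishing 1 := vanishing_one.2 ⟨by fun_prop, by simp⟩
  have hsemi := gam_semiconj (l := l) (f := germ l K) (g := germ l H) (n := n)
    (hK.germ_mem hr) (hH.germ_mem one_pos) hψv
    (hH.deriv_germ_zero one_pos) hn
    (Eventually.of_forall fun z => by
      simp only [Function.comp, germ, H]
      rw [mul_inv_cancel_left₀ hrc]
      ring) id_mem_vanishing
  rw [show deriv (fun z => (r : ℂ)⁻¹ * z) 0 = (r : ℂ)⁻¹ by simp,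
    show (id : ℂ → ℂ) ∘ (fun z => (r : ℂ)⁻¹ * z) = (r : ℂ)⁻¹ • (id : ℂ → ℂ) by ext z; simp,
    gam_smul (hK.germ_mem hr) _ id_mem_vanishing] at hsemi
  have h2 := congrArg norm hsemi
  rw [norm_mul, norm_mul, norm_pow, norm_inv, Complex.norm_real, Real.norm_of_nonneg hr.le] at h2
  have h3 : (r⁻¹) ^ n * ‖gam l n (germ l H) id‖ ≤ (r⁻¹) ^ n * D ^ n := by
    gcongr
    exact hB H hH
  have h4 : ‖gam l n (germ l K) id‖ ≤ r⁻¹ * ‖gam l n (germ l K) id‖ :=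
    le_mul_of_one_le_left (norm_nonneg _) ((one_le_inv₀ hr).2 hr1)
  rw [div_eq_inv_mul, mul_pow]
  linarith

section

variable {l : ℂ} {h u : ℂ → ℂ}

/-- Bounded observables vanishing to second order are controlled through their coboundary. -/
theorem gam_bound_of_vanishing_two (hl : ‖l‖ = 1) {n : ℕ} (hn : 1 ≤ n) (hnl : nrm l n ≠ 0) {A : ℝ}
    (hA : ∀ K, SmallPert (1 / 8) (1 / 8) K → ‖gam l n (germ l K) id‖ ≤ A)
    (hh : SmallPert 1 (1 / 16) h) (hu : DifferentiableOn ℂ u (ball 0 1)) (hu2 : u ∈ vanishing 2)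
    (hu3 : ∀ z ∈ ball (0 : ℂ) 1, ‖u z‖ ≤ 3) : ‖gam l n (germ l h) u‖ ≤ 2000 * A := by
  have hfm := hh.germ_mem (l := l) one_pos
  have hfd := hh.deriv_germ_zero (l := l) one_pos
  set f := germ l h with hf
  have hA0 : 0 ≤ A := (norm_nonneg _).trans (hA (fun _ => 0) (smallPert_zero (by norm_num)))
  let H : ℂ → ℂ := fun z => u (f z) - deriv f z * u z
  have hmaps : ∀ z ∈ ball (0 : ℂ) (1 / 4), f z ∈ ball (0 : ℂ) 1 := by
    intro z hz
    have h1 := hh.norm_le (ball_subset_ball (by norm_num) hz)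
    rw [mem_ball_zero_iff] at hz ⊢
    have h2 : ‖f z‖ ≤ ‖l * z‖ + ‖h z‖ := norm_add_le _ _
    rw [norm_mul, hl] at h2
    linarith
  have hH2 : H ∈ vanishing 2 := by
    have h1 : (fun z => deriv f z * u z) ∈ vanishing 2 := by
      refine vanishing_mono (m := 2) (n := 0 + 2) (by norm_num) (vanishing_mul ?_ hu2)
      exact deriv_mem_vanishing hfm
    exact (vanishing 2).sub_mem (comp_mem_vanishing hu2 hfm) h1
  have hHd : DifferentiableOn ℂ H (ball 0 (1 / 4)) := by
    intro z hz
    have hz1 : z ∈ ball (0 : ℂ) 1 := ball_subset_ball (by norm_num) hz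
    have h1 : AnalyticAt ℂ f z := hh.germ_analyticAt hz1
    have h2 := h1.deriv
    have h3 : AnalyticAt ℂ u z := hu.analyticAt (isOpen_ball.mem_nhds hz1)
    have h4 : AnalyticAt ℂ u (f z) := hu.analyticAt (isOpen_ball.mem_nhds (hmaps z hz))
    exact ((AnalyticAt.fun_comp h4 h1).sub (h2.mul h3)).differentiableAt.differentiableWithinAt
  have hHM : ∀ z ∈ ball (0 : ℂ) (1 / 4), ‖H z‖ ≤ 7 := by
    intro z hz
    have hz1 : z ∈ ball (0 : ℂ) 1 := ball_subset_ball (by norm_num) hz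
    have h1 := hu3 _ (hmaps z hz)
    have h2 := hu3 z hz1
    have h3 : ‖deriv f z‖ ≤ 17 / 16 := by
      rw [hf, hh.deriv_germ hz1]
      have := norm_add_le l (deriv h z)
      have := hh.bound z hz1
      linarith
    have h4 : ‖deriv f z * u z‖ ≤ 17 / 16 * 3 := by
      rw [norm_mul]
      gcongr
    have h5 := norm_sub_le (u (f z)) (deriv f z * u z)
    linarith
  have hHs : SmallPert (1 / 8) 112 H := by
    refine ⟨hHd.mono (ball_subset_ball (by norm_num)), ?_, ?_, ?_⟩
    · exact (vanishing_one.1 (vanishing_mono (by norm_num) hH2)).2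
    · exact (vanishing_one.1 (deriv_mem_vanishing hH2)).2
    · intro z hz
      have hz' : ‖z‖ < 1 / 8 := by simpa using hz
      have hsub : ball z (1 / 8) ⊆ ball 0 (1 / 4) := ball_subset_ball' (by
        rw [dist_zero_right]; linarith)
      have := norm_deriv_le_of_ball (by norm_num) (hHd.mono hsub) fun w hw => hHM w (hsub hw)
      norm_num at this
      exact this
  have h1 := lam_bound_of_gam_id (δ := 1 / 8) (κ := 1 / 16) hn hnl (by norm_num) hA (by norm_num)
    (hh.mono (by norm_num) (by norm_num)) (by norm_num) hHs
  rw [lam_coboundary hfm hfd hn hu2] at h1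
  refine h1.trans ?_
  linarith

end

/-- Geometric growth of the coefficient functionals on the identity implies geometric growth on
all bounded observables. -/
theorem exists_gamBound {l : ℂ} (hl : ‖l‖ = 1) (hnl : ∀ n, nrm l n ≠ 0) {D : ℝ} (hD : 0 < D)
    (hB : ∀ H, SmallPert 1 (1 / 8) H → ∀ n : ℕ, 1 ≤ n → ‖gam l n (germ l H) id‖ ≤ D ^ n) :
    ∃ U ≥ 0, ∀ n : ℕ, 1 ≤ n → GamBound l n 1 (1 / 16) (Real.exp (n * U)) := by
  refine ⟨Real.log (16016 * (D + 1)), Real.log_nonneg (by linarith),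
    fun n hn h hh v hv hv0 hv1 => ?_⟩
  have hfm := hh.germ_mem (l := l) one_pos
  have hva : AnalyticAt ℂ v 0 := hv.analyticAt (ball_mem_nhds _ one_pos)
  set a := deriv v 0 with ha
  have ha2 : ‖a‖ ≤ 2 := by simpa using norm_deriv_le_of_ball one_pos hv hv1
  let u : ℂ → ℂ := fun z => v z - a * z
  have hu : DifferentiableOn ℂ u (ball 0 1) := by fun_prop
  have hu2 : u ∈ vanishing 2 := by
    refine vanishing_two (by fun_prop) (by simp [u, hv0]) ?_
    have : HasDerivAt u (a - a * 1) 0 :=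
      hva.differentiableAt.hasDerivAt.sub ((hasDerivAt_id _).const_mul a)
    rw [this.deriv]
    ring
  have hu3 : ∀ z ∈ ball (0 : ℂ) 1, ‖u z‖ ≤ 3 := by
    intro z hz
    have h1 := hv1 z hz
    have h2 := norm_sub_le (v z) (a * z)
    rw [norm_mul] at h2
    rw [mem_ball_zero_iff] at hz
    have h3 : ‖a‖ * ‖z‖ ≤ 2 * 1 := by gcongr
    linarith
  have h1 := gam_bound_of_vanishing_two hl hn (hnl n)
    (fun K hK => gam_id_rescale (by norm_num) (by norm_num) hn (fun H hH => hB H hH n hn) hK)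
    hh hu hu2 hu3
  have h2 := hB h (hh.mono le_rfl (by norm_num)) n hn
  have h3 : v = a • (id : ℂ → ℂ) + u := by ext z; simp [u]
  have h4 : gam l n (germ l h) v = a * gam l n (germ l h) id + gam l n (germ l h) u := by
    conv_lhs => rw [h3]
    rw [gam_add hfm ((vanishing 1).smul_mem a id_mem_vanishing) (vanishing_mono (by norm_num) hu2),
      gam_smul hfm a id_mem_vanishing]
  rw [h4, Real.exp_nat_mul, Real.exp_log (by positivity)]
  have h5 : ‖a * gam l n (germ l h) id‖ ≤ 2 * D ^ n := by
    rw [norm_mul]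
    gcongr
  have h6 : D ^ n ≤ (D / (1 / 8)) ^ n := by
    gcongr
    rw [le_div_iff₀ (by norm_num)]
    linarith
  have h7 : (2002 : ℝ) ≤ 2002 ^ n := le_self_pow₀ (by norm_num) (by omega)
  have h8 : 2002 * (D / (1 / 8)) ^ n ≤ (16016 * (D + 1)) ^ n := by
    calc 2002 * (D / (1 / 8)) ^ n ≤ 2002 ^ n * (D / (1 / 8)) ^ n := by gcongr
      _ = (16016 * D) ^ n := by rw [← mul_pow]; ring_nf
      _ ≤ _ := by gcongr; linarith
  have h9 := norm_add_le (a * gam l n (germ l h) id) (gam l n (germ l h) u)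
  linarith

end YoccozBrjuno

namespace YoccozBrjuno

open Topology Filter Polynomial Metric

/-- A linearizing germ of a nonresonant quadratic polynomial is locally invertible. -/
theorem deriv_ne_zero_of_linearizes {l : ℂ} (hnl : ∀ n, nrm l n ≠ 0) {φ : ℂ → ℂ}
    (h : AnalyticAt ℂ φ 0) (h0 : φ 0 = 0) (hne : ¬ ∀ᶠ z in 𝓝 0, φ z = 0)
    (heq : ∀ᶠ z in 𝓝 0, l * φ z + φ z ^ 2 = φ (l * z)) : deriv φ 0 ≠ 0 := by
  obtain ⟨n, g, hg, hg0, hgφ⟩ := h.exists_eventuallyEq_pow_smul_nonzero_iff.2 hne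
  have hgφ' : φ =ᶠ[𝓝 0] fun z => z ^ n * g z := by
    filter_upwards [hgφ] with z hz
    simpa using hz
  have hn0 : n ≠ 0 := by
    rintro rfl
    have := hgφ'.self_of_nhds
    simp only [h0, pow_zero, one_mul] at this
    exact hg0 this.symm
  have hφn : φ ∈ vanishing n := ⟨g, hg, hgφ'⟩
  have hc : coef n φ = g 0 := coef_of_eventuallyEq hg hgφ'
  have hlv : (fun z => l * z) ∈ vanishing 1 := vanishing_one.2 ⟨by fun_prop, by simp⟩
  have hsq : (fun z => φ z * φ z) ∈ vanishing (n + 1) :=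
    vanishing_mono (by omega) (vanishing_mul hφn hφn)
  have h1 : coef n (φ ∘ fun z => l * z) = coef n (l • φ + fun z => φ z * φ z) := by
    refine coef_congr ?_
    filter_upwards [heq] with z hz
    simp [← hz, sq]
  rw [coef_comp hφn hlv, coef_add (h.const_smul (c := l)) (vanishing_analyticAt hsq),
    coef_smul _ h, coef_vanishing_succ hsq, hc, add_zero,
    show deriv (fun z => l * z) 0 = l by simp] at h1
  have h2 : l ^ n = l := mul_right_cancel₀ hg0 h1
  have hn1 : n = 1 := by
    by_contra hn1
    have h3 := Finset.prod_ne_zero_iff.1 (hnl n) 1 (Finset.mem_Ico.2 ⟨le_rfl, by omega⟩)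
    rw [pow_one, h2, sub_self] at h3
    exact h3 rfl
  subst hn1
  rw [coef, iteratedDeriv_one] at hc
  simp only [Nat.factorial_one, Nat.cast_one, div_one] at hc
  rwa [hc]

theorem summable_of_linearizes {θ : ℝ} (hθ : θ ∈ Set.Ioo (0 : ℝ) 1) (hirr : Irrational θ)
    {φ : ℂ → ℂ} (h : AnalyticAt ℂ φ 0) (h0 : φ 0 = 0) (hne : ¬ ∀ᶠ z in 𝓝 0, φ z = 0)
    (heq : ∀ᶠ z in 𝓝 0, rot θ * φ z + φ z ^ 2 = φ (rot θ * z)) : Summable (brjunoTerm θ) := by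
  have hl := norm_rot θ
  have hnl := nrm_rot_ne_zero hirr
  have hd := deriv_ne_zero_of_linearizes hnl h h0 hne heq
  set d := deriv φ 0
  let Φ : ℂ → ℂ := fun z => φ (d⁻¹ * z)
  have hlin : HasDerivAt (fun z : ℂ => d⁻¹ * z) d⁻¹ 0 := by
    simpa using (hasDerivAt_id (0 : ℂ)).const_mul d⁻¹
  have hd' : HasDerivAt φ d (d⁻¹ * 0) := by
    rw [mul_zero]
    exact h.differentiableAt.hasDerivAt
  have hΦa : AnalyticAt ℂ Φ 0 :=
    AnalyticAt.fun_comp (f := fun z : ℂ => d⁻¹ * z) (by rwa [mul_zero]) (by fun_prop)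
  have hΦ1 : deriv Φ 0 = 1 := by
    have : HasDerivAt Φ (d * d⁻¹) 0 := hd'.comp 0 hlin
    rw [this.deriv, mul_inv_cancel₀ hd]
  have ht : Tendsto (fun z : ℂ => d⁻¹ * z) (𝓝 0) (𝓝 0) := by
    simpa using hlin.continuousAt.tendsto
  have hΦe : ∀ᶠ z in 𝓝 0, rot θ * Φ z + Φ z ^ 2 = Φ (rot θ * z) := by
    filter_upwards [ht.eventually heq] with z hz
    simp only [Φ]
    rw [hz]
    ring_nf
  obtain ⟨D, hD, hB⟩ := exists_germ_gam_bound hl hnl hΦa (by simp [Φ, h0]) hΦ1 hΦe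
  obtain ⟨U, hU, hG⟩ := exists_gamBound hl hnl hD hB
  refine summable_of_levelBound hθ hirr hU fun n => ?_
  have h1 : (0 : ℝ) < (1 / 2) ^ n := by positivity
  have h2 : (0 : ℝ) < (1 / 2) ^ (n + 1) := by positivity
  refine (hG (cfQ θ n + 1) (by omega)).mono (by linarith) (by linarith) (le_of_eq ?_)
  push_cast
  rfl

end YoccozBrjuno

/-- Yoccoz's theorem: if the quadratic polynomial `P_θ` has a Siegel point at the
origin, then `θ` is a Brjuno number, i.e. `Φ(θ) < ∞`. -/
theorem yoccoz_brjuno_of_siegel (θ : ℝ) (hθ : θ ∈ Set.Ioo (0 : ℝ) 1)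
    (hirr : Irrational θ)
    (hSiegel : ∃ ρ : ℝ, 0 < ρ ∧ ∃ φ : ℂ → ℂ,
      Set.InjOn φ (Metric.ball (0 : ℂ) ρ) ∧
      DifferentiableOn ℂ φ (Metric.ball (0 : ℂ) ρ) ∧
      φ 0 = 0 ∧
      ∀ z ∈ Metric.ball (0 : ℂ) ρ,
        Ptheta θ (φ z) = φ (Complex.exp (2 * Real.pi * Complex.I * θ) * z)) :
    Summable (brjunoTerm θ) := by
  obtain ⟨ρ, hρ, φ, hinj, hφ, h0, heq⟩ := hSiegel
  have hball := Metric.ball_mem_nhds (0 : ℂ) hρ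
  refine YoccozBrjuno.summable_of_linearizes hθ hirr (hφ.analyticAt hball) h0 (fun hz => ?_) ?_
  · obtain ⟨z, ⟨hz, hzρ⟩, hz0⟩ := ((hz.and hball).filter_mono nhdsWithin_le_nhds
      |>.and (eventually_mem_nhdsWithin (a := (0 : ℂ)) (s := {0}ᶜ))).exists
    exact hz0 (hinj hzρ (Metric.mem_ball_self hρ) (hz.trans h0.symm))
  · filter_upwards [hball] with z hz
    rw [add_comm]
    exact heq z hz
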